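/- arXiv:2501.11446 — 7 statements merged into one kernel-verified Lean document; each statement's English description precedes it below -/
import Mathlib

section
/- Let K = 0 and h₁ ∈ (−1,1), and let (v,h) be a classical solution of the fluid–particle system on [0,∞). Then for every t ≥ 0 one has ∫_{−1}^{1} v(t,y)² dy + g(t)² ≤ exp(−t/4)·(∫_{−1}^{1} v₀(y)² dy + g₀²). -/
open Real Set MeasureTheory Filter

/-- A classical solution of the simplified fluid–particle interaction system on `[0,∞)`,
with feedback constant `K ≥ 0` and target position `h₁ ∈ (-1,1)`.
`v t y` is the fluid velocity, `h t` the particle position; `vt`, `vy`, `vyy` are the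
time derivative, the spatial derivative (for `y ≠ h t`) and the second spatial derivative
of `v`, while `vyL t`, `vyR t` are the one-sided spatial derivatives of `v t` at `y = h t`. -/
structure FluidParticleSol (K h₁ : ℝ) where
  v : ℝ → ℝ → ℝ
  h : ℝ → ℝ
  vt : ℝ → ℝ → ℝ
  vy : ℝ → ℝ → ℝ
  vyy : ℝ → ℝ → ℝ
  vyL : ℝ → ℝ
  vyR : ℝ → ℝ
  hK : 0 ≤ K
  hh₁ : h₁ ∈ Set.Ioo (-1 : ℝ) 1
  h_in : ∀ t, 0 ≤ t → h t ∈ Set.Ioo (-1 : ℝ) 1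
  h_C2 : ContDiff ℝ 2 h
  v_cont : ContinuousOn (fun p : ℝ × ℝ => v p.1 p.2) (Set.Ici 0 ×ˢ Set.Icc (-1) 1)
  hasDeriv_t : ∀ t, 0 ≤ t → ∀ y ∈ Set.Icc (-1 : ℝ) 1, HasDerivAt (fun s => v s y) (vt t y) t
  vt_cont : ∀ y ∈ Set.Icc (-1 : ℝ) 1, ContinuousOn (fun t => vt t y) (Set.Ici 0)
  hasDeriv_y : ∀ t, 0 ≤ t → ∀ y ∈ Set.Ioo (-1 : ℝ) 1, y ≠ h t →
      HasDerivAt (fun x => v t x) (vy t y) y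
  hasDeriv_yL : ∀ t, 0 ≤ t → HasDerivWithinAt (fun x => v t x) (vyL t) (Set.Iic (h t)) (h t)
  hasDeriv_yR : ∀ t, 0 ≤ t → HasDerivWithinAt (fun x => v t x) (vyR t) (Set.Ici (h t)) (h t)
  vy_contL : ∀ t, 0 ≤ t → ContinuousOn (fun y => vy t y) (Set.Ico (-1) (h t))
  vy_contR : ∀ t, 0 ≤ t → ContinuousOn (fun y => vy t y) (Set.Ioc (h t) 1)
  vy_limL : ∀ t, 0 ≤ t →
      Filter.Tendsto (fun y => vy t y) (nhdsWithin (h t) (Set.Iio (h t))) (nhds (vyL t))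
  vy_limR : ∀ t, 0 ≤ t →
      Filter.Tendsto (fun y => vy t y) (nhdsWithin (h t) (Set.Ioi (h t))) (nhds (vyR t))
  hasDeriv_yy : ∀ t, 0 ≤ t → ∀ y ∈ Set.Ioo (-1 : ℝ) 1, y ≠ h t →
      HasDerivAt (fun x => vy t x) (vyy t y) y
  pde : ∀ t, 0 ≤ t → ∀ y ∈ Set.Ioo (-1 : ℝ) 1, y ≠ h t →
      vt t y + v t y * vy t y = vyy t y
  bc_left : ∀ t, 0 ≤ t → v t (-1) = 0
  bc_right : ∀ t, 0 ≤ t → v t 1 = 0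
  ode1 : ∀ t, 0 ≤ t → deriv h t = v t (h t)
  ode2 : ∀ t, 0 ≤ t → deriv (deriv h) t = vyR t - vyL t + K * (h₁ - h t)


/-- The Gaussian density of variance `1/2`. -/
noncomputable def gaussWeight (z : ℝ) : ℝ := Real.exp (-z ^ 2) / √π

lemma gaussWeight_pos (z : ℝ) : 0 < gaussWeight z := by
  unfold gaussWeight; positivity

lemma continuous_gaussWeight : Continuous gaussWeight := by
  unfold gaussWeight; fun_prop

lemma hasDerivAt_gaussWeight (z : ℝ) : HasDerivAt gaussWeight (-(2 * (z * gaussWeight z))) z := by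
  have h1 : HasDerivAt (fun z : ℝ => -z ^ 2) (-(2 * z)) z := by
    exact ((hasDerivAt_pow 2 z).neg).congr_deriv (by simp)
  have h2 := (h1.exp).div_const (√π)
  refine h2.congr_deriv ?_
  unfold gaussWeight; ring

lemma integral_gaussWeight : ∫ z, gaussWeight z = 1 := by
  have h := integral_gaussian 1
  simp only [div_one, neg_mul, one_mul] at h
  unfold gaussWeight
  rw [integral_div, h, div_self (by positivity)]

lemma integrable_sq_add_const_mul_gaussWeight (A C : ℝ) :
    Integrable fun z => (A + C * z ^ 2) * gaussWeight z := by
  have h0 := integrable_exp_neg_mul_sq (b := 1) one_pos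
  have h2 := integrable_rpow_mul_exp_neg_mul_sq (b := 1) one_pos (s := 2) (by norm_num)
  refine ((h0.const_mul (A / √π)).add (h2.const_mul (C / √π))).congr (ae_of_all _ fun z => ?_)
  simp [gaussWeight]
  ring

lemma integrable_of_le_mul_gaussWeight {f : ℝ → ℝ} (hf : Continuous f) (A B C : ℝ)
    (hB : 0 ≤ B) (h : ∀ z, |f z| ≤ A + B * |z| + C * z ^ 2) :
    Integrable fun z => f z * gaussWeight z := by
  refine (integrable_sq_add_const_mul_gaussWeight (A + B) (B + C)).mono'
    (hf.mul continuous_gaussWeight).aestronglyMeasurable (ae_of_all _ fun z => ?_)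
  rw [Real.norm_eq_abs, abs_mul, abs_of_pos (gaussWeight_pos z)]
  refine mul_le_mul_of_nonneg_right ((h z).trans ?_) (gaussWeight_pos z).le
  have : |z| ≤ 1 + z ^ 2 := by nlinarith [sq_abs z, sq_nonneg (|z| - 1), abs_nonneg z]
  nlinarith

lemma integrable_abs_mul_gaussWeight (A B : ℝ) (hB : 0 ≤ B) :
    Integrable fun z => (A + B * |z|) * gaussWeight z := by
  refine integrable_of_le_mul_gaussWeight (by fun_prop) |A| B 0 hB fun z => ?_
  calc abs (A + B * |z|) ≤ |A| + abs (B * |z|) := abs_add_le _ _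
    _ = |A| + B * |z| + 0 * z ^ 2 := by rw [abs_mul, abs_abs, abs_of_nonneg hB]; ring

/-- Gaussian integration by parts. -/
lemma integral_mul_two_mul_gaussWeight {F F' : ℝ → ℝ} (hF : ∀ z, HasDerivAt F (F' z) z)
    (hF' : Continuous F') {A B M : ℝ} (hB : 0 ≤ B) (hM : ∀ z, |F' z| ≤ M)
    (hA : ∀ z, |F z| ≤ A + B * |z|) :
    ∫ z, F z * (2 * (z * gaussWeight z)) = ∫ z, F' z * gaussWeight z := by
  have hFc : Continuous F := continuous_iff_continuousAt.2 fun z => (hF z).continuousAt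
  have hA0 : 0 ≤ A := by have := (abs_nonneg _).trans (hA 0); simpa using this
  have e1 : Integrable (F * fun z => -(2 * (z * gaussWeight z))) := by
    have := integrable_of_le_mul_gaussWeight (f := fun z => F z * (-2 * z)) (by fun_prop)
      0 (2 * A) (2 * B) (by positivity) (fun z => by
        rw [abs_mul, abs_mul]
        have := mul_le_mul_of_nonneg_right (hA z) (abs_nonneg z)
        rw [abs_of_neg (by norm_num : (-2 : ℝ) < 0)]
        nlinarith [sq_abs z])
    refine this.congr (ae_of_all _ fun z => ?_)
    simp only [Pi.mul_apply]; ring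
  have e2 : Integrable (F' * gaussWeight) :=
    integrable_of_le_mul_gaussWeight hF' M 0 0 le_rfl (fun z => by simpa using hM z)
  have e3 : Integrable (F * gaussWeight) :=
    integrable_of_le_mul_gaussWeight hFc A B 0 hB (fun z => by simpa using hA z)
  have := integral_mul_deriv_eq_deriv_mul_of_integrable (fun z _ => hF z)
    (fun z _ => hasDerivAt_gaussWeight z) e1 e2 e3
  rw [← neg_eq_iff_eq_neg, ← integral_neg] at this
  rw [← this]
  congr 1; ext z; ring

lemma integral_two_mul_sq_mul_gaussWeight : ∫ z, 2 * z ^ 2 * gaussWeight z = 1 := by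
  have := integral_mul_two_mul_gaussWeight (F := fun z => z) (F' := fun _ => 1)
    (fun z => hasDerivAt_id z) continuous_const (A := 0) (B := 1) (M := 1) one_pos.le
    (fun z => by simp) (fun z => by simp)
  simp only [one_mul, integral_gaussWeight] at this
  rw [← this]
  congr 1; ext z; ring

/-- The heat evolution `w_s = w_yy` on the line at time `s`, with initial datum `U`. -/
noncomputable def heatFlow (U : ℝ → ℝ) (s y : ℝ) : ℝ :=
  ∫ z, U (y + 2 * √s * z) * gaussWeight z

/-- The spatial derivative of `heatFlow p s`, for continuous bounded `p` and `0 < s`. -/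
noncomputable def heatFlowDeriv (p : ℝ → ℝ) (s y : ℝ) : ℝ :=
  (√s)⁻¹ * ∫ z, p (y + 2 * √s * z) * (z * gaussWeight z)

lemma heatFlow_zero (U : ℝ → ℝ) (y : ℝ) : heatFlow U 0 y = U y := by
  simp [heatFlow, integral_const_mul, integral_gaussWeight]

lemma continuous_heatFlow {q : ℝ → ℝ} (hq : Continuous q) {A B : ℝ} (hB : 0 ≤ B)
    (h : ∀ x, |q x| ≤ A + B * |x|) : Continuous fun P : ℝ × ℝ => heatFlow q P.1 P.2 := by
  refine continuous_iff_continuousAt.2 fun P => ?_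
  unfold heatFlow
  have hG := continuous_gaussWeight
  refine continuousAt_of_dominated
    (bound := fun z => (A + B * (|P.2| + 1) + (B * (2 * (√P.1 + 1))) * |z|) * gaussWeight z)
    (Eventually.of_forall fun Q => (by fun_prop)) ?_
    (integrable_abs_mul_gaussWeight _ _ (by positivity))
    (ae_of_all _ fun z => (by fun_prop))
  have e1 : ∀ᶠ Q : ℝ × ℝ in nhds P, √Q.1 < √P.1 + 1 :=
    (by fun_prop : ContinuousAt (fun Q : ℝ × ℝ => √Q.1) P).eventually_lt continuousAt_const
      (by simp)
  have e2 : ∀ᶠ Q : ℝ × ℝ in nhds P, |Q.2| < |P.2| + 1 :=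
    (by fun_prop : ContinuousAt (fun Q : ℝ × ℝ => |Q.2|) P).eventually_lt continuousAt_const
      (by simp)
  filter_upwards [e1, e2] with Q h1 h2
  refine ae_of_all _ fun z => ?_
  rw [Real.norm_eq_abs, abs_mul, abs_of_pos (gaussWeight_pos z)]
  refine mul_le_mul_of_nonneg_right ((h _).trans ?_) (gaussWeight_pos z).le
  have h3 : |Q.2 + 2 * √Q.1 * z| ≤ (|P.2| + 1) + 2 * (√P.1 + 1) * |z| := by
    refine (abs_add_le _ _).trans ?_
    rw [abs_mul, abs_of_nonneg (by positivity : 0 ≤ 2 * √Q.1)]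
    gcongr
  nlinarith [mul_le_mul_of_nonneg_left h3 hB]

lemma abs_heatFlow_le {p : ℝ → ℝ} {M : ℝ} (hM : ∀ x, |p x| ≤ M) (s y : ℝ) :
    |heatFlow p s y| ≤ M := by
  have h := norm_integral_le_of_norm_le (f := fun z => p (y + 2 * √s * z) * gaussWeight z)
    (by simpa using integrable_abs_mul_gaussWeight M 0 le_rfl) (ae_of_all _ fun z => by
      rw [Real.norm_eq_abs, abs_mul, abs_of_pos (gaussWeight_pos z)]
      exact mul_le_mul_of_nonneg_right (hM _) (gaussWeight_pos z).le)
  rwa [integral_const_mul, integral_gaussWeight, mul_one] at h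

lemma heatFlow_eq_of_odd {U : ℝ → ℝ} (hU : Continuous U) {A B : ℝ} (hB : 0 ≤ B)
    (h : ∀ x, |U x| ≤ A + B * |x|) {a : ℝ}
    (hodd : ∀ x, U (a + x) + U (a - x) = 2 * U a) (s : ℝ) : heatFlow U s a = U a := by
  have hUint : ∀ c : ℝ, Integrable fun z => U (a + c * z) * gaussWeight z := fun c =>
    integrable_of_le_mul_gaussWeight (by fun_prop) (A + B * |a|) (B * |c|) 0 (by positivity)
      fun z => by
        refine (h _).trans ?_
        have := abs_add_le a (c * z)
        rw [abs_mul] at this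
        nlinarith [mul_le_mul_of_nonneg_left this hB]
  have h1 : heatFlow U s a = ∫ z, U (a + (-(2 * √s)) * z) * gaussWeight z := by
    unfold heatFlow
    rw [← integral_neg_eq_self]
    congr 1; ext z
    simp [gaussWeight]
  have h2 : heatFlow U s a + heatFlow U s a = 2 * U a := by
    nth_rw 2 [h1]
    unfold heatFlow
    rw [← integral_add (hUint _) (hUint _), ← mul_one (2 * U a), ← integral_gaussWeight,
      ← integral_const_mul]
    congr 1; ext z
    rw [← hodd (2 * √s * z)]
    ring_nf
  linarith

section HeatFlow

variable {U p : ℝ → ℝ} {M : ℝ}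

lemma abs_le_of_hasDerivAt_bounded (hU : ∀ x, HasDerivAt U (p x) x) (hM : ∀ x, |p x| ≤ M)
    (x : ℝ) : |U x| ≤ |U 0| + M * |x| := by
  have h := Convex.norm_image_sub_le_of_norm_hasDerivWithin_le (f := U) (f' := p) (C := M)
    (s := univ) (fun x _ => (hU x).hasDerivWithinAt) (fun x _ => hM x) convex_univ
    (mem_univ 0) (mem_univ x)
  simp only [Real.norm_eq_abs, sub_zero] at h
  have := abs_sub_abs_le_abs_sub (U x) (U 0)
  linarith

variable (hU : ∀ x, HasDerivAt U (p x) x) (hp : Continuous p) (hM : ∀ x, |p x| ≤ M)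
include hU hp hM

lemma hasDerivAt_heatFlow (s y : ℝ) :
    HasDerivAt (fun x => heatFlow U s x) (heatFlow p s y) y := by
  have hM0 : 0 ≤ M := (abs_nonneg _).trans (hM 0)
  have hUc : Continuous U := continuous_iff_continuousAt.2 fun z => (hU z).continuousAt
  have hG := continuous_gaussWeight
  refine (hasDerivAt_integral_of_dominated_loc_of_deriv_le (s := univ)
    (bound := fun z => (M + 0 * |z|) * gaussWeight z) (F := fun x z => U (x + 2 * √s * z) * gaussWeight z)
    (F' := fun x z => p (x + 2 * √s * z) * gaussWeight z) univ_mem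
    (Eventually.of_forall fun x => (by fun_prop)) ?_ (by fun_prop) ?_
    (integrable_abs_mul_gaussWeight M 0 le_rfl) ?_).2
  · refine integrable_of_le_mul_gaussWeight (by fun_prop) (|U 0| + M * |y|) (M * (2 * √s)) 0
      (by positivity) fun z => ?_
    refine (abs_le_of_hasDerivAt_bounded hU hM _).trans ?_
    have := abs_add_le y (2 * √s * z)
    rw [abs_mul, abs_of_nonneg (by positivity : 0 ≤ 2 * √s)] at this
    nlinarith [mul_le_mul_of_nonneg_left this hM0]
  · refine ae_of_all _ fun z x _ => ?_
    rw [Real.norm_eq_abs, abs_mul, abs_of_pos (gaussWeight_pos z)]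
    exact mul_le_mul_of_nonneg_right (by simpa using hM _) (gaussWeight_pos z).le
  · refine ae_of_all _ fun z x _ => ?_
    exact ((hU _).comp_add_const x _).mul_const _

lemma heatFlow_eq_integral_mul_id {s : ℝ} (hs : 0 < s) (y : ℝ) :
    heatFlow p s y = (√s)⁻¹ * ∫ z, U (y + 2 * √s * z) * (z * gaussWeight z) := by
  have hM0 : 0 ≤ M := (abs_nonneg _).trans (hM 0)
  have hs' : √s ≠ 0 := (Real.sqrt_pos.2 hs).ne'
  have h := integral_mul_two_mul_gaussWeight (F := fun z => U (y + 2 * √s * z))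
    (F' := fun z => p (y + 2 * √s * z) * (2 * √s)) (fun z => by
      have := (hU (y + 2 * √s * z)).comp z (((hasDerivAt_id z).const_mul (2 * √s)).const_add y)
      exact this.congr_deriv (by simp)) (by fun_prop) (A := |U 0| + M * |y|) (B := M * (2 * √s))
      (M := M * (2 * √s)) (by positivity)
      (fun z => by
        rw [abs_mul, abs_of_nonneg (by positivity : 0 ≤ 2 * √s)]
        exact mul_le_mul_of_nonneg_right (hM _) (by positivity))
      (fun z => by
        refine (abs_le_of_hasDerivAt_bounded hU hM _).trans ?_
        have := abs_add_le y (2 * √s * z)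
        rw [abs_mul, abs_of_nonneg (by positivity : 0 ≤ 2 * √s)] at this
        nlinarith [mul_le_mul_of_nonneg_left this hM0])
  have h1 : ∫ z, p (y + 2 * √s * z) * (2 * √s) * gaussWeight z = (2 * √s) * heatFlow p s y := by
    unfold heatFlow; rw [← integral_const_mul]; congr 1; ext z; ring
  have h2 : ∫ z, U (y + 2 * √s * z) * (2 * (z * gaussWeight z))
      = 2 * ∫ z, U (y + 2 * √s * z) * (z * gaussWeight z) := by
    rw [← integral_const_mul]; congr 1; ext z; ring
  rw [h1, h2] at h
  rw [eq_inv_mul_iff_mul_eq₀ hs']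
  linarith

lemma hasDerivAt_heatFlow_deriv {s : ℝ} (hs : 0 < s) (y : ℝ) :
    HasDerivAt (fun x => heatFlow p s x) (heatFlowDeriv p s y) y := by
  have hM0 : 0 ≤ M := (abs_nonneg _).trans (hM 0)
  have hUc : Continuous U := continuous_iff_continuousAt.2 fun z => (hU z).continuousAt
  have hG := continuous_gaussWeight
  have : (fun x => heatFlow p s x)
      = fun x => (√s)⁻¹ * ∫ z, U (x + 2 * √s * z) * (z * gaussWeight z) :=
    funext fun x => heatFlow_eq_integral_mul_id hU hp hM hs x
  rw [this]
  refine HasDerivAt.const_mul _ (hasDerivAt_integral_of_dominated_loc_of_deriv_le (s := univ)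
    (bound := fun z => (0 + M * |z|) * gaussWeight z)
    (F := fun x z => U (x + 2 * √s * z) * (z * gaussWeight z))
    (F' := fun x z => p (x + 2 * √s * z) * (z * gaussWeight z)) univ_mem
    (Eventually.of_forall fun x => (by fun_prop)) ?_ (by fun_prop) ?_
    (integrable_abs_mul_gaussWeight 0 M hM0) ?_).2
  · simp_rw [← mul_assoc]
    refine integrable_of_le_mul_gaussWeight (by fun_prop) 0 (|U 0| + M * |y|) (M * (2 * √s))
      (by positivity) fun z => ?_
    have h1 := abs_le_of_hasDerivAt_bounded hU hM (y + 2 * √s * z)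
    have h2 := abs_add_le y (2 * √s * z)
    rw [abs_mul (2 * √s), abs_of_nonneg (by positivity : 0 ≤ 2 * √s)] at h2
    have h3 : |U (y + 2 * √s * z)| ≤ |U 0| + M * |y| + M * (2 * √s) * |z| := by
      nlinarith [mul_le_mul_of_nonneg_left h2 hM0]
    rw [abs_mul]
    have h4 := mul_le_mul_of_nonneg_right h3 (abs_nonneg z)
    rw [← sq_abs z]
    linarith
  · refine ae_of_all _ fun z x _ => ?_
    rw [Real.norm_eq_abs, abs_mul, abs_mul, abs_of_pos (gaussWeight_pos z), ← mul_assoc]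
    refine mul_le_mul_of_nonneg_right ?_ (gaussWeight_pos z).le
    simpa using mul_le_mul_of_nonneg_right (hM _) (abs_nonneg z)
  · refine ae_of_all _ fun z x _ => ?_
    exact ((hU _).comp_add_const x _).mul_const _

lemma hasDerivAt_heatFlow_time {s : ℝ} (hs : 0 < s) (y : ℝ) :
    HasDerivAt (fun r => heatFlow U r y) (heatFlowDeriv p s y) s := by
  have hM0 : 0 ≤ M := (abs_nonneg _).trans (hM 0)
  have hUc : Continuous U := continuous_iff_continuousAt.2 fun z => (hU z).continuousAt
  have hG := continuous_gaussWeight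
  have key := (hasDerivAt_integral_of_dominated_loc_of_deriv_le (s := Ioi (s / 2)) (x₀ := s)
    (μ := volume)
    (bound := fun z => (0 + M * (√(s / 2))⁻¹ * |z|) * gaussWeight z)
    (F := fun r z => U (y + 2 * √r * z) * gaussWeight z)
    (F' := fun r z => (√r)⁻¹ * (p (y + 2 * √r * z) * (z * gaussWeight z)))
    (Ioi_mem_nhds (by linarith))
    (Eventually.of_forall fun x => (by fun_prop)) ?_ (by fun_prop) ?_
    (integrable_abs_mul_gaussWeight _ _ (by positivity)) ?_).2
  · rw [integral_const_mul] at key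
    exact key
  · refine integrable_of_le_mul_gaussWeight (by fun_prop) (|U 0| + M * |y|) (M * (2 * √s)) 0
      (by positivity) fun z => ?_
    refine (abs_le_of_hasDerivAt_bounded hU hM _).trans ?_
    have := abs_add_le y (2 * √s * z)
    rw [abs_mul, abs_of_nonneg (by positivity : 0 ≤ 2 * √s)] at this
    nlinarith [mul_le_mul_of_nonneg_left this hM0]
  · refine ae_of_all _ fun z r hr => ?_
    have hr' : s / 2 < r := hr
    have h1 : (√r)⁻¹ ≤ (√(s / 2))⁻¹ :=
      inv_anti₀ (Real.sqrt_pos.2 (by linarith)) (Real.sqrt_le_sqrt hr'.le)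
    rw [Real.norm_eq_abs, abs_mul, abs_mul, abs_mul, abs_of_pos (gaussWeight_pos z), ← mul_assoc,
      ← mul_assoc, abs_of_nonneg (by positivity : 0 ≤ (√r)⁻¹)]
    refine mul_le_mul_of_nonneg_right ?_ (gaussWeight_pos z).le
    rw [zero_add, mul_comm M]
    gcongr
    exact hM _
  · refine ae_of_all _ fun z r hr => ?_
    have hr' : 0 < r := by have : s / 2 < r := hr; linarith
    have h1 : HasDerivAt (fun r => y + 2 * √r * z) ((√r)⁻¹ * z) r := by
      have := (((Real.hasDerivAt_sqrt hr'.ne').const_mul 2).mul_const z).const_add y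
      refine this.congr_deriv ?_
      field_simp
    refine (((hU _).comp r h1).mul_const _).congr_deriv ?_
    ring

omit hU in
lemma continuous_heatFlowDeriv (s : ℝ) : Continuous fun y => heatFlowDeriv p s y := by
  have hG := continuous_gaussWeight
  have hM0 : 0 ≤ M := (abs_nonneg _).trans (hM 0)
  unfold heatFlowDeriv
  refine continuous_const.mul (continuous_of_dominated
    (bound := fun z => (0 + M * |z|) * gaussWeight z) (fun y => by fun_prop) (fun y => ?_)
    (integrable_abs_mul_gaussWeight 0 M hM0) (ae_of_all _ fun z => by fun_prop))
  refine ae_of_all _ fun z => ?_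
  rw [Real.norm_eq_abs, abs_mul, abs_mul, abs_of_pos (gaussWeight_pos z), ← mul_assoc]
  refine mul_le_mul_of_nonneg_right ?_ (gaussWeight_pos z).le
  simpa using mul_le_mul_of_nonneg_right (hM _) (abs_nonneg z)

omit hU hp in
lemma exists_abs_heatFlowDeriv_le :
    ∃ c, 0 ≤ c ∧ ∀ s y, |heatFlowDeriv p s y| ≤ (√s)⁻¹ * c := by
  have hM0 : 0 ≤ M := (abs_nonneg _).trans (hM 0)
  refine ⟨∫ z, (0 + M * |z|) * gaussWeight z, integral_nonneg fun z => ?_, fun s y => ?_⟩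
  · have := gaussWeight_pos z
    simp only [Pi.zero_apply]; positivity
  · unfold heatFlowDeriv
    rw [abs_mul, abs_of_nonneg (by positivity : 0 ≤ (√s)⁻¹)]
    refine mul_le_mul_of_nonneg_left ?_ (by positivity)
    refine norm_integral_le_of_norm_le (f := fun z => p (y + 2 * √s * z) * (z * gaussWeight z))
      (integrable_abs_mul_gaussWeight 0 M hM0) (ae_of_all _ fun z => ?_)
    rw [Real.norm_eq_abs, abs_mul, abs_mul, abs_of_pos (gaussWeight_pos z), ← mul_assoc]
    refine mul_le_mul_of_nonneg_right ?_ (gaussWeight_pos z).le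
    simpa using mul_le_mul_of_nonneg_right (hM _) (abs_nonneg z)

omit hU in
lemma tendsto_heatFlowDeriv {y q : ℝ} (hq : HasDerivAt p q y) :
    Tendsto (fun s => heatFlowDeriv p s y) (nhdsWithin 0 (Ioi 0)) (nhds q) := by
  have hM0 : 0 ≤ M := (abs_nonneg _).trans (hM 0)
  have hG := continuous_gaussWeight
  obtain ⟨C, hC0, hC⟩ : ∃ C, 0 ≤ C ∧ ∀ x, |p x - p y| ≤ C * |x - y| := by
    have h1 := hq.differentiableAt.isBigO_sub
    obtain ⟨c, hc⟩ := h1.bound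
    obtain ⟨r, hr, hball⟩ := Metric.eventually_nhds_iff.1 hc
    refine ⟨max (max c 0) (2 * M / r), le_max_of_le_left (le_max_right _ _), fun x => ?_⟩
    by_cases hx : dist x y < r
    · refine (hball hx).trans ?_
      rw [Real.norm_eq_abs]
      gcongr
      exact (le_max_left c 0).trans (le_max_left _ _)
    · rw [Real.dist_eq, not_lt] at hx
      have h2 : |p x - p y| ≤ 2 * M := by
        have := abs_sub (p x) (p y)
        linarith [hM x, hM y]
      refine h2.trans ?_
      calc 2 * M = 2 * M / r * r := by field_simp
        _ ≤ max (max c 0) (2 * M / r) * |x - y| := by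
          gcongr
          exact le_max_right _ _
  have hUint : Integrable fun z => z * gaussWeight z :=
    integrable_of_le_mul_gaussWeight continuous_id 0 1 0 one_pos.le (fun z => by simp)
  have hodd : ∫ z, z * gaussWeight z = 0 := by
    have : ∫ z, z * gaussWeight z = -∫ z, z * gaussWeight z := by
      refine (integral_neg_eq_self (fun z => z * gaussWeight z) volume).symm.trans ?_
      rw [← integral_neg]
      congr 1; ext z; simp [gaussWeight]
    linarith
  have hEq : ∀ s, 0 < s → heatFlowDeriv p s y
      = ∫ z, (√s)⁻¹ * ((p (y + 2 * √s * z) - p y) * (z * gaussWeight z)) := by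
    intro s hs
    unfold heatFlowDeriv
    rw [integral_const_mul]
    congr 1
    have h1 : Integrable fun z => p (y + 2 * √s * z) * (z * gaussWeight z) := by
      simp_rw [← mul_assoc]
      refine integrable_of_le_mul_gaussWeight (by fun_prop) 0 M 0 hM0 fun z => ?_
      rw [abs_mul]
      nlinarith [mul_le_mul_of_nonneg_right (hM (y + 2 * √s * z)) (abs_nonneg z)]
    simp_rw [sub_mul]
    rw [integral_sub h1 (hUint.const_mul _), integral_const_mul, hodd, mul_zero, sub_zero]
  have hlim : ∫ z, q * (2 * z ^ 2 * gaussWeight z) = q := by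
    rw [integral_const_mul, integral_two_mul_sq_mul_gaussWeight, mul_one]
  rw [← hlim]
  refine Tendsto.congr' (f₁ := fun s =>
      ∫ z, (√s)⁻¹ * ((p (y + 2 * √s * z) - p y) * (z * gaussWeight z))) ?_ ?_
  · filter_upwards [self_mem_nhdsWithin] with s hs using (hEq s hs).symm
  refine tendsto_integral_filter_of_dominated_convergence
    (fun z => (0 + 2 * C * z ^ 2) * gaussWeight z)
    (Eventually.of_forall fun s => by fun_prop) ?_
    (integrable_sq_add_const_mul_gaussWeight _ _) (ae_of_all _ fun z => ?_)
  · filter_upwards [self_mem_nhdsWithin] with s hs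
    have hs' : 0 < √s := Real.sqrt_pos.2 hs
    refine ae_of_all _ fun z => ?_
    rw [Real.norm_eq_abs, abs_mul, abs_mul, abs_mul, abs_of_pos (gaussWeight_pos z),
      abs_of_pos (inv_pos.2 hs')]
    have h1 := hC (y + 2 * √s * z)
    rw [add_sub_cancel_left, abs_mul, abs_of_pos (by positivity : 0 < 2 * √s)] at h1
    calc (√s)⁻¹ * (|p (y + 2 * √s * z) - p y| * (|z| * gaussWeight z))
        ≤ (√s)⁻¹ * (C * (2 * √s * |z|) * (|z| * gaussWeight z)) := by
          have := gaussWeight_pos z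
          gcongr
      _ = (0 + 2 * C * |z| ^ 2) * gaussWeight z := by field_simp; ring
      _ = _ := by rw [sq_abs]
  · by_cases hz : z = 0
    · subst hz; simp
    · have h1 : Tendsto (fun s : ℝ => y + 2 * √s * z) (nhdsWithin 0 (Ioi 0)) (nhdsWithin y {y}ᶜ) := by
        refine tendsto_nhdsWithin_iff.2 ⟨?_, ?_⟩
        · have : ContinuousAt (fun s : ℝ => y + 2 * √s * z) 0 := by fun_prop
          have h := this.tendsto
          simp only [Real.sqrt_zero, mul_zero, zero_mul, add_zero] at h
          exact h.mono_left nhdsWithin_le_nhds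
        · filter_upwards [self_mem_nhdsWithin] with s hs
          have hs' : 0 < √s := Real.sqrt_pos.2 hs
          simp [hs'.ne', hz]
      have h2 := (hasDerivAt_iff_tendsto_slope.1 hq).comp h1
      have h3 := h2.mul_const (2 * z ^ 2 * gaussWeight z)
      refine h3.congr' ?_
      filter_upwards [self_mem_nhdsWithin] with s hs
      have hs' : 0 < √s := Real.sqrt_pos.2 hs
      simp only [Function.comp, slope_def_field]
      rw [add_sub_cancel_left]
      field_simp

end HeatFlow

/-- A function that is `C¹` on `[a, b]` extends to a `C¹` function on the line with bounded
derivative that is odd about `(a, f a)` and about `(b, f b)`. -/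
lemma exists_odd_extension {a b : ℝ} (hab : a < b) {f φ : ℝ → ℝ}
    (hf : ContinuousOn f (Icc a b)) (hφ : ContinuousOn φ (Icc a b))
    (hfφ : ∀ x ∈ Ioo a b, HasDerivAt f (φ x) x) :
    ∃ U p : ℝ → ℝ, ∃ M : ℝ, Continuous p ∧ (∀ x, |p x| ≤ M) ∧ (∀ x, HasDerivAt U (p x) x) ∧
      EqOn U f (Icc a b) ∧ EqOn p φ (Icc a b) ∧
      (∀ x, U (a + x) + U (a - x) = 2 * U a) ∧ ∀ x, U (b + x) + U (b - x) = 2 * U b := by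
  have hba : 0 < b - a := sub_pos.2 hab
  have hπ := Real.pi_pos
  set fold : ℝ → ℝ := fun x => a + (b - a) / π * Real.arccos (Real.cos (π / (b - a) * (x - a)))
    with hfold
  have hfold_cont : Continuous fold := by
    have := Real.continuous_arccos
    fun_prop
  have hfold_mem : ∀ x, fold x ∈ Icc a b := by
    intro x
    have h0 := Real.arccos_nonneg (Real.cos (π / (b - a) * (x - a)))
    have h1 := Real.arccos_le_pi (Real.cos (π / (b - a) * (x - a)))
    have h2 : 0 ≤ (b - a) / π := by positivity
    have h3 : (b - a) / π * π = b - a := by field_simp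
    refine ⟨?_, ?_⟩
    · have := mul_nonneg h2 h0
      simp only [hfold]; linarith
    · have := mul_le_mul_of_nonneg_left h1 h2
      simp only [hfold]; linarith
  have hfold_id : ∀ x ∈ Icc a b, fold x = x := by
    intro x hx
    have h1 : 0 ≤ π / (b - a) * (x - a) := mul_nonneg (by positivity) (sub_nonneg.2 hx.1)
    have h2 : π / (b - a) * (x - a) ≤ π := by
      calc π / (b - a) * (x - a) ≤ π / (b - a) * (b - a) := by gcongr; exact hx.2
        _ = π := by field_simp
    simp only [hfold]
    rw [Real.arccos_cos h1 h2]
    field_simp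
    ring
  have hfold_a : ∀ x, fold (a - x) = fold (a + x) := by
    intro x
    simp only [hfold]
    rw [← Real.cos_neg]
    ring_nf
  have hfold_b : ∀ x, fold (b - x) = fold (b + x) := by
    intro x
    simp only [hfold]
    have e1 : π / (b - a) * (b - x - a) = π - π / (b - a) * x := by field_simp; ring
    have e2 : π / (b - a) * (b + x - a) = π / (b - a) * x + π := by field_simp; ring
    rw [e1, e2, Real.cos_pi_sub, Real.cos_add_pi]
  set p : ℝ → ℝ := fun x => φ (fold x) with hp
  have hpc : Continuous p := hφ.comp_continuous hfold_cont hfold_mem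
  obtain ⟨M, hM⟩ := isCompact_Icc.exists_bound_of_continuousOn hφ
  set U : ℝ → ℝ := fun x => f a + ∫ t in a..x, p t with hU
  have hUd : ∀ x, HasDerivAt U (p x) x := fun x =>
    ((hpc.integral_hasStrictDerivAt a x).hasDerivAt).const_add (f a)
  have hodd : ∀ c, (∀ x, p (c - x) = p (c + x)) → ∀ x, U (c + x) + U (c - x) = 2 * U c := by
    intro c hc x
    have hconst : ∀ x, HasDerivAt (fun x => U (c + x) + U (c - x)) 0 x := by
      intro x
      have h1 := (hUd (c + x)).comp_const_add c x
      have h2 := (hUd (c - x)).comp_const_sub c x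
      exact (h1.add h2).congr_deriv (by rw [hc]; ring)
    have := is_const_of_deriv_eq_zero (fun x => (hconst x).differentiableAt)
      (fun x => (hconst x).deriv) x 0
    simp only [add_zero, sub_zero] at this
    linarith
  refine ⟨U, p, M, hpc, fun x => hM _ (hfold_mem x), hUd, fun x hx => ?_, fun x hx => ?_,
    hodd a fun x => ?_, hodd b fun x => ?_⟩
  · have : ∫ t in a..x, p t = f x - f a :=
      intervalIntegral.integral_eq_sub_of_hasDerivAt_of_le hx.1
        (hf.mono (Icc_subset_Icc_right hx.2))
        (fun y hy => by
          have hy' : y ∈ Ioo a b := ⟨hy.1, hy.2.trans_le hx.2⟩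
          simp only [hp]
          rw [hfold_id y (Ioo_subset_Icc_self hy')]
          exact hfφ y hy')
        (hpc.intervalIntegrable _ _)
    simp only [hU, this]
    ring
  · simp only [hp, hfold_id x hx]
  · simp only [hp, hfold_a]
  · simp only [hp, hfold_b]

lemma sq_integral_le {p : ℝ → ℝ} (hp : Continuous p) {a b : ℝ} (hab : a ≤ b) :
    (∫ x in a..b, p x) ^ 2 ≤ (b - a) * ∫ x in a..b, p x ^ 2 := by
  rcases hab.eq_or_lt with rfl | hlt
  · simp
  set I := ∫ x in a..b, p x
  set J := ∫ x in a..b, p x ^ 2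
  have hL : 0 < b - a := sub_pos.2 hlt
  have h0 : 0 ≤ ∫ x in a..b, ((b - a) * p x - I) ^ 2 :=
    intervalIntegral.integral_nonneg hab fun x _ => sq_nonneg _
  have h1 : ∫ x in a..b, ((b - a) * p x - I) ^ 2
      = (b - a) ^ 2 * J - 2 * (b - a) * I * I + I ^ 2 * (b - a) := by
    have e : ∀ x, ((b - a) * p x - I) ^ 2
        = (b - a) ^ 2 * p x ^ 2 - 2 * (b - a) * I * p x + I ^ 2 := fun x => by ring
    simp_rw [e]
    rw [intervalIntegral.integral_add (Continuous.intervalIntegrable (by fun_prop) _ _)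
        (Continuous.intervalIntegrable (by fun_prop) _ _),
      intervalIntegral.integral_sub (Continuous.intervalIntegrable (by fun_prop) _ _)
        (Continuous.intervalIntegrable (by fun_prop) _ _),
      intervalIntegral.integral_const_mul, intervalIntegral.integral_const_mul,
      intervalIntegral.integral_const, smul_eq_mul]
    ring
  rw [h1] at h0
  have h2 : 0 ≤ (b - a) * ((b - a) * J - I ^ 2) := by nlinarith
  have := nonneg_of_mul_nonneg_right h2 hL
  linarith

lemma IsLocalMax.second_deriv_nonpos {f f' : ℝ → ℝ} {f'' x : ℝ} (hmax : IsLocalMax f x)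
    (hf : ∀ᶠ y in nhds x, HasDerivAt f (f' y) y) (hf' : HasDerivAt f' f'' x) : f'' ≤ 0 := by
  by_contra! hpos
  have hd : deriv f =ᶠ[nhds x] f' := hf.mono fun y hy => hy.deriv
  have hdd : deriv (deriv f) x = f'' := by rw [hd.deriv_eq]; exact hf'.deriv
  have hmin := isLocalMin_of_deriv_deriv_pos (by rw [hdd]; exact hpos) hmax.deriv_eq_zero
    hf.self_of_nhds.continuousAt
  have hconst : f =ᶠ[nhds x] fun _ => f x := by
    filter_upwards [hmax, hmin] with y h1 h2 using le_antisymm h1 h2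
  have : deriv (deriv f) x = 0 := by
    have h := hconst.deriv.deriv_eq
    simpa using h
  linarith [hdd ▸ this]

lemma HasDerivAt.nonneg_of_left_max {f : ℝ → ℝ} {f' x : ℝ} (hf : HasDerivAt f f' x)
    (hmax : ∀ᶠ y in nhdsWithin x (Iio x), f y ≤ f x) : 0 ≤ f' := by
  have h := (hasDerivAt_iff_tendsto_slope.1 hf).mono_left
    (nhdsWithin_mono x (s := Iio x) (fun y hy => ne_of_lt hy))
  refine ge_of_tendsto h ?_
  filter_upwards [hmax, self_mem_nhdsWithin] with y hy hyx
  rw [slope_def_field]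
  have : y - x < 0 := sub_neg.2 hyx
  exact div_nonneg_of_nonpos (by linarith) this.le

/-- One-sided parabolic comparison on a region with moving lateral boundary. -/
lemma parabolic_comparison_upper {α β : ℝ → ℝ} {D Dt Dy Dyy : ℝ → ℝ → ℝ} {C : ℝ}
    (hα : Continuous α) (hβ : Continuous β)
    (hD : ContinuousOn (fun P : ℝ × ℝ => D P.1 P.2)
      {P | P.1 ∈ Icc (0 : ℝ) 1 ∧ P.2 ∈ Icc (α P.1) (β P.1)})
    (hDt : ∀ s ∈ Ioc (0 : ℝ) 1, ∀ y ∈ Ioo (α s) (β s), HasDerivAt (fun r => D r y) (Dt s y) s)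
    (hDy : ∀ s ∈ Ioc (0 : ℝ) 1, ∀ y ∈ Ioo (α s) (β s), HasDerivAt (fun x => D s x) (Dy s y) y)
    (hDyy : ∀ s ∈ Ioc (0 : ℝ) 1, ∀ y ∈ Ioo (α s) (β s), HasDerivAt (fun x => Dy s x) (Dyy s y) y)
    (hsub : ∀ s ∈ Ioc (0 : ℝ) 1, ∀ y ∈ Ioo (α s) (β s), Dy s y = 0 → Dt s y - Dyy s y < C)
    (h0 : ∀ y ∈ Icc (α 0) (β 0), D 0 y ≤ 0)
    (hleft : ∀ s ∈ Icc (0 : ℝ) 1, D s (α s) ≤ C * s)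
    (hright : ∀ s ∈ Icc (0 : ℝ) 1, D s (β s) ≤ C * s) :
    ∀ s ∈ Icc (0 : ℝ) 1, ∀ y ∈ Icc (α s) (β s), D s y ≤ C * s := by
  intro s₁ hs₁ y₁ hy₁
  set R : Set (ℝ × ℝ) := {P | P.1 ∈ Icc (0 : ℝ) 1 ∧ P.2 ∈ Icc (α P.1) (β P.1)} with hR
  have hRc : IsCompact R := by
    obtain ⟨A, hA⟩ := isCompact_Icc.exists_bound_of_continuousOn (hα.continuousOn (s := Icc 0 1))
    obtain ⟨B, hB⟩ := isCompact_Icc.exists_bound_of_continuousOn (hβ.continuousOn (s := Icc 0 1))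
    refine ((isCompact_Icc (a := (0 : ℝ)) (b := 1)).prod (isCompact_Icc (a := -A) (b := B))).of_isClosed_subset ?_ ?_
    · have e : R = {P | 0 ≤ P.1} ∩ {P | P.1 ≤ 1} ∩ {P | α P.1 ≤ P.2} ∩ {P | P.2 ≤ β P.1} := by
        ext P; simp [hR, and_assoc]
      rw [e]
      exact (((isClosed_le (by fun_prop) (by fun_prop)).inter
        (isClosed_le (by fun_prop) (by fun_prop))).inter
        (isClosed_le (by fun_prop) (by fun_prop))).inter (isClosed_le (by fun_prop) (by fun_prop))
    · rintro P ⟨h1, h2⟩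
      refine ⟨h1, ?_, ?_⟩
      · exact (abs_le.1 (hA _ h1)).1.trans h2.1
      · exact h2.2.trans (abs_le.1 (hB _ h1)).2
  have hΦ : ContinuousOn (fun P : ℝ × ℝ => D P.1 P.2 - C * P.1) R :=
    hD.sub (by fun_prop)
  obtain ⟨⟨s, y⟩, ⟨hs, hy⟩, hmax⟩ := hRc.exists_isMaxOn ⟨(s₁, y₁), hs₁, hy₁⟩ hΦ
  have hmax' : ∀ s' ∈ Icc (0 : ℝ) 1, ∀ y' ∈ Icc (α s') (β s'),
      D s' y' - C * s' ≤ D s y - C * s := fun s' h1 y' h2 => hmax (a := (s', y')) ⟨h1, h2⟩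
  suffices h : D s y - C * s ≤ 0 by linarith [hmax' s₁ hs₁ y₁ hy₁]
  simp only at hs hy
  rcases hs.1.eq_or_lt with rfl | hs0
  · simpa using h0 y hy
  rcases hy.1.eq_or_lt with rfl | hyl
  · linarith [hleft s hs]
  rcases hy.2.eq_or_lt with rfl | hyr
  · linarith [hright s hs]
  exfalso
  have hs' : s ∈ Ioc (0 : ℝ) 1 := ⟨hs0, hs.2⟩
  have hlm : IsLocalMax (fun x => D s x) y := by
    filter_upwards [Ioo_mem_nhds hyl hyr] with x hx
    linarith [hmax' s hs x (Ioo_subset_Icc_self hx)]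
  have hy0 : Dy s y = 0 := hlm.hasDerivAt_eq_zero (hDy s hs' y ⟨hyl, hyr⟩)
  have hyy : Dyy s y ≤ 0 := hlm.second_deriv_nonpos
    (by filter_upwards [Ioo_mem_nhds hyl hyr] with x hx using hDy s hs' x hx)
    (hDyy s hs' y ⟨hyl, hyr⟩)
  have htt : HasDerivAt (fun r => D r y - C * r) (Dt s y - C) s := by
    exact ((hDt s hs' y ⟨hyl, hyr⟩).sub ((hasDerivAt_id s).const_mul C)).congr_deriv (by simp)
  have ht := htt.nonneg_of_left_max (by
    have e1 : ∀ᶠ r in nhds s, α r < y := hα.continuousAt.eventually_lt continuousAt_const hyl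
    have e2 : ∀ᶠ r in nhds s, y < β r := continuousAt_const.eventually_lt hβ.continuousAt hyr
    filter_upwards [nhdsWithin_le_nhds e1, nhdsWithin_le_nhds e2,
      nhdsWithin_le_nhds (lt_mem_nhds hs0), self_mem_nhdsWithin] with r h1 h2 h3 h4
    exact hmax' r ⟨h3.le, (le_of_lt h4).trans hs.2⟩ y ⟨h1.le, h2.le⟩)
  linarith [hsub s hs' y ⟨hyl, hyr⟩ hy0]

/-- Parabolic comparison on a region with moving lateral boundary. -/
lemma parabolic_comparison {α β : ℝ → ℝ} {D Dt Dy Dyy : ℝ → ℝ → ℝ} {C : ℝ}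
    (hα : Continuous α) (hβ : Continuous β)
    (hD : ContinuousOn (fun P : ℝ × ℝ => D P.1 P.2)
      {P | P.1 ∈ Icc (0 : ℝ) 1 ∧ P.2 ∈ Icc (α P.1) (β P.1)})
    (hDt : ∀ s ∈ Ioc (0 : ℝ) 1, ∀ y ∈ Ioo (α s) (β s), HasDerivAt (fun r => D r y) (Dt s y) s)
    (hDy : ∀ s ∈ Ioc (0 : ℝ) 1, ∀ y ∈ Ioo (α s) (β s), HasDerivAt (fun x => D s x) (Dy s y) y)
    (hDyy : ∀ s ∈ Ioc (0 : ℝ) 1, ∀ y ∈ Ioo (α s) (β s), HasDerivAt (fun x => Dy s x) (Dyy s y) y)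
    (hsub : ∀ s ∈ Ioc (0 : ℝ) 1, ∀ y ∈ Ioo (α s) (β s), Dy s y = 0 → |Dt s y - Dyy s y| < C)
    (h0 : ∀ y ∈ Icc (α 0) (β 0), D 0 y = 0)
    (hleft : ∀ s ∈ Icc (0 : ℝ) 1, |D s (α s)| ≤ C * s)
    (hright : ∀ s ∈ Icc (0 : ℝ) 1, |D s (β s)| ≤ C * s) :
    ∀ s ∈ Icc (0 : ℝ) 1, ∀ y ∈ Icc (α s) (β s), |D s y| ≤ C * s := by
  intro s hs y hy
  refine abs_le'.2 ⟨?_, ?_⟩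
  · exact parabolic_comparison_upper hα hβ hD hDt hDy hDyy
      (fun s hs y hy h => (abs_lt.1 (hsub s hs y hy h)).2) (fun y hy => (h0 y hy).le)
      (fun s hs => (abs_le.1 (hleft s hs)).2) (fun s hs => (abs_le.1 (hright s hs)).2) s hs y hy
  · refine parabolic_comparison_upper (D := fun s y => -D s y) (Dt := fun s y => -Dt s y)
      (Dy := fun s y => -Dy s y) (Dyy := fun s y => -Dyy s y) hα hβ hD.neg
      (fun s hs y hy => (hDt s hs y hy).neg) (fun s hs y hy => (hDy s hs y hy).neg)
      (fun s hs y hy => (hDyy s hs y hy).neg) (fun s hs y hy h => ?_)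
      (fun y hy => by rw [h0 y hy, neg_zero])
      (fun s hs => (abs_le'.1 (hleft s hs)).2) (fun s hs => (abs_le'.1 (hright s hs)).2) s hs y hy
    have := (abs_lt.1 (hsub s hs y hy (neg_eq_zero.1 h))).1
    linarith

section EnergyOnPiece

variable {U p : ℝ → ℝ} {M a b : ℝ}
variable (hU : ∀ x, HasDerivAt U (p x) x) (hp : Continuous p) (hM : ∀ x, |p x| ≤ M)
include hU hp hM

omit hp in
lemma continuous_heatFlow_of_deriv : Continuous fun P : ℝ × ℝ => heatFlow U P.1 P.2 :=
  continuous_heatFlow (continuous_iff_continuousAt.2 fun z => (hU z).continuousAt)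
    ((abs_nonneg _).trans (hM 0)) (abs_le_of_hasDerivAt_bounded hU hM)

lemma hasDerivWithinAt_heatFlow_zero {y q : ℝ} (hq : HasDerivAt p q y) :
    HasDerivWithinAt (fun s => heatFlow U s y) q (Ici 0) 0 := by
  have hc := continuous_heatFlow_of_deriv hU hM
  refine hasDerivWithinAt_Ici_of_tendsto_deriv (s := Ioi 0) ?_ ?_ self_mem_nhdsWithin ?_
  · exact fun s hs => (hasDerivAt_heatFlow_time hU hp hM hs y).differentiableAt.differentiableWithinAt
  · exact (by fun_prop : Continuous fun s => heatFlow U s y).continuousWithinAt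
  · refine (tendsto_heatFlowDeriv hp hM hq).congr' ?_
    filter_upwards [self_mem_nhdsWithin] with s hs
    exact (hasDerivAt_heatFlow_time hU hp hM hs y).deriv.symm

lemma hasDerivAt_integral_sq_heatFlow {s : ℝ} (hs : 0 < s) :
    HasDerivAt (fun r => ∫ y in a..b, heatFlow U r y ^ 2)
      (2 * (heatFlow U s b * heatFlow p s b - heatFlow U s a * heatFlow p s a)
        - 2 * ∫ y in a..b, heatFlow p s y ^ 2) s := by
  have hc := continuous_heatFlow_of_deriv hU hM
  have hcp : Continuous fun P : ℝ × ℝ => heatFlow p P.1 P.2 :=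
    continuous_heatFlow hp le_rfl (fun x => by simpa using hM x)
  have hcd := continuous_heatFlowDeriv hp hM s
  obtain ⟨c, hc0, hcb⟩ := exists_abs_heatFlowDeriv_le hM
  obtain ⟨B, hB⟩ := ((isCompact_Icc (a := s / 2) (b := s + 1)).prod
    (isCompact_uIcc (a := a) (b := b))).exists_bound_of_continuousOn hc.continuousOn
  have key := (intervalIntegral.hasDerivAt_integral_of_dominated_loc_of_deriv_le
    (μ := volume) (a := a) (b := b) (x₀ := s) (s := Icc (s / 2) (s + 1))
    (bound := fun _ => 2 * (B * ((√(s / 2))⁻¹ * c)))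
    (F := fun r y => heatFlow U r y ^ 2)
    (F' := fun r y => 2 * (heatFlow U r y * heatFlowDeriv p r y))
    (Icc_mem_nhds (by linarith) (by linarith))
    (Eventually.of_forall fun r => (Continuous.aestronglyMeasurable (by fun_prop)))
    (Continuous.intervalIntegrable (by fun_prop) _ _)
    (Continuous.aestronglyMeasurable (by fun_prop)) ?_ (by simp) ?_).2
  · refine key.congr_deriv ?_
    rw [intervalIntegral.integral_const_mul,
      intervalIntegral.integral_mul_deriv_eq_deriv_mul
      (u := fun y => heatFlow U s y) (v := fun y => heatFlow p s y)
      (fun y _ => hasDerivAt_heatFlow hU hp hM s y)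
      (fun y _ => hasDerivAt_heatFlow_deriv hU hp hM hs y)
      (Continuous.intervalIntegrable (by fun_prop) _ _)
      (Continuous.intervalIntegrable (by fun_prop) _ _)]
    simp only [← sq]
    ring
  · refine ae_of_all _ fun y hy r hr => ?_
    have h1 : |heatFlow U r y| ≤ B := hB (r, y) ⟨hr, uIoc_subset_uIcc hy⟩
    have h2 : |heatFlowDeriv p r y| ≤ (√(s / 2))⁻¹ * c := by
      refine (hcb r y).trans (mul_le_mul_of_nonneg_right ?_ hc0)
      exact inv_anti₀ (Real.sqrt_pos.2 (by linarith)) (Real.sqrt_le_sqrt hr.1)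
    rw [Real.norm_eq_abs, abs_mul, abs_mul, abs_two]
    have : 0 ≤ B := (abs_nonneg _).trans h1
    gcongr
  · refine ae_of_all _ fun y _ r hr => ?_
    have hr' : 0 < r := by have := hr.1; linarith
    refine ((hasDerivAt_heatFlow_time hU hp hM hr' y).pow 2).congr_deriv ?_
    simp; ring

lemma hasDerivWithinAt_integral_sq_heatFlow :
    HasDerivWithinAt (fun s => ∫ y in a..b, heatFlow U s y ^ 2)
      (2 * (U b * p b - U a * p a) - 2 * ∫ y in a..b, p y ^ 2) (Ici 0) 0 := by
  have hc := continuous_heatFlow_of_deriv hU hM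
  have hcp : Continuous fun P : ℝ × ℝ => heatFlow p P.1 P.2 :=
    continuous_heatFlow hp le_rfl (fun x => by simpa using hM x)
  refine hasDerivWithinAt_Ici_of_tendsto_deriv (s := Ioi 0) ?_ ?_ self_mem_nhdsWithin ?_
  · exact fun s hs =>
      (hasDerivAt_integral_sq_heatFlow hU hp hM hs).differentiableAt.differentiableWithinAt
  · refine Continuous.continuousWithinAt ?_
    exact intervalIntegral.continuous_parametric_intervalIntegral_of_continuous'
      (f := fun s y => heatFlow U s y ^ 2) (by unfold Function.uncurry; fun_prop) a b
  · have hlim : Continuous fun s =>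
        2 * (heatFlow U s b * heatFlow p s b - heatFlow U s a * heatFlow p s a)
          - 2 * ∫ y in a..b, heatFlow p s y ^ 2 := by
      have := intervalIntegral.continuous_parametric_intervalIntegral_of_continuous' (μ := volume)
        (f := fun s y => heatFlow p s y ^ 2) (by unfold Function.uncurry; fun_prop) a b
      fun_prop
    have h0 := hlim.tendsto 0
    simp only [heatFlow_zero] at h0
    refine (h0.mono_left nhdsWithin_le_nhds).congr' ?_
    filter_upwards [self_mem_nhdsWithin] with s hs
    exact (hasDerivAt_integral_sq_heatFlow hU hp hM hs).deriv.symm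

/-- The right derivative of the energy on an interval, for a function that stays within `O(s)`
of the heat evolution and whose time derivative at `0` is given by Burgers' equation. -/
lemma hasDerivWithinAt_integral_sq_of_near_heatFlow (hab : a ≤ b) {z : ℝ → ℝ → ℝ} {zt q : ℝ → ℝ}
    {C : ℝ} (hz : ∀ s ∈ Icc (0 : ℝ) 1, ContinuousOn (z s) (Icc a b))
    (hzw : ∀ s ∈ Icc (0 : ℝ) 1, ∀ y ∈ Icc a b, |z s y - heatFlow U s y| ≤ C * s)
    (hzt : ∀ y ∈ Ioo a b, HasDerivWithinAt (fun s => z s y) (zt y) (Ici 0) 0)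
    (hq : ∀ y ∈ Ioo a b, HasDerivAt p (q y) y)
    (hpde : ∀ y ∈ Ioo a b, zt y + U y * p y = q y) :
    HasDerivWithinAt (fun s => ∫ y in a..b, z s y ^ 2)
      (2 * (U b * p b - U a * p a) - 2 * (∫ y in a..b, p y ^ 2) - 2 / 3 * (U b ^ 3 - U a ^ 3))
      (Ici 0) 0 := by
  have hc := continuous_heatFlow_of_deriv hU hM
  have hUc : Continuous U := continuous_iff_continuousAt.2 fun z => (hU z).continuousAt
  have hC : 0 ≤ C := by
    simpa using (abs_nonneg _).trans (hzw 1 ⟨zero_le_one, le_rfl⟩ a ⟨le_rfl, hab⟩)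
  obtain ⟨B, hB⟩ := ((isCompact_Icc (a := (0 : ℝ)) (b := 1)).prod
    (isCompact_Icc (a := a) (b := b))).exists_bound_of_continuousOn hc.continuousOn
  have hz0 : ∀ y ∈ Icc a b, z 0 y = U y := by
    intro y hy
    have := hzw 0 ⟨le_rfl, zero_le_one⟩ y hy
    rw [mul_zero, heatFlow_zero] at this
    exact sub_eq_zero.1 (abs_nonpos_iff.1 this)
  have hcube : ∫ y in a..b, -(U y * p y) * (2 * U y) = -(2 / 3 * (U b ^ 3 - U a ^ 3)) := by
    rw [intervalIntegral.integral_eq_sub_of_hasDerivAt (f := fun y => -(2 / 3 * U y ^ 3))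
      (fun y _ => (((hU y).pow 3).const_mul (2 / 3)).neg.congr_deriv (by push_cast; ring))
      (Continuous.intervalIntegrable (by fun_prop) _ _)]
    ring
  have hrem : HasDerivWithinAt (fun s => ∫ y in a..b, (z s y ^ 2 - heatFlow U s y ^ 2))
      (-(2 / 3 * (U b ^ 3 - U a ^ 3))) (Ici 0) 0 := by
    rw [← hasDerivWithinAt_Ioi_iff_Ici, hasDerivWithinAt_iff_tendsto_slope' (by simp), ← hcube]
    have hI0 : ∫ y in a..b, (z 0 y ^ 2 - heatFlow U 0 y ^ 2) = 0 := by
      rw [intervalIntegral.integral_congr (g := fun _ => (0 : ℝ)), intervalIntegral.integral_zero]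
      intro y hy
      rw [uIcc_of_le hab] at hy
      simp [heatFlow_zero, hz0 y hy]
    have hmem : ∀ᶠ s in nhdsWithin (0 : ℝ) (Ioi 0), s ∈ Ioc (0 : ℝ) 1 :=
      Ioc_mem_nhdsGT one_pos
    refine Tendsto.congr' (f₁ := fun s => ∫ y in a..b,
      (s⁻¹ * (z s y - heatFlow U s y)) * (z s y + heatFlow U s y)) ?_ ?_
    · filter_upwards [hmem] with s hs
      rw [slope_def_field, hI0, sub_zero, sub_zero, div_eq_inv_mul,
        ← intervalIntegral.integral_const_mul]
      congr 1; ext y; ring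
    refine intervalIntegral.tendsto_integral_filter_of_dominated_convergence
      (fun _ => C * (2 * B + C)) ?_ ?_ (by simp) ?_
    · filter_upwards [hmem] with s hs
      have h1 : ContinuousOn (z s) (Icc a b) := hz s ⟨hs.1.le, hs.2⟩
      have h2 : Continuous (heatFlow U s) := by fun_prop
      rw [uIoc_of_le hab]
      refine (ContinuousOn.mono ?_ Ioc_subset_Icc_self).aestronglyMeasurable measurableSet_Ioc
      exact (continuousOn_const.mul (h1.sub h2.continuousOn)).mul (h1.add h2.continuousOn)
    · filter_upwards [hmem] with s hs
      refine ae_of_all _ fun y hy => ?_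
      rw [uIoc_of_le hab] at hy
      have hs' : s ∈ Icc (0 : ℝ) 1 := ⟨hs.1.le, hs.2⟩
      have hy' := Ioc_subset_Icc_self hy
      have h1 := hzw s hs' y hy'
      have h2 : |heatFlow U s y| ≤ B := hB (s, y) ⟨hs', hy'⟩
      have h3 : |z s y + heatFlow U s y| ≤ 2 * B + C := by
        have e : z s y + heatFlow U s y = (z s y - heatFlow U s y) + 2 * heatFlow U s y := by ring
        rw [e]
        refine (abs_add_le _ _).trans ?_
        rw [abs_mul, abs_two]
        nlinarith [hs.2]
      rw [Real.norm_eq_abs, abs_mul, abs_mul, abs_of_pos (inv_pos.2 hs.1)]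
      have h4 : s⁻¹ * |z s y - heatFlow U s y| ≤ C := by
        rw [inv_mul_le_iff₀ hs.1]; linarith
      exact mul_le_mul h4 h3 (abs_nonneg _) hC
    · have hne : ∀ᵐ y : ℝ, y ≠ b := by simp [ae_iff]
      filter_upwards [hne] with y hyb hy
      rw [uIoc_of_le hab] at hy
      have hy' : y ∈ Ioo a b := ⟨hy.1, lt_of_le_of_ne hy.2 hyb⟩
      have hd := (hzt y hy').sub (hasDerivWithinAt_heatFlow_zero hU hp hM (hq y hy'))
      have h1 := hd
      rw [← hasDerivWithinAt_Ioi_iff_Ici, hasDerivWithinAt_iff_tendsto_slope' (by simp)] at h1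
      have h2 : Tendsto (fun s => z s y + heatFlow U s y) (nhdsWithin 0 (Ioi 0))
          (nhds (2 * U y)) := by
        have := (hzt y hy').continuousWithinAt.add
          (hasDerivWithinAt_heatFlow_zero hU hp hM (hq y hy')).continuousWithinAt
        have h := this.tendsto.mono_left (nhdsWithin_mono 0 Ioi_subset_Ici_self)
        simp only [Pi.add_apply, hz0 y (Ioo_subset_Icc_self hy'), heatFlow_zero] at h
        rwa [two_mul]
      have h3 := h1.mul h2
      have e : zt y - q y = -(U y * p y) := by linarith [hpde y hy']
      rw [e] at h3
      refine h3.congr' ?_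
      filter_upwards [hmem] with s hs
      simp only [slope_def_field, Pi.sub_apply, hz0 y (Ioo_subset_Icc_self hy'), heatFlow_zero,
        sub_self, sub_zero, div_eq_inv_mul]
  have hsum := (hasDerivWithinAt_integral_sq_heatFlow hU hp hM (a := a) (b := b)).add hrem
  have hsplit : ∀ s ∈ Icc (0 : ℝ) 1, ∫ y in a..b, z s y ^ 2 =
      (∫ y in a..b, heatFlow U s y ^ 2) + ∫ y in a..b, (z s y ^ 2 - heatFlow U s y ^ 2) := by
    intro s hs
    have h1 : IntervalIntegrable (fun y => z s y ^ 2) volume a b :=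
      ContinuousOn.intervalIntegrable (by rw [uIcc_of_le hab]; exact (hz s hs).pow 2)
    have h2 : IntervalIntegrable (fun y => heatFlow U s y ^ 2) volume a b :=
      Continuous.intervalIntegrable (by fun_prop) _ _
    rw [intervalIntegral.integral_sub h1 h2]
    ring
  refine (hsum.congr_of_eventuallyEq
      (f₁ := fun s => ∫ y in a..b, z s y ^ 2) ?_ ?_).congr_deriv (by ring)
  · filter_upwards [Icc_mem_nhdsGE one_pos] with s hs
    exact hsplit s hs
  · exact hsplit 0 ⟨le_rfl, zero_le_one⟩

end EnergyOnPiece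

/-- A solution of Burgers' equation stays within `O(s)` of the heat evolution of its initial
profile, provided that it does so on the lateral boundary. -/
lemma abs_sub_heatFlow_le_of_burgers {U p : ℝ → ℝ} {M : ℝ} (hU : ∀ x, HasDerivAt U (p x) x)
    (hp : Continuous p) (hM : ∀ x, |p x| ≤ M) {α β : ℝ → ℝ} {z zt zy zyy : ℝ → ℝ → ℝ} {B L : ℝ}
    (hα : Continuous α) (hβ : Continuous β)
    (hz : ContinuousOn (fun P : ℝ × ℝ => z P.1 P.2)
      {P | P.1 ∈ Icc (0 : ℝ) 1 ∧ P.2 ∈ Icc (α P.1) (β P.1)})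
    (hzt : ∀ s ∈ Ioc (0 : ℝ) 1, ∀ y ∈ Ioo (α s) (β s), HasDerivAt (fun r => z r y) (zt s y) s)
    (hzy : ∀ s ∈ Ioc (0 : ℝ) 1, ∀ y ∈ Ioo (α s) (β s), HasDerivAt (fun x => z s x) (zy s y) y)
    (hzyy : ∀ s ∈ Ioc (0 : ℝ) 1, ∀ y ∈ Ioo (α s) (β s), HasDerivAt (fun x => zy s x) (zyy s y) y)
    (hpde : ∀ s ∈ Ioc (0 : ℝ) 1, ∀ y ∈ Ioo (α s) (β s), zt s y + z s y * zy s y = zyy s y)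
    (hB : 0 ≤ B) (hzB : ∀ s ∈ Ioc (0 : ℝ) 1, ∀ y ∈ Ioo (α s) (β s), |z s y| ≤ B) (hL : 0 ≤ L)
    (h0 : ∀ y ∈ Icc (α 0) (β 0), z 0 y = U y)
    (hleft : ∀ s ∈ Icc (0 : ℝ) 1, |z s (α s) - heatFlow U s (α s)| ≤ L * s)
    (hright : ∀ s ∈ Icc (0 : ℝ) 1, |z s (β s) - heatFlow U s (β s)| ≤ L * s) :
    ∀ s ∈ Icc (0 : ℝ) 1, ∀ y ∈ Icc (α s) (β s),
      |z s y - heatFlow U s y| ≤ (B * M + 1 + L) * s := by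
  have hc := continuous_heatFlow_of_deriv hU hM
  have hM0 : 0 ≤ M := (abs_nonneg _).trans (hM 0)
  have hBM : 0 ≤ B * M := mul_nonneg hB hM0
  refine parabolic_comparison hα hβ (D := fun s y => z s y - heatFlow U s y)
    (Dt := fun s y => zt s y - heatFlowDeriv p s y) (Dy := fun s y => zy s y - heatFlow p s y)
    (Dyy := fun s y => zyy s y - heatFlowDeriv p s y) (hz.sub hc.continuousOn)
    (fun s hs y hy => (hzt s hs y hy).sub (hasDerivAt_heatFlow_time hU hp hM hs.1 y))
    (fun s hs y hy => (hzy s hs y hy).sub (hasDerivAt_heatFlow hU hp hM s y))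
    (fun s hs y hy => (hzyy s hs y hy).sub (hasDerivAt_heatFlow_deriv hU hp hM hs.1 y))
    (fun s hs y hy h => ?_) (fun y hy => by simp [heatFlow_zero, h0 y hy])
    (fun s hs => (hleft s hs).trans (mul_le_mul_of_nonneg_right (by linarith) hs.1))
    (fun s hs => (hright s hs).trans (mul_le_mul_of_nonneg_right (by linarith) hs.1))
  have e : zt s y - heatFlowDeriv p s y - (zyy s y - heatFlowDeriv p s y)
      = -(z s y * heatFlow p s y) := by
    rw [← hpde s hs y hy, ← sub_eq_zero.1 h]; ring
  rw [e, abs_neg, abs_mul]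
  have := mul_le_mul (hzB s hs y hy) (abs_heatFlow_le hM s y) (abs_nonneg _) hB
  linarith

lemma abs_heatFlow_sub_le {U p : ℝ → ℝ} {M : ℝ} (hU : ∀ x, HasDerivAt U (p x) x)
    (hp : Continuous p) (hM : ∀ x, |p x| ≤ M) (s x y : ℝ) :
    |heatFlow U s y - heatFlow U s x| ≤ M * |y - x| :=
  convex_univ.norm_image_sub_le_of_norm_hasDerivWithin_le (f := fun x => heatFlow U s x)
    (fun z _ => (hasDerivAt_heatFlow hU hp hM s z).hasDerivWithinAt)
    (fun z _ => abs_heatFlow_le hM s z) (mem_univ x) (mem_univ y)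

lemma ContDiff.exists_abs_sub_le {f : ℝ → ℝ} (hf : ContDiff ℝ 1 f) :
    ∃ C, 0 ≤ C ∧ ∀ s ∈ Icc (0 : ℝ) 1, |f s - f 0| ≤ C * s := by
  obtain ⟨C, hC⟩ := isCompact_Icc.exists_bound_of_continuousOn
    ((hf.continuous_deriv le_rfl).continuousOn (s := Icc (0 : ℝ) 1))
  have h0 : (0 : ℝ) ∈ Icc (0 : ℝ) 1 := ⟨le_rfl, zero_le_one⟩
  refine ⟨C, (norm_nonneg _).trans (hC 0 h0), fun s hs => ?_⟩
  have := (convex_Icc (0 : ℝ) 1).norm_image_sub_le_of_norm_deriv_le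
    (fun x _ => (hf.differentiable one_ne_zero) x) hC h0 hs
  simpa [abs_of_nonneg hs.1] using this

lemma sq_sub_le_mul_integral_sq {U p : ℝ → ℝ} (hU : ∀ x, HasDerivAt U (p x) x)
    (hp : Continuous p) {a b : ℝ} (hab : a ≤ b) :
    (U b - U a) ^ 2 ≤ (b - a) * ∫ y in a..b, p y ^ 2 := by
  rw [← intervalIntegral.integral_eq_sub_of_hasDerivAt (fun y _ => hU y) (hp.intervalIntegrable _ _)]
  exact sq_integral_le hp hab

lemma integral_sq_le_mul_integral_sq_deriv {U p : ℝ → ℝ} (hU : ∀ x, HasDerivAt U (p x) x)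
    (hp : Continuous p) {a b : ℝ} (hab : a ≤ b) (h0 : U a = 0 ∨ U b = 0) :
    ∫ y in a..b, U y ^ 2 ≤ (b - a) ^ 2 * ∫ y in a..b, p y ^ 2 := by
  have hUc : Continuous U := continuous_iff_continuousAt.2 fun z => (hU z).continuousAt
  have hpi : ∀ c d, IntervalIntegrable (fun y => p y ^ 2) volume c d := fun c d =>
    Continuous.intervalIntegrable (by fun_prop) _ _
  have hbound : ∀ y ∈ Icc a b, U y ^ 2 ≤ (b - a) * ∫ y in a..b, p y ^ 2 := by
    intro y hy
    have hs := intervalIntegral.integral_add_adjacent_intervals (hpi a y) (hpi y b)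
    have n1 : 0 ≤ ∫ x in a..y, p x ^ 2 :=
      intervalIntegral.integral_nonneg hy.1 fun x _ => sq_nonneg _
    have n2 : 0 ≤ ∫ x in y..b, p x ^ 2 :=
      intervalIntegral.integral_nonneg hy.2 fun x _ => sq_nonneg _
    rcases h0 with h0 | h0
    · have := sq_sub_le_mul_integral_sq hU hp hy.1
      rw [h0, sub_zero] at this
      exact this.trans (mul_le_mul (by linarith [hy.2]) (by linarith) n1 (by linarith))
    · have := sq_sub_le_mul_integral_sq hU hp hy.2
      rw [h0, zero_sub, neg_sq] at this
      exact this.trans (mul_le_mul (by linarith [hy.1]) (by linarith) n2 (by linarith))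
  refine (intervalIntegral.integral_mono_on hab (Continuous.intervalIntegrable (by fun_prop) _ _)
    intervalIntegrable_const hbound).trans_eq ?_
  simp
  ring

namespace FluidParticleSol

variable {K h₁ : ℝ}

/-- The time translate of a solution. -/
def shift (S : FluidParticleSol K h₁) (τ : ℝ) (hτ : 0 ≤ τ) : FluidParticleSol K h₁ where
  v t := S.v (τ + t)
  h t := S.h (τ + t)
  vt t := S.vt (τ + t)
  vy t := S.vy (τ + t)
  vyy t := S.vyy (τ + t)
  vyL t := S.vyL (τ + t)
  vyR t := S.vyR (τ + t)
  hK := S.hK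
  hh₁ := S.hh₁
  h_in t ht := S.h_in _ (add_nonneg hτ ht)
  h_C2 := S.h_C2.comp (contDiff_const.add contDiff_id)
  v_cont := S.v_cont.comp (f := fun P : ℝ × ℝ => (τ + P.1, P.2)) (by fun_prop)
    fun _ hP => ⟨add_nonneg hτ hP.1, hP.2⟩
  hasDeriv_t t ht y hy := (S.hasDeriv_t _ (add_nonneg hτ ht) y hy).comp_const_add τ t
  vt_cont y hy := (S.vt_cont y hy).comp (f := fun t => τ + t) (by fun_prop)
    fun _ ht => add_nonneg hτ ht
  hasDeriv_y t ht := S.hasDeriv_y _ (add_nonneg hτ ht)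
  hasDeriv_yL t ht := S.hasDeriv_yL _ (add_nonneg hτ ht)
  hasDeriv_yR t ht := S.hasDeriv_yR _ (add_nonneg hτ ht)
  vy_contL t ht := S.vy_contL _ (add_nonneg hτ ht)
  vy_contR t ht := S.vy_contR _ (add_nonneg hτ ht)
  vy_limL t ht := S.vy_limL _ (add_nonneg hτ ht)
  vy_limR t ht := S.vy_limR _ (add_nonneg hτ ht)
  hasDeriv_yy t ht := S.hasDeriv_yy _ (add_nonneg hτ ht)
  pde t ht := S.pde _ (add_nonneg hτ ht)
  bc_left t ht := S.bc_left _ (add_nonneg hτ ht)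
  bc_right t ht := S.bc_right _ (add_nonneg hτ ht)
  ode1 t ht := (deriv_comp_const_add _ _ _).trans (S.ode1 _ (add_nonneg hτ ht))
  ode2 t ht := by
    rw [← S.ode2 _ (add_nonneg hτ ht), ← deriv_comp_const_add]
    congr 1
    ext s
    exact deriv_comp_const_add _ _ _

/-- The kinetic energy of fluid and particle. -/
noncomputable def energy (S : FluidParticleSol K h₁) (t : ℝ) : ℝ :=
  (∫ y in (-1 : ℝ)..1, S.v t y ^ 2) + deriv S.h t ^ 2

lemma energy_shift (S : FluidParticleSol K h₁) (τ : ℝ) (hτ : 0 ≤ τ) (t : ℝ) :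
    (S.shift τ hτ).energy t = S.energy (τ + t) := by
  simp only [energy, shift, deriv_comp_const_add]

lemma contDiff_deriv_h (S : FluidParticleSol K h₁) : ContDiff ℝ 1 (deriv S.h) :=
  ((contDiff_succ_iff_deriv (n := 1)).1 S.h_C2).2.2

lemma continuousOn_v (S : FluidParticleSol K h₁) {t : ℝ} (ht : 0 ≤ t) :
    ContinuousOn (S.v t) (Icc (-1) 1) :=
  S.v_cont.comp (f := fun y => (t, y)) (by fun_prop) fun _ hy => ⟨ht, hy⟩

lemma continuousOn_energy (S : FluidParticleSol K h₁) : ContinuousOn S.energy (Ici 0) := by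
  have hc : Continuous fun P : ℝ × ℝ => S.v (max P.1 0) (max (-1) (min 1 P.2)) :=
    S.v_cont.comp_continuous
      (f := fun P : ℝ × ℝ => (max P.1 0, max (-1) (min 1 P.2))) (by fun_prop)
      fun P => ⟨mem_Ici.2 (le_max_right _ _), le_max_left _ _,
        max_le (by norm_num) (min_le_left _ _)⟩
  have hI := intervalIntegral.continuous_parametric_intervalIntegral_of_continuous'
    (μ := volume) (f := fun t y => S.v (max t 0) (max (-1) (min 1 y)) ^ 2)
    (by unfold Function.uncurry; fun_prop) (-1) 1
  have hg := S.contDiff_deriv_h.continuous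
  refine (hI.add (hg.pow 2)).continuousOn.congr fun t ht => ?_
  have ht' : (0 : ℝ) ≤ t := ht
  simp only [energy, Pi.add_apply, Pi.pow_apply]
  congr 1
  refine intervalIntegral.integral_congr fun y hy => ?_
  rw [uIcc_of_le (by norm_num)] at hy
  simp only [max_eq_left ht', min_eq_right hy.2, max_eq_right hy.1]

lemma exists_left_extension (S : FluidParticleSol K h₁) :
    ∃ U p : ℝ → ℝ, ∃ M : ℝ, Continuous p ∧ (∀ x, |p x| ≤ M) ∧ (∀ x, HasDerivAt U (p x) x) ∧
      EqOn U (S.v 0) (Icc (-1) (S.h 0)) ∧ p (S.h 0) = S.vyL 0 ∧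
      (∀ y ∈ Ioo (-1) (S.h 0), p y = S.vy 0 y ∧ HasDerivAt p (S.vyy 0 y) y) ∧
      (∀ s, heatFlow U s (-1) = 0) ∧ ∀ s, heatFlow U s (S.h 0) = S.v 0 (S.h 0) := by
  obtain ⟨hl, hr⟩ := S.h_in 0 le_rfl
  have hφ : ContinuousOn (Function.update (S.vy 0) (S.h 0) (S.vyL 0)) (Icc (-1) (S.h 0)) := by
    rw [continuousOn_update_iff, Icc_sdiff_right]
    exact ⟨S.vy_contL 0 le_rfl, fun _ =>
      (S.vy_limL 0 le_rfl).mono_left (nhdsWithin_mono _ fun y hy => hy.2)⟩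
  obtain ⟨U, p, M, hp, hM, hU, hUv, hpφ, ho1, ho2⟩ := exists_odd_extension hl
    ((S.continuousOn_v le_rfl).mono (Icc_subset_Icc_right hr.le)) hφ (fun x hx => by
      rw [Function.update_of_ne hx.2.ne]
      exact S.hasDeriv_y 0 le_rfl x ⟨hx.1, hx.2.trans hr⟩ hx.2.ne)
  have hUc : Continuous U := continuous_iff_continuousAt.2 fun z => (hU z).continuousAt
  have hM0 : 0 ≤ M := (abs_nonneg _).trans (hM 0)
  have hg := abs_le_of_hasDerivAt_bounded hU hM
  have hpv : ∀ y ∈ Ioo (-1) (S.h 0), p y = S.vy 0 y := fun y hy => by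
    rw [hpφ (Ioo_subset_Icc_self hy), Function.update_of_ne hy.2.ne]
  refine ⟨U, p, M, hp, hM, hU, hUv, ?_, fun y hy => ⟨hpv y hy, ?_⟩, fun s => ?_, fun s => ?_⟩
  · rw [hpφ ⟨hl.le, le_rfl⟩, Function.update_self]
  · refine (S.hasDeriv_yy 0 le_rfl y ⟨hy.1, hy.2.trans hr⟩ hy.2.ne).congr_of_eventuallyEq ?_
    filter_upwards [Ioo_mem_nhds hy.1 hy.2] with x hx using hpv x hx
  · rw [heatFlow_eq_of_odd hUc hM0 hg ho1, hUv ⟨le_rfl, hl.le⟩, S.bc_left 0 le_rfl]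
  · rw [heatFlow_eq_of_odd hUc hM0 hg ho2, hUv ⟨hl.le, le_rfl⟩]

lemma exists_right_extension (S : FluidParticleSol K h₁) :
    ∃ U p : ℝ → ℝ, ∃ M : ℝ, Continuous p ∧ (∀ x, |p x| ≤ M) ∧ (∀ x, HasDerivAt U (p x) x) ∧
      EqOn U (S.v 0) (Icc (S.h 0) 1) ∧ p (S.h 0) = S.vyR 0 ∧
      (∀ y ∈ Ioo (S.h 0) 1, p y = S.vy 0 y ∧ HasDerivAt p (S.vyy 0 y) y) ∧
      (∀ s, heatFlow U s 1 = 0) ∧ ∀ s, heatFlow U s (S.h 0) = S.v 0 (S.h 0) := by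
  obtain ⟨hl, hr⟩ := S.h_in 0 le_rfl
  have hφ : ContinuousOn (Function.update (S.vy 0) (S.h 0) (S.vyR 0)) (Icc (S.h 0) 1) := by
    rw [continuousOn_update_iff, Icc_sdiff_left]
    exact ⟨S.vy_contR 0 le_rfl, fun _ =>
      (S.vy_limR 0 le_rfl).mono_left (nhdsWithin_mono _ fun y hy => hy.1)⟩
  obtain ⟨U, p, M, hp, hM, hU, hUv, hpφ, ho1, ho2⟩ := exists_odd_extension hr
    ((S.continuousOn_v le_rfl).mono (Icc_subset_Icc_left hl.le)) hφ (fun x hx => by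
      rw [Function.update_of_ne hx.1.ne']
      exact S.hasDeriv_y 0 le_rfl x ⟨hl.trans hx.1, hx.2⟩ hx.1.ne')
  have hUc : Continuous U := continuous_iff_continuousAt.2 fun z => (hU z).continuousAt
  have hM0 : 0 ≤ M := (abs_nonneg _).trans (hM 0)
  have hg := abs_le_of_hasDerivAt_bounded hU hM
  have hpv : ∀ y ∈ Ioo (S.h 0) 1, p y = S.vy 0 y := fun y hy => by
    rw [hpφ (Ioo_subset_Icc_self hy), Function.update_of_ne hy.1.ne']
  refine ⟨U, p, M, hp, hM, hU, hUv, ?_, fun y hy => ⟨hpv y hy, ?_⟩, fun s => ?_, fun s => ?_⟩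
  · rw [hpφ ⟨le_rfl, hr.le⟩, Function.update_self]
  · refine (S.hasDeriv_yy 0 le_rfl y ⟨hl.trans hy.1, hy.2⟩ hy.1.ne').congr_of_eventuallyEq ?_
    filter_upwards [Ioo_mem_nhds hy.1 hy.2] with x hx using hpv x hx
  · rw [heatFlow_eq_of_odd hUc hM0 hg ho2, hUv ⟨hr.le, le_rfl⟩, S.bc_right 0 le_rfl]
  · rw [heatFlow_eq_of_odd hUc hM0 hg ho1, hUv ⟨le_rfl, hr.le⟩]

/-- The energy inequality at the initial time. -/
lemma exists_hasDerivWithinAt_energy_zero (S : FluidParticleSol 0 h₁) :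
    ∃ e, HasDerivWithinAt S.energy e (Ici 0) 0 ∧ e ≤ -(1 / 4) * S.energy 0 := by
  obtain ⟨hl, hr⟩ := S.h_in 0 le_rfl
  obtain ⟨U, p, M, hp, hM, hU, hUv, hph, hpv, hU1, hUh⟩ := S.exists_left_extension
  obtain ⟨V, q, N, hq, hN, hV, hVv, hqh, hqv, hV1, hVh⟩ := S.exists_right_extension
  have hM0 : 0 ≤ M := (abs_nonneg _).trans (hM 0)
  have hN0 : 0 ≤ N := (abs_nonneg _).trans (hN 0)
  have hhc : Continuous S.h := S.h_C2.continuous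
  obtain ⟨B, hB⟩ := ((isCompact_Icc (a := (0 : ℝ)) (b := 1)).prod
    (isCompact_Icc (a := (-1 : ℝ)) (b := 1))).exists_bound_of_continuousOn
    (S.v_cont.mono (prod_mono Icc_subset_Ici_self subset_rfl))
  have hB' : ∀ s ∈ Icc (0 : ℝ) 1, ∀ y ∈ Icc (-1 : ℝ) 1, |S.v s y| ≤ B :=
    fun s hs y hy => hB (s, y) ⟨hs, hy⟩
  have hB0 : 0 ≤ B := (abs_nonneg _).trans
    (hB' 0 ⟨le_rfl, zero_le_one⟩ 1 ⟨by norm_num, le_rfl⟩)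
  obtain ⟨C₁, hC₁0, hC₁⟩ := (S.h_C2.of_le one_le_two).exists_abs_sub_le
  obtain ⟨C₂, hC₂0, hC₂⟩ := S.contDiff_deriv_h.exists_abs_sub_le
  have hh : ∀ s ∈ Icc (0 : ℝ) 1, |S.v s (S.h s) - S.v 0 (S.h 0)| ≤ C₂ * s := fun s hs => by
    rw [← S.ode1 s hs.1, ← S.ode1 0 le_rfl]
    exact hC₂ s hs
  have hUlip : ∀ s y, |heatFlow U s y - S.v 0 (S.h 0)| ≤ M * |y - S.h 0| := fun s y => by
    rw [← hUh s]; exact abs_heatFlow_sub_le hU hp hM s _ y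
  have hVlip : ∀ s y, |heatFlow V s y - S.v 0 (S.h 0)| ≤ N * |y - S.h 0| := fun s y => by
    rw [← hVh s]; exact abs_heatFlow_sub_le hV hq hN s _ y
  have hleft : ∀ s ∈ Icc (0 : ℝ) 1, ∀ y ∈ Icc (-1) (S.h s),
      |S.v s y - heatFlow U s y| ≤ (B * M + 1 + (C₂ + M * C₁)) * s := by
    refine abs_sub_heatFlow_le_of_burgers hU hp hM (α := fun _ => -1) continuous_const hhc
      (S.v_cont.mono ?_) (fun s hs y hy => S.hasDeriv_t s hs.1.le y ?_)
      (fun s hs y hy => S.hasDeriv_y s hs.1.le y ?_ hy.2.ne)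
      (fun s hs y hy => S.hasDeriv_yy s hs.1.le y ?_ hy.2.ne)
      (fun s hs y hy => S.pde s hs.1.le y ?_ hy.2.ne)
      hB0 (fun s hs y hy => hB' s ⟨hs.1.le, hs.2⟩ y ?_) (by positivity)
      (fun y hy => (hUv hy).symm) (fun s hs => ?_) (fun s hs => ?_)
    · exact fun P hP => ⟨hP.1.1, hP.2.1, hP.2.2.trans (S.h_in _ hP.1.1).2.le⟩
    · exact ⟨hy.1.le, (hy.2.trans (S.h_in _ hs.1.le).2).le⟩
    · exact ⟨hy.1, hy.2.trans (S.h_in _ hs.1.le).2⟩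
    · exact ⟨hy.1, hy.2.trans (S.h_in _ hs.1.le).2⟩
    · exact ⟨hy.1, hy.2.trans (S.h_in _ hs.1.le).2⟩
    · exact ⟨hy.1.le, (hy.2.trans (S.h_in _ hs.1.le).2).le⟩
    · rw [S.bc_left s hs.1, hU1 s, sub_zero, abs_zero]
      exact mul_nonneg (by positivity) hs.1
    · have h1 := mul_le_mul_of_nonneg_left (hC₁ s hs) hM0
      have h2 := abs_sub_le (S.v s (S.h s)) (S.v 0 (S.h 0)) (heatFlow U s (S.h s))
      rw [abs_sub_comm (S.v 0 (S.h 0))] at h2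
      linarith [hUlip s (S.h s), hh s hs]
  have hright : ∀ s ∈ Icc (0 : ℝ) 1, ∀ y ∈ Icc (S.h s) 1,
      |S.v s y - heatFlow V s y| ≤ (B * N + 1 + (C₂ + N * C₁)) * s := by
    refine abs_sub_heatFlow_le_of_burgers hV hq hN (β := fun _ => 1) hhc continuous_const
      (S.v_cont.mono ?_) (fun s hs y hy => S.hasDeriv_t s hs.1.le y ?_)
      (fun s hs y hy => S.hasDeriv_y s hs.1.le y ?_ hy.1.ne')
      (fun s hs y hy => S.hasDeriv_yy s hs.1.le y ?_ hy.1.ne')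
      (fun s hs y hy => S.pde s hs.1.le y ?_ hy.1.ne')
      hB0 (fun s hs y hy => hB' s ⟨hs.1.le, hs.2⟩ y ?_) (by positivity)
      (fun y hy => (hVv hy).symm) (fun s hs => ?_) (fun s hs => ?_)
    · exact fun P hP => ⟨hP.1.1, (S.h_in _ hP.1.1).1.le.trans hP.2.1, hP.2.2⟩
    · exact ⟨((S.h_in _ hs.1.le).1.trans hy.1).le, hy.2.le⟩
    · exact ⟨(S.h_in _ hs.1.le).1.trans hy.1, hy.2⟩
    · exact ⟨(S.h_in _ hs.1.le).1.trans hy.1, hy.2⟩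
    · exact ⟨(S.h_in _ hs.1.le).1.trans hy.1, hy.2⟩
    · exact ⟨((S.h_in _ hs.1.le).1.trans hy.1).le, hy.2.le⟩
    · have h1 := mul_le_mul_of_nonneg_left (hC₁ s hs) hN0
      have h2 := abs_sub_le (S.v s (S.h s)) (S.v 0 (S.h 0)) (heatFlow V s (S.h s))
      rw [abs_sub_comm (S.v 0 (S.h 0))] at h2
      linarith [hVlip s (S.h s), hh s hs]
    · rw [S.bc_right s hs.1, hV1 s, sub_zero, abs_zero]
      exact mul_nonneg (by positivity) hs.1
  set C := (B * M + 1 + (C₂ + M * C₁)) + (B * N + 1 + (C₂ + N * C₁)) + (M + N) * C₁ with hC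
  have hnear : ∀ s ∈ Icc (0 : ℝ) 1, ∀ y, |y - S.h 0| ≤ C₁ * s →
      |heatFlow U s y - heatFlow V s y| ≤ (M + N) * C₁ * s := fun s hs y hy => by
    have h1 := mul_le_mul_of_nonneg_left hy hM0
    have h2 := mul_le_mul_of_nonneg_left hy hN0
    have h3 := abs_sub_le (heatFlow U s y) (S.v 0 (S.h 0)) (heatFlow V s y)
    rw [abs_sub_comm (S.v 0 (S.h 0))] at h3
    linarith [hUlip s y, hVlip s y]
  have hn1 : ∀ s ∈ Icc (0 : ℝ) 1, 0 ≤ (B * M + 1 + (C₂ + M * C₁)) * s := fun s hs =>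
    mul_nonneg (by positivity) hs.1
  have hn2 : ∀ s ∈ Icc (0 : ℝ) 1, 0 ≤ (B * N + 1 + (C₂ + N * C₁)) * s := fun s hs =>
    mul_nonneg (by positivity) hs.1
  have hn3 : ∀ s ∈ Icc (0 : ℝ) 1, 0 ≤ (M + N) * C₁ * s := fun s hs =>
    mul_nonneg (by positivity) hs.1
  have hleft' : ∀ s ∈ Icc (0 : ℝ) 1, ∀ y ∈ Icc (-1) (S.h 0),
      |S.v s y - heatFlow U s y| ≤ C * s := by
    intro s hs y hy
    rw [hC, add_mul, add_mul]
    rcases le_total y (S.h s) with hle | hle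
    · linarith [hleft s hs y ⟨hy.1, hle⟩, hn2 s hs, hn3 s hs]
    · have h1 := hright s hs y ⟨hle, hy.2.trans hr.le⟩
      have h2 : |y - S.h 0| ≤ C₁ * s := by
        refine le_trans ?_ (hC₁ s hs)
        rw [abs_of_nonpos (by linarith [hy.2]), abs_of_nonpos (by linarith [hy.2])]
        linarith
      have h3 := hnear s hs y h2
      have h4 := abs_sub_le (S.v s y) (heatFlow V s y) (heatFlow U s y)
      rw [abs_sub_comm (heatFlow V s y)] at h4
      linarith [hn1 s hs]
  have hright' : ∀ s ∈ Icc (0 : ℝ) 1, ∀ y ∈ Icc (S.h 0) 1,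
      |S.v s y - heatFlow V s y| ≤ C * s := by
    intro s hs y hy
    rw [hC, add_mul, add_mul]
    rcases le_total (S.h s) y with hle | hle
    · linarith [hright s hs y ⟨hle, hy.2⟩, hn1 s hs, hn3 s hs]
    · have h1 := hleft s hs y ⟨hl.le.trans hy.1, hle⟩
      have h2 : |y - S.h 0| ≤ C₁ * s := by
        refine le_trans ?_ (hC₁ s hs)
        rw [abs_of_nonneg (by linarith [hy.1]), abs_of_nonneg (by linarith [hy.1])]
        linarith
      have h3 := hnear s hs y h2
      have h4 := abs_sub_le (S.v s y) (heatFlow U s y) (heatFlow V s y)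
      linarith [hn2 s hs]
  have dL := hasDerivWithinAt_integral_sq_of_near_heatFlow hU hp hM hl.le
    (fun s hs => (S.continuousOn_v hs.1).mono (Icc_subset_Icc_right hr.le)) hleft'
    (zt := S.vt 0) (q := S.vyy 0)
    (fun y hy => (S.hasDeriv_t 0 le_rfl y ⟨hy.1.le, (hy.2.trans hr).le⟩).hasDerivWithinAt)
    (fun y hy => (hpv y hy).2) (fun y hy => by
      rw [hUv (Ioo_subset_Icc_self hy), (hpv y hy).1]
      exact S.pde 0 le_rfl y ⟨hy.1, hy.2.trans hr⟩ hy.2.ne)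
  have dR := hasDerivWithinAt_integral_sq_of_near_heatFlow hV hq hN hr.le
    (fun s hs => (S.continuousOn_v hs.1).mono (Icc_subset_Icc_left hl.le)) hright'
    (zt := S.vt 0) (q := S.vyy 0)
    (fun y hy => (S.hasDeriv_t 0 le_rfl y ⟨(hl.trans hy.1).le, hy.2.le⟩).hasDerivWithinAt)
    (fun y hy => (hqv y hy).2) (fun y hy => by
      rw [hVv (Ioo_subset_Icc_self hy), (hqv y hy).1]
      exact S.pde 0 le_rfl y ⟨hl.trans hy.1, hy.2⟩ hy.1.ne')
  have dg : HasDerivWithinAt (fun s => deriv S.h s ^ 2)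
      (2 * S.v 0 (S.h 0) * (S.vyR 0 - S.vyL 0)) (Ici 0) 0 := by
    have h := (S.contDiff_deriv_h.differentiable one_ne_zero 0).hasDerivAt
    rw [S.ode2 0 le_rfl] at h
    refine ((h.pow 2).congr_deriv ?_).hasDerivWithinAt
    rw [S.ode1 0 le_rfl]
    simp
  have hUa : U (-1) = 0 := by rw [hUv ⟨le_rfl, hl.le⟩, S.bc_left 0 le_rfl]
  have hUb : U (S.h 0) = S.v 0 (S.h 0) := hUv ⟨hl.le, le_rfl⟩
  have hVa : V (S.h 0) = S.v 0 (S.h 0) := hVv ⟨le_rfl, hr.le⟩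
  have hVb : V 1 = 0 := by rw [hVv ⟨hr.le, le_rfl⟩, S.bc_right 0 le_rfl]
  have hsplit : ∀ s, 0 ≤ s → S.energy s = (∫ y in (-1)..(S.h 0), S.v s y ^ 2)
      + (∫ y in (S.h 0)..1, S.v s y ^ 2) + deriv S.h s ^ 2 := by
    intro s hs
    have hc : ContinuousOn (fun y => S.v s y ^ 2) (Icc (-1) 1) := (S.continuousOn_v hs).pow 2
    rw [energy, intervalIntegral.integral_add_adjacent_intervals]
    · refine ContinuousOn.intervalIntegrable (hc.mono ?_)
      rw [uIcc_of_le hl.le]; exact Icc_subset_Icc_right hr.le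
    · refine ContinuousOn.intervalIntegrable (hc.mono ?_)
      rw [uIcc_of_le hr.le]; exact Icc_subset_Icc_left hl.le
  refine ⟨_, ((dL.add dR).add dg).congr (fun s hs => hsplit s hs) (hsplit 0 le_rfl), ?_⟩
  have eL : ∫ y in (-1)..(S.h 0), S.v 0 y ^ 2 = ∫ y in (-1)..(S.h 0), U y ^ 2 :=
    intervalIntegral.integral_congr fun y hy => by
      rw [uIcc_of_le hl.le] at hy; simp only [hUv hy]
  have eR : ∫ y in (S.h 0)..1, S.v 0 y ^ 2 = ∫ y in (S.h 0)..1, V y ^ 2 :=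
    intervalIntegral.integral_congr fun y hy => by
      rw [uIcc_of_le hr.le] at hy; simp only [hVv hy]
  have pL := integral_sq_le_mul_integral_sq_deriv hU hp hl.le (Or.inl hUa)
  have pR := integral_sq_le_mul_integral_sq_deriv hV hq hr.le (Or.inr hVb)
  have pg := sq_sub_le_mul_integral_sq hU hp hl.le
  have nL : 0 ≤ ∫ y in (-1)..(S.h 0), p y ^ 2 :=
    intervalIntegral.integral_nonneg hl.le fun x _ => sq_nonneg _
  have nR : 0 ≤ ∫ y in (S.h 0)..1, q y ^ 2 :=
    intervalIntegral.integral_nonneg hr.le fun x _ => sq_nonneg _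
  rw [hsplit 0 le_rfl, eL, eR, S.ode1 0 le_rfl]
  rw [hUa, hUb, sub_zero] at pg
  rw [hUa, hUb, hVa, hVb, hph, hqh]
  have l1 : (S.h 0 - -1) ^ 2 ≤ 4 := by nlinarith
  have l2 : (1 - S.h 0) ^ 2 ≤ 4 := by nlinarith
  have l3 : S.h 0 - -1 ≤ 2 := by linarith
  have := mul_le_mul_of_nonneg_right l1 nL
  have := mul_le_mul_of_nonneg_right l2 nR
  have := mul_le_mul_of_nonneg_right l3 nL
  linarith

lemma exists_hasDerivWithinAt_energy (S : FluidParticleSol 0 h₁) (t : ℝ) (ht : 0 ≤ t) :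
    ∃ e, HasDerivWithinAt S.energy e (Ici t) t ∧ e ≤ -(1 / 4) * S.energy t := by
  obtain ⟨e, he, hle⟩ := (S.shift t ht).exists_hasDerivWithinAt_energy_zero
  rw [energy_shift, add_zero] at hle
  refine ⟨e, ?_, hle⟩
  have h1 : HasDerivWithinAt (fun s : ℝ => s - t) 1 (Ici t) t :=
    ((hasDerivAt_id t).sub_const t).hasDerivWithinAt
  refine ((he.comp_of_eq t h1 (fun s hs => mem_Ici.2 (sub_nonneg.2 hs)) (sub_self t).symm).congr_deriv
    (mul_one e)).congr (fun s _ => ?_) ?_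
  · simp [energy_shift]
  · simp [energy_shift]

end FluidParticleSol

/-- Exponential decay of the kinetic energy in the uncontrolled case `K = 0`. -/
theorem energy_decay_K_zero {h₁ : ℝ} (S : FluidParticleSol 0 h₁) (t : ℝ) (ht : 0 ≤ t) :
    (∫ y in (-1 : ℝ)..1, (S.v t y) ^ 2) + (deriv S.h t) ^ 2
      ≤ Real.exp (-t / 4) * ((∫ y in (-1 : ℝ)..1, (S.v 0 y) ^ 2) + (deriv S.h 0) ^ 2) := by
  choose! e he hle using S.exists_hasDerivWithinAt_energy
  have key := le_gronwallBound_of_liminf_deriv_right_le (f := S.energy) (f' := e)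
    (δ := S.energy 0) (K := -(1 / 4)) (ε := 0) (a := 0) (b := t)
    (S.continuousOn_energy.mono Icc_subset_Ici_self)
    (fun x hx r hr => (he x hx.1).liminf_right_slope_le hr) le_rfl
    (fun x hx => by rw [add_zero]; exact hle x hx.1) t ⟨ht, le_rfl⟩
  rw [gronwallBound_ε0, sub_zero, mul_comm, show -(1 / 4) * t = -t / 4 by ring] at key
  exact key
end

section
/- Let K ≥ 0 and h₁ ∈ (−1,1), and let (v,h) be a classical solution of the fluid–particle system on [0,∞). Then ∫_{0}^{∞} (∫_{−1}^{1} v(t,y)² dy + g(t)²) dt ≤ 3·(∫_{−1}^{1} v₀(y)² dy + g₀² + K(h₀−h₁)²); in particular the kinetic energy t ↦ ∫_{−1}^{1} v(t,y)² dy + g(t)² is integrable on (0,∞). -/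
open Real Set MeasureTheory Filter

/-- A function with a one-sided maximum from the left has nonnegative derivative there. -/
lemma HasDerivAt.nonneg_of_le_left {f : ℝ → ℝ} {c t : ℝ} (hf : HasDerivAt f c t)
    (hmax : ∀ᶠ s in nhdsWithin t (Iio t), f s ≤ f t) : 0 ≤ c := by
  have h := (hasDerivAt_iff_tendsto_slope_left_right.1 hf).1
  refine ge_of_tendsto h ?_
  filter_upwards [hmax, self_mem_nhdsWithin] with s hs hst
  rw [slope_def_field]
  exact div_nonneg_of_nonpos (by linarith) (by simp only [mem_Iio] at hst; linarith)

/-- First and second order necessary conditions at a local maximum. -/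
lemma IsLocalMax.second_deriv_test {f f' : ℝ → ℝ} {c x : ℝ} (hm : IsLocalMax f x)
    (hf : ∀ᶠ y in nhds x, HasDerivAt f (f' y) y) (hf' : HasDerivAt f' c x) :
    f' x = 0 ∧ c ≤ 0 := by
  have h0 : f' x = 0 := hm.hasDerivAt_eq_zero hf.self_of_nhds
  refine ⟨h0, ?_⟩
  by_contra! hc
  have hd : deriv f =ᶠ[nhds x] f' := hf.mono fun y hy => hy.deriv
  have hdd : deriv (deriv f) x = c := by rw [hd.deriv_eq, hf'.deriv]
  have hmin : IsLocalMin f x :=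
    isLocalMin_of_deriv_deriv_pos (by rw [hdd]; exact hc) (by rw [hd.self_of_nhds, h0])
      hf.self_of_nhds.continuousAt
  have hconst : f =ᶠ[nhds x] fun _ => f x := by
    filter_upwards [hm, hmin] with y h1 h2 using le_antisymm h1 h2
  have h1 : deriv f =ᶠ[nhds x] fun _ => 0 := by
    have := hconst.deriv
    simpa using this
  have h2 := h1.deriv_eq
  rw [hdd] at h2
  simp at h2
  linarith

lemma abs_le_of_sign {a b : ℝ} (h : ∀ σ : ℝ, σ = 1 ∨ σ = -1 → σ * a ≤ b) : |a| ≤ b := by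
  have h1 := h 1 (Or.inl rfl)
  have h2 := h (-1) (Or.inr rfl)
  exact abs_le.2 ⟨by linarith, by linarith⟩

lemma sign_mul_le_abs {σ : ℝ} (hσ : σ = 1 ∨ σ = -1) (a : ℝ) : σ * a ≤ |a| := by
  rcases hσ with rfl | rfl
  · simpa using le_abs_self a
  · simpa using neg_le_abs a

/-- A concave modulus which is a strict supersolution for drifts of size `2 * M`
and sources of size `G`. -/
structure BarrierData (M G d L₀ : ℝ) where
  f : ℝ → ℝ
  f' : ℝ → ℝ
  f'' : ℝ → ℝ
  L : ℝ
  hL : 0 ≤ L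
  deriv1 : ∀ r, HasDerivAt f (f' r) r
  deriv2 : ∀ r, HasDerivAt f' (f'' r) r
  zero : f 0 = 0
  nonneg' : ∀ r, 0 ≤ f' r
  super : ∀ r, r ≤ 2 → f'' r + 2 * M * f' r + G < 0
  lower : ∀ r, 0 ≤ r → r ≤ 2 → L₀ * r ≤ f r
  upper : ∀ r, f r ≤ L * r
  large : ∀ r, d ≤ r → 2 * M ≤ f r
  mono : Monotone f

lemma exists_barrierData {M G d L₀ : ℝ} (hM : 0 ≤ M) (hG : 0 ≤ G) (hd : 0 < d) (hd2 : d ≤ 2)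
    (hL₀ : 0 ≤ L₀) : Nonempty (BarrierData M G d L₀) := by
  set a : ℝ := 2 * M + 1 with ha
  have ha0 : 0 < a := by positivity
  set B : ℝ := G + 1 + L₀ + 2 * M / d with hB
  have hMd : 0 ≤ 2 * M / d := by positivity
  have hB0 : 0 < B := by positivity
  let f : ℝ → ℝ := fun r => B / a * (exp (2 * a) - exp (a * (2 - r)))
  let f' : ℝ → ℝ := fun r => B * exp (a * (2 - r))
  have hlin : ∀ r, HasDerivAt (fun r : ℝ => a * (2 - r)) (-a) r := fun r => by
    have := ((hasDerivAt_id r).const_sub 2).const_mul a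
    simpa using this
  have d1 : ∀ r, HasDerivAt f (f' r) r := fun r => by
    have := (((hlin r).exp).const_sub (exp (2 * a))).const_mul (B / a)
    refine this.congr_deriv ?_
    simp only [f']
    field_simp
  have d2 : ∀ r, HasDerivAt f' (-a * f' r) r := fun r => by
    have := ((hlin r).exp).const_mul B
    refine this.congr_deriv ?_
    simp only [f']
    ring
  have hnn : ∀ r, 0 ≤ f' r := fun r => by positivity
  have hmono : Monotone f := monotone_of_hasDerivAt_nonneg d1 hnn
  have hf'B : ∀ r, r ≤ 2 → B ≤ f' r := fun r hr => by
    have : 1 ≤ exp (a * (2 - r)) := one_le_exp (mul_nonneg ha0.le (by linarith))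
    simp only [f']
    nlinarith
  have hlow : ∀ r, 0 ≤ r → r ≤ 2 → B * r ≤ f r := fun r hr0 hr => by
    have h1 : 1 ≤ exp (a * (2 - r)) := one_le_exp (mul_nonneg ha0.le (by linarith))
    have h2 : exp (2 * a) = exp (a * (2 - r)) * exp (a * r) := by
      rw [← exp_add]; ring_nf
    have h3 : a * r + 1 ≤ exp (a * r) := add_one_le_exp _
    have h4 : a * r ≤ exp (2 * a) - exp (a * (2 - r)) := by
      rw [h2]
      nlinarith [mul_nonneg ha0.le hr0]
    calc B * r = B / a * (a * r) := by field_simp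
      _ ≤ _ := mul_le_mul_of_nonneg_left h4 (by positivity)
  refine ⟨⟨f, f', fun r => -a * f' r, B * exp (2 * a), by positivity, d1, d2, ?_, hnn, ?_, ?_,
    ?_, ?_, hmono⟩⟩
  · simp [f, mul_comm]
  · intro r hr
    have := hf'B r hr
    rw [ha]
    nlinarith
  · intro r hr0 hr
    refine le_trans (mul_le_mul_of_nonneg_right ?_ hr0) (hlow r hr0 hr)
    linarith
  · intro r
    have h2 : exp (a * (2 - r)) = exp (2 * a) * exp (-(a * r)) := by
      rw [← exp_add]; ring_nf
    have h3 : -(a * r) + 1 ≤ exp (-(a * r)) := add_one_le_exp _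
    have h4 : exp (2 * a) - exp (a * (2 - r)) ≤ exp (2 * a) * (a * r) := by
      rw [h2]
      nlinarith [exp_pos (2 * a)]
    calc f r ≤ B / a * (exp (2 * a) * (a * r)) :=
          mul_le_mul_of_nonneg_left h4 (by positivity)
      _ = _ := by field_simp
  · intro r hr
    refine le_trans ?_ (hmono hr)
    refine le_trans ?_ (hlow d hd.le hd2)
    have : 2 * M / d * d = 2 * M := by field_simp
    nlinarith

lemma exists_pos_max {X : Type*} [TopologicalSpace X] {k : Set X} {z : X → ℝ} (hk : IsCompact k)
    (hz : ContinuousOn z k) {p : X} (hp : p ∈ k) (hpos : 0 < z p) :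
    ∃ q ∈ k, 0 < z q ∧ ∀ r ∈ k, z r ≤ z q := by
  obtain ⟨q, hq, hmax⟩ := hk.exists_isMaxOn ⟨p, hp⟩ hz
  exact ⟨q, hq, hpos.trans_le (hmax hp), fun r hr => hmax hr⟩

lemma eventually_left_mem {t : ℝ} (ht : 0 < t) {T : ℝ} (hT : t ≤ T) :
    ∀ᶠ s in nhdsWithin t (Iio t), s ∈ Icc 0 T := by
  filter_upwards [nhdsWithin_le_nhds (Ioi_mem_nhds ht), self_mem_nhdsWithin] with s h1 h2
  exact ⟨le_of_lt h1, (le_of_lt h2).trans hT⟩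

lemma BarrierData.comp_affine {M G d L₀ : ℝ} (b : BarrierData M G d L₀) (τ c : ℝ) :
    (∀ x, HasDerivAt (fun x => b.f (τ * x + c)) (τ * b.f' (τ * x + c)) x) ∧
    ∀ x, HasDerivAt (fun x => τ * b.f' (τ * x + c)) (τ * (τ * b.f'' (τ * x + c))) x := by
  have hl : ∀ x, HasDerivAt (fun x : ℝ => τ * x + c) τ x := fun x => by
    simpa using ((hasDerivAt_id x).const_mul τ).add_const c
  refine ⟨fun x => ?_, fun x => ?_⟩
  · have := (b.deriv1 (τ * x + c)).comp x (hl x)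
    rwa [mul_comm] at this
  · have := ((b.deriv2 (τ * x + c)).comp x (hl x)).const_mul τ
    rwa [mul_comm (b.f'' _)] at this

lemma BarrierData.continuous {M G d L₀ : ℝ} (b : BarrierData M G d L₀) : Continuous b.f :=
  continuous_iff_continuousAt.2 fun r => (b.deriv1 r).continuousAt

lemma BarrierData.nonneg {M G d L₀ : ℝ} (b : BarrierData M G d L₀) {r : ℝ} (hr : 0 ≤ r) :
    0 ≤ b.f r := b.zero ▸ b.mono hr

namespace FluidParticleSol

variable {K h₁ : ℝ} (S : FluidParticleSol K h₁)

lemma hasDerivAt_h (t : ℝ) : HasDerivAt S.h (deriv S.h t) t :=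
  ((S.h_C2.differentiable (by norm_num)) t).hasDerivAt

lemma contDiff_deriv_h_s8 : ContDiff ℝ 1 (deriv S.h) := by
  have : ContDiff ℝ (1 + 1) S.h := by
    have h2 : (1 + 1 : WithTop ℕ∞) = 2 := by norm_num
    rw [h2]; exact S.h_C2
  exact (contDiff_succ_iff_deriv.1 this).2.2

lemma hasDerivAt_deriv_h (t : ℝ) : HasDerivAt (deriv S.h) (deriv (deriv S.h) t) t :=
  ((S.contDiff_deriv_h_s8.differentiable (by norm_num)) t).hasDerivAt

lemma continuous_h : Continuous S.h := S.h_C2.continuous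

lemma continuous_deriv_h : Continuous (deriv S.h) := S.contDiff_deriv_h_s8.continuous

lemma continuous_deriv_deriv_h : Continuous (deriv (deriv S.h)) :=
  S.contDiff_deriv_h_s8.continuous_deriv (by norm_num)

lemma h_mem {t : ℝ} (ht : 0 ≤ t) : S.h t ∈ Icc (-1 : ℝ) 1 := Ioo_subset_Icc_self (S.h_in t ht)

lemma continuousOn_v_slice {t : ℝ} (ht : 0 ≤ t) : ContinuousOn (S.v t) (Icc (-1) 1) :=
  S.v_cont.comp (f := fun y => (t, y)) (by fun_prop) (fun _ hy => ⟨ht, hy⟩)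

/-- Continuity of `v` composed with continuous maps into its domain. -/
lemma continuousOn_v_comp {X : Type*} [TopologicalSpace X] {s : Set X} {a b : X → ℝ}
    (ha : Continuous a) (hb : Continuous b) (hs : ∀ p ∈ s, 0 ≤ a p ∧ b p ∈ Icc (-1 : ℝ) 1) :
    ContinuousOn (fun p => S.v (a p) (b p)) s :=
  S.v_cont.comp (f := fun p => (a p, b p)) (by fun_prop) hs

lemma exists_bounds (T : ℝ) (hT : 0 ≤ T) : ∃ M G d : ℝ, 0 ≤ M ∧ 0 ≤ G ∧ 0 < d ∧ d ≤ 1 ∧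
    (∀ t ∈ Icc 0 T, ∀ y ∈ Icc (-1 : ℝ) 1, |S.v t y| ≤ M) ∧
    (∀ t ∈ Icc 0 T, |deriv (deriv S.h) t| ≤ G) ∧
    (∀ t ∈ Icc 0 T, -1 + d ≤ S.h t ∧ S.h t ≤ 1 - d) := by
  have hc : IsCompact (Icc 0 T ×ˢ Icc (-1 : ℝ) 1) := isCompact_Icc.prod isCompact_Icc
  obtain ⟨M, hM⟩ := hc.exists_bound_of_continuousOn
    (S.v_cont.mono (prod_mono Icc_subset_Ici_self Subset.rfl))
  obtain ⟨G, hG⟩ := (isCompact_Icc (a := (0 : ℝ)) (b := T)).exists_bound_of_continuousOn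
    S.continuous_deriv_deriv_h.continuousOn
  obtain ⟨t₀, ht₀, hmax⟩ := (isCompact_Icc (a := (0 : ℝ)) (b := T)).exists_isMaxOn
    ⟨0, left_mem_Icc.2 hT⟩ (S.continuous_h.abs.continuousOn)
  have h0 := S.h_in t₀ ht₀.1
  have h1 : |S.h t₀| < 1 := abs_lt.2 h0
  refine ⟨|M|, |G|, 1 - |S.h t₀|, abs_nonneg _, abs_nonneg _, by linarith, ?_, ?_, ?_, ?_⟩
  · linarith [abs_nonneg (S.h t₀)]
  · intro t ht y hy
    exact (hM (t, y) ⟨ht, hy⟩).trans (le_abs_self _)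
  · intro t ht
    exact (hG t ht).trans (le_abs_self _)
  · intro t ht
    have h2 : |S.h t| ≤ |S.h t₀| := hmax ht
    have := abs_le.1 h2
    exact ⟨by linarith, by linarith⟩

lemma continuousOn_update_vyL {t : ℝ} (ht : 0 ≤ t) :
    ContinuousOn (Function.update (S.vy t) (S.h t) (S.vyL t)) (Icc (-1) (S.h t)) := by
  rw [continuousOn_update_iff, Icc_sdiff_right]
  exact ⟨S.vy_contL t ht, fun _ => (S.vy_limL t ht).mono_left
    (nhdsWithin_mono _ fun y hy => hy.2)⟩

lemma continuousOn_update_vyR {t : ℝ} (ht : 0 ≤ t) :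
    ContinuousOn (Function.update (S.vy t) (S.h t) (S.vyR t)) (Icc (S.h t) 1) := by
  rw [continuousOn_update_iff, Icc_sdiff_left]
  exact ⟨S.vy_contR t ht, fun _ => (S.vy_limR t ht).mono_left
    (nhdsWithin_mono _ fun y hy => hy.1)⟩

/-- The spatial derivative is bounded at each fixed time. -/
lemma exists_vy_bound {t : ℝ} (ht : 0 ≤ t) :
    ∃ B : ℝ, 0 ≤ B ∧ ∀ y ∈ Icc (-1 : ℝ) 1, y ≠ S.h t → |S.vy t y| ≤ B := by
  obtain ⟨A, hA⟩ := isCompact_Icc.exists_bound_of_continuousOn (S.continuousOn_update_vyL ht)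
  obtain ⟨B, hB⟩ := isCompact_Icc.exists_bound_of_continuousOn (S.continuousOn_update_vyR ht)
  refine ⟨max |A| |B|, by positivity, fun y hy hne => ?_⟩
  rcases le_total y (S.h t) with h | h
  · have := hA y ⟨hy.1, h⟩
    rw [Function.update_of_ne hne] at this
    exact this.trans ((le_abs_self _).trans (le_max_left _ _))
  · have := hB y ⟨h, hy.2⟩
    rw [Function.update_of_ne hne] at this
    exact this.trans ((le_abs_self _).trans (le_max_right _ _))

lemma slice_lipschitz {t : ℝ} (ht : 0 ≤ t) : ∃ L : ℝ, 0 ≤ L ∧ ∀ x ∈ Icc (-1 : ℝ) 1,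
    ∀ y ∈ Icc (-1 : ℝ) 1, |S.v t x - S.v t y| ≤ L * |x - y| := by
  obtain ⟨B, hB0, hB⟩ := S.exists_vy_bound ht
  have key : ∀ a b, -1 ≤ a → a < b → b ≤ 1 → (∀ z ∈ Ioo a b, z ≠ S.h t) →
      |S.v t b - S.v t a| ≤ B * (b - a) := by
    intro a b ha hab hb hz
    obtain ⟨c, hc, hc'⟩ := exists_hasDerivAt_eq_slope (S.v t) (S.vy t) hab
      ((S.continuousOn_v_slice ht).mono (Icc_subset_Icc ha hb))
      (fun z hz' => S.hasDeriv_y t ht z ⟨by linarith [hz'.1], by linarith [hz'.2]⟩ (hz z hz'))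
    have h1 := hB c ⟨by linarith [hc.1], by linarith [hc.2]⟩ (hz c hc)
    rw [hc', abs_div, abs_of_pos (sub_pos.2 hab), div_le_iff₀ (sub_pos.2 hab)] at h1
    exact h1
  have key2 : ∀ a b, -1 ≤ a → a < b → b ≤ 1 → |S.v t b - S.v t a| ≤ B * (b - a) := by
    intro a b ha hab hb
    by_cases hh : S.h t ∈ Ioo a b
    · have h1 := key a (S.h t) ha hh.1 (by linarith [hh.2]) (fun z hz => hz.2.ne)
      have h2 := key (S.h t) b (by linarith [hh.1]) hh.2 hb (fun z hz => hz.1.ne')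
      have h3 := abs_sub_le (S.v t b) (S.v t (S.h t)) (S.v t a)
      linarith
    · exact key a b ha hab hb (fun z hz he => hh (he ▸ hz))
  refine ⟨B, hB0, fun x hx y hy => ?_⟩
  rcases lt_trichotomy x y with h | h | h
  · rw [abs_sub_comm, abs_sub_comm x, abs_of_pos (sub_pos.2 h)]
    exact key2 x y hx.1 h hy.2
  · subst h; simp
  · rw [abs_of_pos (sub_pos.2 h)]
    exact key2 y x hy.1 h hx.2

/-- Spatial derivatives exist near any point off the interface. -/
lemma eventually_hasDerivAt {t y : ℝ} (ht : 0 ≤ t) (hy : y ∈ Ioo (-1 : ℝ) 1) (hne : y ≠ S.h t) :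
    ∀ᶠ x in nhds y, HasDerivAt (S.v t) (S.vy t x) x := by
  filter_upwards [Ioo_mem_nhds hy.1 hy.2, isOpen_ne.mem_nhds hne] with x h1 h2
  exact S.hasDeriv_y t ht x h1 h2

/-- Touching principle: a function touching `σ * v` from above at a point off the interface is a
subsolution of the linear equation with drift `v` there. -/
lemma touching {σ t y : ℝ} (ht : 0 < t) (hy : y ∈ Ioo (-1 : ℝ) 1)
    (hne : y ≠ S.h t) {α β β' : ℝ → ℝ} {α' β'' : ℝ} (hα : HasDerivAt α α' t)
    (hβ : ∀ x, HasDerivAt β (β' x) x) (hβ' : HasDerivAt β' β'' y)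
    (hmt : ∀ᶠ s in nhdsWithin t (Iio t), σ * S.v s y - α s ≤ σ * S.v t y - α t)
    (hmy : ∀ᶠ x in nhds y, σ * S.v t x - β x ≤ σ * S.v t y - β y) :
    α' + S.v t y * β' y ≤ β'' := by
  have hyI := Ioo_subset_Icc_self hy
  have h1 : 0 ≤ σ * S.vt t y - α' :=
    (((S.hasDeriv_t t ht.le y hyI).const_mul σ).sub hα).nonneg_of_le_left hmt
  obtain ⟨h2, h3⟩ := IsLocalMax.second_deriv_test (f := fun x => σ * S.v t x - β x)
    (f' := fun x => σ * S.vy t x - β' x) (c := σ * S.vyy t y - β'') (x := y) hmy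
    (by
      filter_upwards [S.eventually_hasDerivAt ht.le hy hne] with x hx
      exact (hx.const_mul σ).sub (hβ x))
    (((S.hasDeriv_yy t ht.le y hy hne).const_mul σ).sub hβ')
  have h4 := S.pde t ht.le y hy hne
  have h5 : β' y = σ * S.vy t y := by linarith
  rw [h5]
  have h6 : σ * S.vt t y + S.v t y * (σ * S.vy t y) = σ * S.vyy t y := by
    rw [← h4]; ring
  linarith

end FluidParticleSol

namespace FluidParticleSol

variable {K h₁ : ℝ} (S : FluidParticleSol K h₁)

/-- Near the interface, `v` stays close to the particle velocity. -/
lemma interface_barrier {T M G d L₀ : ℝ}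
    (hv : ∀ t ∈ Icc 0 T, ∀ y ∈ Icc (-1 : ℝ) 1, |S.v t y| ≤ M)
    (hG : ∀ t ∈ Icc 0 T, |deriv (deriv S.h) t| ≤ G)
    (hd : ∀ t ∈ Icc 0 T, -1 + d ≤ S.h t ∧ S.h t ≤ 1 - d)
    (hL₀ : ∀ x ∈ Icc (-1 : ℝ) 1, ∀ y ∈ Icc (-1 : ℝ) 1, |S.v 0 x - S.v 0 y| ≤ L₀ * |x - y|)
    (b : BarrierData M G d L₀) :
    ∀ t ∈ Icc 0 T, ∀ y ∈ Icc (-1 : ℝ) 1, |S.v t y - S.v t (S.h t)| ≤ b.f |y - S.h t| := by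
  have key : ∀ σ : ℝ, σ = 1 ∨ σ = -1 → ∀ τ : ℝ, τ = 1 ∨ τ = -1 → ∀ t ∈ Icc 0 T,
      ∀ y ∈ Icc (-1 : ℝ) 1, 0 ≤ τ * (y - S.h t) →
      σ * (S.v t y - deriv S.h t) ≤ b.f (τ * (y - S.h t)) := by
    intro σ hσ τ hτ t₁ ht₁ y₁ hy₁ hτ₁
    have hττ : τ * τ = 1 := by rcases hτ with rfl | rfl <;> norm_num
    by_contra! hcon
    let k : Set (ℝ × ℝ) := (Icc 0 T ×ˢ Icc (-1 : ℝ) 1) ∩ {p | 0 ≤ τ * (p.2 - S.h p.1)}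
    have hch := S.continuous_h
    have hcg := S.continuous_deriv_h
    have hcb := b.continuous
    have hk : IsCompact k := (isCompact_Icc.prod isCompact_Icc).inter_right
      (isClosed_le continuous_const (by fun_prop))
    let z : ℝ × ℝ → ℝ := fun p =>
      σ * (S.v p.1 p.2 - deriv S.h p.1) - b.f (τ * (p.2 - S.h p.1))
    have hz : ContinuousOn z k := by
      refine ContinuousOn.sub (continuousOn_const.mul (ContinuousOn.sub ?_ ?_)) ?_
      · exact S.continuousOn_v_comp continuous_fst continuous_snd
          (fun p hp => ⟨hp.1.1.1, hp.1.2⟩)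
      · exact Continuous.continuousOn (by fun_prop)
      · exact Continuous.continuousOn (by fun_prop)
    obtain ⟨⟨t, y⟩, ⟨⟨ht, hy⟩, hτy⟩, hpos, hmax⟩ :=
      exists_pos_max hk hz (p := (t₁, y₁)) ⟨⟨ht₁, hy₁⟩, hτ₁⟩ (by simp only [z]; linarith)
    simp only [mem_ofPred_eq] at ht hy hτy
    simp only [z] at hpos hmax
    have hh := S.h_mem ht.1
    have hode := S.ode1 t ht.1
    have habs : |y - S.h t| = τ * (y - S.h t) := by
      rcases hτ with rfl | rfl
      · rw [abs_of_nonneg (by linarith)]; ring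
      · rw [abs_of_nonpos (by linarith)]; ring
    have hle2 : τ * (y - S.h t) ≤ 2 := by
      rw [← habs, abs_le]; constructor <;> linarith [hy.1, hy.2, hh.1, hh.2]
    have ht0 : 0 < t := by
      rcases ht.1.eq_or_lt with h0 | h0
      · subst h0
        exfalso
        have h1 := hL₀ y hy (S.h 0) hh
        have h2 := b.lower _ hτy hle2
        have h3 := sign_mul_le_abs hσ (S.v 0 y - S.v 0 (S.h 0))
        rw [habs] at h1
        rw [hode] at hpos
        linarith
      · exact h0
    have hne : y ≠ S.h t := by
      intro he
      rw [he, hode] at hpos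
      simp [b.zero] at hpos
    have hgM : σ * (-S.v t (S.h t)) ≤ M :=
      (sign_mul_le_abs hσ _).trans (by rw [abs_neg]; exact hv t ht _ hh)
    have hM0 : 0 ≤ M := (abs_nonneg _).trans (hv t ht _ hh)
    have hbig : d ≤ |y - S.h t| → S.v t y ≠ 0 := by
      intro hdy h0
      have := b.large _ hdy
      rw [h0, hode, ← habs] at hpos
      rw [zero_sub] at hpos
      linarith
    have hdt := hd t ht
    have hyI : y ∈ Ioo (-1 : ℝ) 1 := by
      refine ⟨lt_of_le_of_ne hy.1 ?_, lt_of_le_of_ne hy.2 ?_⟩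
      · rintro rfl
        exact hbig (by rw [abs_of_nonpos (by linarith [hh.1])]; linarith) (S.bc_left t ht.1)
      · rintro rfl
        exact hbig (by rw [abs_of_nonneg (by linarith [hh.2])]; linarith) (S.bc_right t ht.1)
    have hτpos : 0 < τ * (y - S.h t) := by
      rw [← habs]; exact abs_pos.2 (sub_ne_zero.2 hne)
    obtain ⟨hβ, hβ'⟩ := b.comp_affine τ (-(τ * S.h t))
    have harg : ∀ s x, τ * (x - S.h s) = τ * x + -(τ * S.h s) := fun s x => by ring
    have hα : HasDerivAt (fun s => σ * deriv S.h s + b.f (τ * (y - S.h s)))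
        (σ * deriv (deriv S.h) t + b.f' (τ * (y - S.h t)) * (τ * -deriv S.h t)) t := by
      refine ((S.hasDerivAt_deriv_h t).const_mul σ).add ?_
      exact (b.deriv1 (τ * (y - S.h t))).comp t (((S.hasDerivAt_h t).const_sub y).const_mul τ)
    have hcon := S.touching (σ := σ) ht0 hyI hne hα hβ (hβ' y)
      (by
        have hev : ∀ᶠ s in nhdsWithin t (Iio t), 0 < τ * (y - S.h s) :=
          nhdsWithin_le_nhds (((by fun_prop : Continuous fun s => τ * (y - S.h s)).tendsto t)
            (Ioi_mem_nhds hτpos))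
        filter_upwards [hev, eventually_left_mem ht0 ht.2] with s hs hsI
        have := hmax (s, y) ⟨⟨hsI, hy⟩, hs.le⟩
        simp only at this
        linarith)
      (by
        have hev : ∀ᶠ x in nhds y, 0 < τ * (x - S.h t) :=
          ((by fun_prop : Continuous fun x => τ * (x - S.h t)).tendsto y) (Ioi_mem_nhds hτpos)
        filter_upwards [hev, Ioo_mem_nhds hyI.1 hyI.2] with x hx hxI
        have := hmax (t, x) ⟨⟨ht, Ioo_subset_Icc_self hxI⟩, hx.le⟩
        simp only at this
        rw [← harg, ← harg]
        linarith)
    rw [← harg] at hcon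
    have h1 := b.super _ hle2
    have h2 := b.nonneg' (τ * (y - S.h t))
    set q := b.f' (τ * (y - S.h t)) with hq
    have h3 : -G ≤ σ * deriv (deriv S.h) t := by
      have := sign_mul_le_abs hσ (-deriv (deriv S.h) t)
      rw [abs_neg] at this
      linarith [hG t ht]
    have h4 : -(2 * M) ≤ τ * (S.v t y - deriv S.h t) := by
      have := sign_mul_le_abs hτ (-(S.v t y - deriv S.h t))
      rw [abs_neg, hode] at this
      rw [hode]
      have h5 := abs_sub (S.v t y) (S.v t (S.h t))
      linarith [hv t ht y hy, hv t ht _ hh]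
    have h5 : τ * (τ * b.f'' (τ * (y - S.h t))) = b.f'' (τ * (y - S.h t)) := by
      rw [← mul_assoc, hττ, one_mul]
    rw [h5] at hcon
    nlinarith [mul_le_mul_of_nonneg_right h4 h2]
  intro t ht y hy
  rw [← S.ode1 t ht.1]
  refine abs_le_of_sign fun σ hσ => ?_
  rcases le_total 0 (y - S.h t) with h | h
  · have := key σ hσ 1 (Or.inl rfl) t ht y hy (by linarith)
    rw [abs_of_nonneg h]
    simpa using this
  · have := key σ hσ (-1) (Or.inr rfl) t ht y hy (by linarith)
    rw [abs_of_nonpos h]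
    simpa using this

/-- Near the walls, `v` is controlled by the distance to the wall. -/
lemma wall_barrier {T M G d L₀ : ℝ} (hG : 0 ≤ G) (hM : 0 ≤ M)
    (hv : ∀ t ∈ Icc 0 T, ∀ y ∈ Icc (-1 : ℝ) 1, |S.v t y| ≤ M)
    (hd : ∀ t ∈ Icc 0 T, -1 + d ≤ S.h t ∧ S.h t ≤ 1 - d)
    (hL₀ : ∀ x ∈ Icc (-1 : ℝ) 1, ∀ y ∈ Icc (-1 : ℝ) 1, |S.v 0 x - S.v 0 y| ≤ L₀ * |x - y|)
    (b : BarrierData M G d L₀) {τ : ℝ} (hτ : τ = 1 ∨ τ = -1) :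
    ∀ t ∈ Icc 0 T, ∀ y ∈ Icc (-1 : ℝ) 1, |S.v t y| ≤ b.f (1 - τ * y) := by
  intro t₁ ht₁ y₁ hy₁
  refine abs_le_of_sign fun σ hσ => ?_
  by_contra! hcon
  have hττ : τ * τ = 1 := by rcases hτ with rfl | rfl <;> norm_num
  have hcb := b.continuous
  have hz : ContinuousOn (fun p : ℝ × ℝ => σ * S.v p.1 p.2 - b.f (1 - τ * p.2))
      (Icc 0 T ×ˢ Icc (-1 : ℝ) 1) := by
    refine ContinuousOn.sub (continuousOn_const.mul ?_) ?_
    · exact S.continuousOn_v_comp continuous_fst continuous_snd (fun p hp => ⟨hp.1.1, hp.2⟩)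
    · exact Continuous.continuousOn (by fun_prop)
  obtain ⟨⟨t, y⟩, ⟨ht, hy⟩, hpos, hmax⟩ :=
    exists_pos_max (isCompact_Icc.prod isCompact_Icc) hz (p := (t₁, y₁)) ⟨ht₁, hy₁⟩
      (by simp only; linarith)
  simp only at ht hy hpos hmax
  have hr : 0 ≤ 1 - τ * y ∧ 1 - τ * y ≤ 2 := by
    rcases hτ with rfl | rfl <;> constructor <;> linarith [hy.1, hy.2]
  have hf0 := b.nonneg hr.1
  have hv0 : S.v t y ≠ 0 := by
    intro h0; rw [h0] at hpos; linarith
  have hyI : y ∈ Ioo (-1 : ℝ) 1 := by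
    refine ⟨lt_of_le_of_ne hy.1 ?_, lt_of_le_of_ne hy.2 ?_⟩
    · rintro rfl; exact hv0 (S.bc_left t ht.1)
    · rintro rfl; exact hv0 (S.bc_right t ht.1)
  have hne : y ≠ S.h t := by
    rintro rfl
    have h1 := sign_mul_le_abs hσ (S.v t (S.h t))
    have h2 := hv t ht _ hy
    have h3 : 2 * M ≤ b.f (1 - τ * S.h t) := by
      refine b.large _ ?_
      rcases hτ with rfl | rfl <;> linarith [hd t ht]
    linarith
  have ht0 : 0 < t := by
    rcases ht.1.eq_or_lt with h0 | h0
    · subst h0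
      exfalso
      have hτI : τ ∈ Icc (-1 : ℝ) 1 := by rcases hτ with rfl | rfl <;> norm_num
      have hvτ : S.v 0 τ = 0 := by
        rcases hτ with rfl | rfl
        · exact S.bc_right 0 le_rfl
        · exact S.bc_left 0 le_rfl
      have h1 := hL₀ y hy τ hτI
      have h2 := b.lower _ hr.1 hr.2
      have h3 := sign_mul_le_abs hσ (S.v 0 y - S.v 0 τ)
      have h4 : |y - τ| = 1 - τ * y := by
        rcases hτ with rfl | rfl
        · rw [abs_of_nonpos (by linarith [hy.2])]; ring
        · rw [abs_of_nonneg (by linarith [hy.1])]; ring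
      rw [h4] at h1
      rw [hvτ, sub_zero] at h3
      rw [hvτ, sub_zero] at h1
      linarith
    · exact h0
  obtain ⟨hβ, hβ'⟩ := b.comp_affine (-τ) 1
  have harg : ∀ x, -τ * x + 1 = 1 - τ * x := fun x => by ring
  have hcon := S.touching (σ := σ) ht0 hyI hne (hasDerivAt_const t (0 : ℝ)) hβ (hβ' y)
    (by
      filter_upwards [eventually_left_mem ht0 ht.2] with s hsI
      have := hmax (s, y) ⟨hsI, hy⟩
      simp only at this
      linarith)
    (by
      filter_upwards [Ioo_mem_nhds hyI.1 hyI.2] with x hxI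
      have := hmax (t, x) ⟨ht, Ioo_subset_Icc_self hxI⟩
      simp only at this
      rw [harg, harg]
      linarith)
  rw [harg] at hcon
  have h1 := b.super _ hr.2
  have h2 := b.nonneg' (1 - τ * y)
  have h4 : -M ≤ -τ * S.v t y := by
    have := sign_mul_le_abs hτ (S.v t y)
    linarith [hv t ht y hy]
  have h5 : -τ * (-τ * b.f'' (1 - τ * y)) = b.f'' (1 - τ * y) := by
    rw [← mul_assoc, neg_mul_neg, hττ, one_mul]
  rw [h5] at hcon
  nlinarith [mul_le_mul_of_nonneg_right h4 h2, mul_nonneg hM h2]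

end FluidParticleSol

namespace FluidParticleSol

variable {K h₁ : ℝ} (S : FluidParticleSol K h₁)

/-- Doubling of variables: a modulus of continuity in space which is uniform in time. -/
lemma doubling {T M G d L₀ : ℝ} (hG0 : 0 ≤ G) (hM : 0 ≤ M)
    (hv : ∀ t ∈ Icc 0 T, ∀ y ∈ Icc (-1 : ℝ) 1, |S.v t y| ≤ M)
    (hG : ∀ t ∈ Icc 0 T, |deriv (deriv S.h) t| ≤ G)
    (hd : ∀ t ∈ Icc 0 T, -1 + d ≤ S.h t ∧ S.h t ≤ 1 - d)
    (hL₀ : ∀ x ∈ Icc (-1 : ℝ) 1, ∀ y ∈ Icc (-1 : ℝ) 1, |S.v 0 x - S.v 0 y| ≤ L₀ * |x - y|)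
    (b : BarrierData M G d L₀) :
    ∀ t ∈ Icc 0 T, ∀ x ∈ Icc (-1 : ℝ) 1, ∀ y ∈ Icc (-1 : ℝ) 1, y ≤ x →
      |S.v t x - S.v t y| ≤ 2 * b.f (x - y) := by
  intro t₁ ht₁ x₁ hx₁ y₁ hy₁ hyx₁
  refine abs_le_of_sign fun σ hσ => ?_
  by_contra! hcon
  have hcb := b.continuous
  let k : Set (ℝ × ℝ × ℝ) :=
    (Icc 0 T ×ˢ Icc (-1 : ℝ) 1 ×ˢ Icc (-1 : ℝ) 1) ∩ {p | p.2.2 ≤ p.2.1}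
  have hk : IsCompact k := (isCompact_Icc.prod (isCompact_Icc.prod isCompact_Icc)).inter_right
    (isClosed_le (by fun_prop) (by fun_prop))
  have hz : ContinuousOn (fun p : ℝ × ℝ × ℝ =>
      σ * (S.v p.1 p.2.1 - S.v p.1 p.2.2) - 2 * b.f (p.2.1 - p.2.2)) k := by
    refine ContinuousOn.sub (continuousOn_const.mul (ContinuousOn.sub ?_ ?_)) ?_
    · exact S.continuousOn_v_comp continuous_fst (by fun_prop)
        (fun p hp => ⟨hp.1.1.1, hp.1.2.1⟩)
    · exact S.continuousOn_v_comp continuous_fst (by fun_prop)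
        (fun p hp => ⟨hp.1.1.1, hp.1.2.2⟩)
    · exact Continuous.continuousOn (by fun_prop)
  obtain ⟨⟨t, x, y⟩, ⟨⟨ht, hx, hy⟩, hyx⟩, hpos, hmax⟩ :=
    exists_pos_max hk hz (p := (t₁, x₁, y₁)) ⟨⟨ht₁, hx₁, hy₁⟩, hyx₁⟩
      (by simp only; linarith)
  simp only [mem_ofPred_eq] at ht hx hy hyx hpos hmax
  have hlt : y < x := by
    refine lt_of_le_of_ne hyx ?_
    rintro rfl
    simp [b.zero] at hpos
  have hf0 : 0 ≤ b.f (x - y) := b.nonneg (by linarith)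
  have hr2 : x - y ≤ 2 := by linarith [hx.2, hy.1]
  have hσabs := sign_mul_le_abs hσ (S.v t x - S.v t y)
  have hnle : ¬ |S.v t x - S.v t y| ≤ 2 * b.f (x - y) := by
    intro h; linarith
  have ht0 : 0 < t := by
    rcases ht.1.eq_or_lt with h0 | h0
    · subst h0
      have h1 := hL₀ x hx y hy
      rw [abs_of_pos (sub_pos.2 hlt)] at h1
      have h2 := b.lower _ (sub_pos.2 hlt).le hr2
      exact absurd (by linarith) hnle
    · exact h0
  have hx1 : x < 1 := by
    refine lt_of_le_of_ne hx.2 ?_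
    rintro rfl
    have h1 := S.wall_barrier hG0 hM hv hd hL₀ b (Or.inl rfl) t ht y hy
    rw [S.bc_right t ht.1, zero_sub, abs_neg] at hnle
    rw [one_mul] at h1
    exact hnle (by linarith)
  have hy1 : -1 < y := by
    refine lt_of_le_of_ne hy.1 ?_
    rintro rfl
    have h1 := S.wall_barrier hG0 hM hv hd hL₀ b (Or.inr rfl) t ht x hx
    rw [S.bc_left t ht.1, sub_zero] at hnle
    rw [show 1 - -1 * x = x - -1 by ring] at h1
    exact hnle (by linarith)
  have hh : S.h t < y ∨ x < S.h t := by
    by_contra! hc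
    have h1 := S.interface_barrier hv hG hd hL₀ b t ht x hx
    have h2 := S.interface_barrier hv hG hd hL₀ b t ht y hy
    rw [abs_of_nonneg (sub_nonneg.2 hc.2)] at h1
    rw [abs_sub_comm y, abs_of_nonneg (sub_nonneg.2 hc.1)] at h2
    have h3 : b.f (x - S.h t) ≤ b.f (x - y) := b.mono (by linarith)
    have h4 : b.f (S.h t - y) ≤ b.f (x - y) := b.mono (by linarith)
    have h5 := abs_sub_le (S.v t x) (S.v t (S.h t)) (S.v t y)
    rw [abs_sub_comm (S.v t (S.h t))] at h5
    exact hnle (by linarith)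
  have hxI : x ∈ Ioo (-1 : ℝ) 1 := ⟨by linarith, hx1⟩
  have hyI : y ∈ Ioo (-1 : ℝ) 1 := ⟨hy1, by linarith⟩
  have hxne : x ≠ S.h t := by rcases hh with h | h <;> [exact (h.trans hlt).ne'; exact h.ne]
  have hyne : y ≠ S.h t := by rcases hh with h | h <;> [exact h.ne'; exact (hlt.trans h).ne]
  have htime : 0 ≤ σ * (S.vt t x - S.vt t y) := by
    refine (((S.hasDeriv_t t ht.1 x hx).sub
      (S.hasDeriv_t t ht.1 y hy)).const_mul σ).nonneg_of_le_left ?_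
    filter_upwards [eventually_left_mem ht0 ht.2] with s hs
    have := hmax (s, x, y) ⟨⟨hs, hx, hy⟩, hyx⟩
    simp only at this
    simp only [Pi.sub_apply]
    linarith
  have evx := S.eventually_hasDerivAt ht.1 hxI hxne
  have evy := S.eventually_hasDerivAt ht.1 hyI hyne
  have hfirst : σ * S.vy t x - 2 * b.f' (x - y) = 0 := by
    have hm : IsLocalMax (fun z => σ * S.v t z - 2 * b.f (z - y)) x := by
      filter_upwards [Ioo_mem_nhds hlt hx1] with z hz
      have := hmax (t, z, y) ⟨⟨ht, ⟨by linarith [hz.1], hz.2.le⟩, hy⟩, hz.1.le⟩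
      simp only at this
      linarith
    refine hm.hasDerivAt_eq_zero ((evx.self_of_nhds.const_mul σ).sub (HasDerivAt.const_mul 2 ?_))
    exact (b.deriv1 (x - y)).comp_sub_const x y
  have hfirsty : -(σ * S.vy t y) + 2 * b.f' (x - y) = 0 := by
    have hm : IsLocalMax (fun z => -(σ * S.v t z) - 2 * b.f (x - z)) y := by
      filter_upwards [Ioo_mem_nhds hy1 hlt] with z hz
      have := hmax (t, x, z) ⟨⟨ht, hx, ⟨hz.1.le, by linarith [hz.2]⟩⟩, hz.2.le⟩
      simp only at this
      linarith
    have hD := hm.hasDerivAt_eq_zero ((evy.self_of_nhds.const_mul σ).neg.sub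
      (((b.deriv1 (x - y)).comp_const_sub x y).const_mul 2))
    linarith
  have hsecond : σ * (S.vyy t x - S.vyy t y) - 8 * b.f'' (x - y) ≤ 0 := by
    have hm : IsLocalMax (fun η => σ * (S.v t (x + η) - S.v t (y - η))
        - 2 * b.f (2 * η + (x - y))) 0 := by
      have e1 : ∀ᶠ η in nhds (0 : ℝ), η < 1 - x := Iio_mem_nhds (by linarith)
      have e2 : ∀ᶠ η in nhds (0 : ℝ), η < y + 1 := Iio_mem_nhds (by linarith)
      have e3 : ∀ᶠ η in nhds (0 : ℝ), -((x - y) / 2) < η := Ioi_mem_nhds (by linarith)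
      filter_upwards [e1, e2, e3] with η h1 h2 h3
      have := hmax (t, x + η, y - η) ⟨⟨ht, ⟨by linarith, by linarith⟩,
        ⟨by linarith, by linarith⟩⟩, by simp only [mem_ofPred_eq]; linarith⟩
      simp only at this
      rw [show x + η - (y - η) = 2 * η + (x - y) by ring] at this
      simpa using this
    have cx : Tendsto (fun η : ℝ => x + η) (nhds 0) (nhds x) :=
      (by fun_prop : Continuous fun η : ℝ => x + η).tendsto' 0 x (by simp)
    have cy : Tendsto (fun η : ℝ => y - η) (nhds 0) (nhds y) :=
      (by fun_prop : Continuous fun η : ℝ => y - η).tendsto' 0 y (by simp)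
    obtain ⟨a1, a2⟩ := b.comp_affine 2 (x - y)
    have hx' := S.hasDeriv_yy t ht.1 x hxI hxne
    have hy' := S.hasDeriv_yy t ht.1 y hyI hyne
    have := (IsLocalMax.second_deriv_test
      (f' := fun η => σ * (S.vy t (x + η) - -S.vy t (y - η))
        - 2 * (2 * b.f' (2 * η + (x - y))))
      (c := σ * (S.vyy t x - - -S.vyy t y) - 2 * (2 * (2 * b.f'' (2 * 0 + (x - y))))) hm
      (by
        filter_upwards [cx.eventually evx, cy.eventually evy] with η h1 h2
        exact (((h1.comp_const_add x η).sub (h2.comp_const_sub y η)).const_mul σ).sub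
          ((a1 η).const_mul 2))
      (by
        have h1 : HasDerivAt (S.vy t) (S.vyy t x) (x + 0) := by rwa [add_zero]
        have h2 : HasDerivAt (S.vy t) (S.vyy t y) (y - 0) := by rwa [sub_zero]
        exact (((h1.comp_const_add x 0).sub (h2.comp_const_sub y 0).neg).const_mul σ).sub
          ((a2 0).const_mul 2))).2
    rw [mul_zero, zero_add, neg_neg] at this
    linarith
  have px := S.pde t ht.1 x hxI hxne
  have py := S.pde t ht.1 y hyI hyne
  have hs := b.super _ hr2
  have hq := b.nonneg' (x - y)
  have e : σ * (S.vt t x - S.vt t y) =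
      σ * (S.vyy t x - S.vyy t y) - (S.v t x - S.v t y) * (2 * b.f' (x - y)) := by
    have e1 : σ * S.vy t x = 2 * b.f' (x - y) := by linarith
    have e2 : σ * S.vy t y = 2 * b.f' (x - y) := by linarith
    have e3 : S.vt t x = S.vyy t x - S.v t x * S.vy t x := by linarith
    have e4 : S.vt t y = S.vyy t y - S.v t y * S.vy t y := by linarith
    rw [e3, e4]
    linear_combination -(S.v t x) * e1 + (S.v t y) * e2
  have hdiff : -(2 * M) ≤ S.v t x - S.v t y := by
    have h1 := abs_le.1 (hv t ht x hx)
    have h2 := abs_le.1 (hv t ht y hy)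
    linarith
  nlinarith [mul_le_mul_of_nonneg_right hdiff hq, mul_nonneg hM hq]

/-- Uniform spatial Lipschitz bound on bounded time intervals. -/
lemma exists_lipschitz {T : ℝ} (hT : 0 ≤ T) : ∃ L : ℝ, 0 ≤ L ∧ ∀ t ∈ Icc 0 T,
    ∀ x ∈ Icc (-1 : ℝ) 1, ∀ y ∈ Icc (-1 : ℝ) 1, |S.v t x - S.v t y| ≤ L * |x - y| := by
  obtain ⟨M, G, d, hM, hG0, hd0, hd1, hv, hG, hd⟩ := S.exists_bounds T hT
  obtain ⟨L₀, hL₀0, hL₀⟩ := S.slice_lipschitz le_rfl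
  obtain ⟨b⟩ := exists_barrierData hM hG0 hd0 (by linarith) hL₀0
  have key := S.doubling hG0 hM hv hG hd hL₀ b
  refine ⟨2 * b.L, by linarith [b.hL], fun t ht x hx y hy => ?_⟩
  rcases le_total y x with h | h
  · rw [abs_of_nonneg (sub_nonneg.2 h)]
    linarith [key t ht x hx y hy h, b.upper (x - y)]
  · rw [abs_sub_comm, abs_sub_comm x, abs_of_nonneg (sub_nonneg.2 h)]
    linarith [key t ht y hy x hx h, b.upper (y - x)]

lemma abs_vy_le {t L : ℝ} (ht : 0 ≤ t) (hL : 0 ≤ L)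
    (hLip : ∀ x ∈ Icc (-1 : ℝ) 1, ∀ y ∈ Icc (-1 : ℝ) 1, |S.v t x - S.v t y| ≤ L * |x - y|)
    {y : ℝ} (hy : y ∈ Ioo (-1 : ℝ) 1) (hne : y ≠ S.h t) : |S.vy t y| ≤ L := by
  refine (S.hasDeriv_y t ht y hy hne).le_of_lip' hL ?_
  filter_upwards [Ioo_mem_nhds hy.1 hy.2] with x hx
  exact hLip x (Ioo_subset_Icc_self hx) y (Ioo_subset_Icc_self hy)

end FluidParticleSol

lemma abs_add_abs_le_of_mul_nonpos {l a b : ℝ} (h : a * b ≤ 0) :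
    |b| + l * |a| ≤ |b - l * a| := by
  rcases lt_trichotomy a 0 with ha | rfl | ha
  · have hb : 0 ≤ b := by
      by_contra! h2
      exact absurd h (not_le.2 (mul_pos_of_neg_of_neg ha h2))
    rw [abs_of_neg ha, abs_of_nonneg hb]
    exact (by linarith : b + l * -a = b - l * a).le.trans (le_abs_self _)
  · simp
  · have hb : b ≤ 0 := by
      by_contra! h2
      exact absurd h (not_le.2 (mul_pos ha h2))
    rw [abs_of_pos ha, abs_of_nonpos hb]
    exact (by linarith : -b + l * a = -(b - l * a)).le.trans (neg_le_abs _)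

lemma abs_mul_sub_le_of_near {l L A M B P Q p q r r' : ℝ} (hl : l ∈ Ico (1 / 2 : ℝ) 1)
    (hL : 0 ≤ L) (hr : 0 ≤ r) (hr' : 0 ≤ r') (hA : r + l * r' ≤ A * (1 - l))
    (hP : |P - p| ≤ L * r) (hQ : |Q - q| ≤ L * r') (hp : |p| ≤ M)
    (hpq : |q - p| ≤ B * (1 - l)) :
    |l * P - Q| ≤ (3 * L * A + M + B) * (1 - l) := by
  have hl0 : 0 < l := by linarith [hl.1]
  have hl1 : 0 < 1 - l := by linarith [hl.2]
  have c1 : r ≤ A * (1 - l) := by linarith [mul_nonneg hl0.le hr']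
  have c2 : r' ≤ 2 * (A * (1 - l)) := by
    linarith [mul_le_mul_of_nonneg_right hl.1 hr']
  have c3 := mul_le_mul_of_nonneg_left c1 hL
  have c4 := mul_le_mul_of_nonneg_left c2 hL
  have f1 : |l * (P - p)| ≤ L * (A * (1 - l)) := by
    rw [abs_mul, abs_of_pos hl0]
    exact (mul_le_of_le_one_left (abs_nonneg _) hl.2.le).trans (hP.trans c3)
  have f2 : |(1 - l) * p| ≤ (1 - l) * M := by
    rw [abs_mul, abs_of_pos hl1]
    exact mul_le_mul_of_nonneg_left hp hl1.le
  have d1 := abs_le.1 f1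
  have d2 := abs_le.1 f2
  have d3 := abs_le.1 hpq
  have d4 := abs_le.1 (hQ.trans c4)
  rw [show l * P - Q = l * (P - p) - (1 - l) * p - (q - p) - (Q - q) by ring, abs_le]
  constructor <;> linarith

namespace FluidParticleSol

variable {K h₁ : ℝ} (S : FluidParticleSol K h₁)

set_option maxHeartbeats 1000000 in
/-- Comparison of `v` with its parabolic rescaling `l * v (l² t) (l y)`. -/
lemma exists_scaling_bound {T : ℝ} (hT : 0 ≤ T) : ∃ C : ℝ, 0 ≤ C ∧ ∀ l ∈ Ico (1 / 2 : ℝ) 1,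
    ∀ t ∈ Icc 0 T, ∀ y ∈ Icc (-1 : ℝ) 1,
      |l * S.v (l ^ 2 * t) (l * y) - S.v t y| ≤ C * (1 - l) := by
  obtain ⟨M, G, -, hM, hG0, -, -, hv, hG, -⟩ := S.exists_bounds T hT
  obtain ⟨L, hL0, hL⟩ := S.exists_lipschitz hT
  set C₀ : ℝ := 3 * L * (1 + 2 * M * T) + M + 2 * G * T + L + M with hC₀
  have hMT : 0 ≤ M * T := by positivity
  have hGT : 0 ≤ G * T := by positivity
  have hLMT : 0 ≤ L * (M * T) := by positivity
  have hC₀0 : 0 ≤ C₀ := by positivity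
  have hg : ∀ t ∈ Icc 0 T, |deriv S.h t| ≤ M := fun t ht => by
    rw [S.ode1 t ht.1]; exact hv t ht _ (S.h_mem ht.1)
  have hhL : ∀ s ∈ Icc 0 T, ∀ t ∈ Icc 0 T, |S.h t - S.h s| ≤ M * |t - s| := fun s hs t ht =>
    Convex.norm_image_sub_le_of_norm_hasDerivWithin_le
      (fun x _ => (S.hasDerivAt_h x).hasDerivWithinAt) hg (convex_Icc 0 T) hs ht
  have hgL : ∀ s ∈ Icc 0 T, ∀ t ∈ Icc 0 T, |deriv S.h t - deriv S.h s| ≤ G * |t - s| :=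
    fun s hs t ht => Convex.norm_image_sub_le_of_norm_hasDerivWithin_le
      (fun x _ => (S.hasDerivAt_deriv_h x).hasDerivWithinAt) hG (convex_Icc 0 T) hs ht
  refine ⟨C₀ * exp ((L + 1) * T), by positivity, fun l hl t₁ ht₁ y₁ hy₁ => ?_⟩
  have hl0 : 0 < l := by linarith [hl.1]
  have hl1 : 0 < 1 - l := by linarith [hl.2]
  have hl2 : l ^ 2 ≤ 1 := by nlinarith [hl.2]
  have hlt : ∀ t ∈ Icc 0 T, l ^ 2 * t ∈ Icc 0 T := fun t ht =>
    ⟨mul_nonneg (by positivity) ht.1, by nlinarith [ht.1, ht.2]⟩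
  have hly : ∀ y ∈ Icc (-1 : ℝ) 1, l * y ∈ Icc (-1 : ℝ) 1 := fun y hy => by
    constructor <;> nlinarith [hy.1, hy.2, hl.2]
  have htd : ∀ t ∈ Icc 0 T, |t - l ^ 2 * t| ≤ 2 * T * (1 - l) := fun t ht => by
    rw [abs_of_nonneg (by nlinarith [ht.1])]
    have e : t - l ^ 2 * t = t * (1 + l) * (1 - l) := by ring
    rw [e]
    refine mul_le_mul_of_nonneg_right ?_ hl1.le
    nlinarith [ht.1, ht.2, hl.2]
  refine abs_le_of_sign fun σ hσ => ?_
  by_contra! hcon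
  have hcz : ContinuousOn (fun p : ℝ × ℝ =>
      σ * (l * S.v (l ^ 2 * p.1) (l * p.2) - S.v p.1 p.2) * exp (-(L + 1) * p.1)
        - C₀ * (1 - l)) (Icc 0 T ×ˢ Icc (-1 : ℝ) 1) := by
    refine ContinuousOn.sub (ContinuousOn.mul (continuousOn_const.mul (ContinuousOn.sub
      (continuousOn_const.mul ?_) ?_)) (Continuous.continuousOn (by fun_prop))) continuousOn_const
    · exact S.continuousOn_v_comp (by fun_prop) (by fun_prop)
        (fun p hp => ⟨(hlt _ hp.1).1, hly _ hp.2⟩)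
    · exact S.continuousOn_v_comp continuous_fst continuous_snd (fun p hp => ⟨hp.1.1, hp.2⟩)
  have hexp : ∀ t : ℝ, exp (-(L + 1) * t) * exp ((L + 1) * t) = 1 := fun t => by
    rw [← exp_add, ← exp_zero]; congr 1; ring
  obtain ⟨⟨t, y⟩, ⟨ht, hy⟩, hpos, hmax⟩ :=
    exists_pos_max (isCompact_Icc.prod isCompact_Icc) hcz (p := (t₁, y₁)) ⟨ht₁, hy₁⟩ (by
      simp only
      have h1 : exp ((L + 1) * t₁) ≤ exp ((L + 1) * T) :=
        exp_le_exp.2 (mul_le_mul_of_nonneg_left ht₁.2 (by linarith))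
      have h2 : C₀ * (1 - l) * exp ((L + 1) * t₁) <
          σ * (l * S.v (l ^ 2 * t₁) (l * y₁) - S.v t₁ y₁) := by
        refine lt_of_le_of_lt ?_ hcon
        have := mul_le_mul_of_nonneg_left h1 (mul_nonneg hC₀0 hl1.le)
        linarith
      have h3 := mul_lt_mul_of_pos_right h2 (exp_pos (-(L + 1) * t₁))
      have h4 := hexp t₁
      have h5 : C₀ * (1 - l) * exp ((L + 1) * t₁) * exp (-(L + 1) * t₁) = C₀ * (1 - l) := by
        rw [mul_assoc, mul_comm (exp _), h4, mul_one]
      linarith)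
  simp only at ht hy hpos hmax
  set W : ℝ := l * S.v (l ^ 2 * t) (l * y) - S.v t y with hW
  have hE0 := exp_pos (-(L + 1) * t)
  have hE1 : exp (-(L + 1) * t) ≤ 1 := exp_le_one_iff.2 (by nlinarith [ht.1])
  have hσW : 0 < σ * W := by
    have : 0 < σ * W * exp (-(L + 1) * t) := by
      linarith [mul_nonneg hC₀0 hl1.le]
    exact pos_of_mul_pos_left this hE0.le
  have hnle : ¬ |W| ≤ C₀ * (1 - l) := by
    intro h
    have h1 := sign_mul_le_abs hσ W
    nlinarith
  have htl := hlt t ht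
  have hyl := hly y hy
  have hyd : ∀ y ∈ Icc (-1 : ℝ) 1, |l * y - y| ≤ 1 - l := fun y hy => by
    rw [show l * y - y = -((1 - l) * y) by ring, abs_neg, abs_mul, abs_of_pos hl1]
    have : |y| ≤ 1 := abs_le.2 hy
    nlinarith
  have hfar : 0 < (y - S.h t) * (l * y - S.h (l ^ 2 * t)) := by
    by_contra! hc
    have e1 := abs_add_abs_le_of_mul_nonpos (l := l) hc
    rw [show l * y - S.h (l ^ 2 * t) - l * (y - S.h t) =
      l * S.h t - S.h (l ^ 2 * t) by ring] at e1
    have e3 := abs_sub_le (l * S.h t) (S.h t) (S.h (l ^ 2 * t))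
    have e4 := hyd _ (S.h_mem ht.1)
    have e5 := hhL _ htl t ht
    have e6 := mul_le_mul_of_nonneg_left (htd t ht) hM
    have b1 := hL _ htl _ hyl _ (S.h_mem htl.1)
    have b2 := hL t ht y hy _ (S.h_mem ht.1)
    rw [← S.ode1 _ htl.1] at b1
    rw [← S.ode1 _ ht.1] at b2
    have b3 := hgL _ htl t ht
    have b4 := mul_le_mul_of_nonneg_left (htd t ht) hG0
    refine hnle ((abs_mul_sub_le_of_near hl hL0 (abs_nonneg _) (abs_nonneg _)
      (by linarith : _ ≤ (1 + 2 * M * T) * (1 - l)) b1 b2 (hg _ htl)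
      (by linarith : _ ≤ 2 * G * T * (1 - l))).trans ?_)
    rw [hC₀]
    have hLl : 0 ≤ L * (1 - l) := by positivity
    have hMl : 0 ≤ M * (1 - l) := by positivity
    linarith
  have hLl : 0 ≤ L * (1 - l) := by positivity
  have hrest : 0 ≤ (3 * L * (1 + 2 * M * T) + 2 * G * T + M) * (1 - l) := by positivity
  have ht0 : 0 < t := by
    rcases ht.1.eq_or_lt with h0 | h0
    · subst h0
      exfalso
      apply hnle
      have b1 := hL 0 ht _ hyl y hy
      have b2 := hv 0 ht _ hyl
      have b3 := mul_le_mul_of_nonneg_left (hyd y hy) hL0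
      have e : W = (S.v 0 (l * y) - S.v 0 y) - (1 - l) * S.v 0 (l * y) := by
        rw [hW, mul_zero]; ring
      have f2 : |(1 - l) * S.v 0 (l * y)| ≤ M * (1 - l) := by
        rw [abs_mul, abs_of_pos hl1]
        nlinarith
      rw [e]
      refine (abs_sub _ _).trans ?_
      rw [hC₀]
      linarith
    · exact h0
  have hwall : ∀ c ∈ Icc (-1 : ℝ) 1, (∀ s, 0 ≤ s → S.v s c = 0) → y ≠ c := by
    rintro c hc hvc rfl
    apply hnle
    have b1 := hL _ htl _ hyl y hy
    have b3 := mul_le_mul_of_nonneg_left (hyd y hy) hL0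
    rw [hvc _ htl.1, sub_zero] at b1
    have hMl : 0 ≤ M * (1 - l) := by positivity
    rw [hW, hvc t ht.1, sub_zero, abs_mul, abs_of_pos hl0, hC₀]
    have h0 := abs_nonneg (S.v (l ^ 2 * t) (l * y))
    nlinarith [hl.2]
  have hyI : y ∈ Ioo (-1 : ℝ) 1 :=
    ⟨lt_of_le_of_ne hy.1 (hwall (-1) (by norm_num) S.bc_left).symm,
      lt_of_le_of_ne hy.2 (hwall 1 (by norm_num) S.bc_right)⟩
  have hylI : l * y ∈ Ioo (-1 : ℝ) 1 := by
    constructor <;> nlinarith [hyI.1, hyI.2, hl.2]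
  have hne : y ≠ S.h t := by
    intro h; rw [← h, sub_self, zero_mul] at hfar; exact lt_irrefl _ hfar
  have hlne : l * y ≠ S.h (l ^ 2 * t) := by
    intro h; rw [← h, sub_self, mul_zero] at hfar; exact lt_irrefl _ hfar
  have hlinT : ∀ s, HasDerivAt (fun s : ℝ => l ^ 2 * s) (l ^ 2) s := fun s => by
    simpa using (hasDerivAt_id s).const_mul (l ^ 2)
  have hlinY : ∀ x, HasDerivAt (fun x : ℝ => l * x) l x := fun x => by
    simpa using (hasDerivAt_id x).const_mul l
  have hexpD : HasDerivAt (fun s : ℝ => exp (-(L + 1) * s))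
      (exp (-(L + 1) * t) * -(L + 1)) t := by
    have : HasDerivAt (fun s : ℝ => -(L + 1) * s) (-(L + 1)) t := by
      simpa using (hasDerivAt_id t).const_mul (-(L + 1))
    exact this.exp
  have htime := HasDerivAt.nonneg_of_le_left
    (((((((S.hasDeriv_t _ htl.1 _ hyl).comp t (hlinT t)).const_mul l).sub
      (S.hasDeriv_t t ht.1 y hy)).const_mul σ).mul hexpD)) (by
      filter_upwards [eventually_left_mem ht0 ht.2] with s hs
      have := hmax (s, y) ⟨hs, hy⟩
      simp only [Pi.mul_apply, Pi.sub_apply, Function.comp] at this ⊢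
      linarith)
  have evy := S.eventually_hasDerivAt ht.1 hyI hne
  have evl := (S.eventually_hasDerivAt htl.1 hylI hlne)
  have evl' := (hlinY y).continuousAt.tendsto.eventually evl
  obtain ⟨hfirst, hsecond⟩ := IsLocalMax.second_deriv_test
    (f := fun x => σ * (l * S.v (l ^ 2 * t) (l * x) - S.v t x))
    (f' := fun x => σ * (l * (S.vy (l ^ 2 * t) (l * x) * l) - S.vy t x))
    (c := σ * (l * (S.vyy (l ^ 2 * t) (l * y) * l * l) - S.vyy t y)) (x := y)
    (by
      filter_upwards [Ioo_mem_nhds hyI.1 hyI.2] with x hx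
      have := hmax (t, x) ⟨ht, Ioo_subset_Icc_self hx⟩
      simp only at this
      refine le_of_mul_le_mul_right ?_ hE0
      linarith)
    (by
      filter_upwards [evy, evl'] with x hx hx'
      exact (((hx'.comp x (hlinY x)).const_mul l).sub hx).const_mul σ)
    ((((((S.hasDeriv_yy _ htl.1 _ hylI hlne).comp y (hlinY y)).mul_const l).const_mul l).sub
      (S.hasDeriv_yy t ht.1 y hyI hne)).const_mul σ)
  simp only [Function.comp, Pi.sub_apply] at htime
  rw [← hW] at htime
  have px := S.pde _ htl.1 _ hylI hlne
  have py := S.pde t ht.1 y hyI hne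
  have hvy := abs_le.1 (S.abs_vy_le ht.1 hL0 (hL t ht) hyI hne)
  set E := exp (-(L + 1) * t)
  have h1 : 0 ≤ σ * (l * (S.vt (l ^ 2 * t) (l * y) * l ^ 2) - S.vt t y)
      - (L + 1) * (σ * W) := by
    refine nonneg_of_mul_nonneg_left ?_ hE0
    linarith
  have h2 : σ * (l * (S.vt (l ^ 2 * t) (l * y) * l ^ 2) - S.vt t y) =
      σ * (l * (S.vyy (l ^ 2 * t) (l * y) * l * l) - S.vyy t y) - σ * W * S.vy t y := by
    have e1 : S.vt (l ^ 2 * t) (l * y) = S.vyy (l ^ 2 * t) (l * y)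
      - S.v (l ^ 2 * t) (l * y) * S.vy (l ^ 2 * t) (l * y) := by linarith
    have e2 : S.vt t y = S.vyy t y - S.v t y * S.vy t y := by linarith
    rw [e1, e2, hW]
    linear_combination (-(l * S.v (l ^ 2 * t) (l * y))) * hfirst
  nlinarith [mul_le_mul_of_nonneg_left hvy.1 hσW.le]

/-- The time derivative is bounded by a multiple of `1 / t`, uniformly in space. -/
lemma exists_vt_bound {T : ℝ} (hT : 0 ≤ T) : ∃ C : ℝ, 0 ≤ C ∧
    ∀ t ∈ Icc 0 T, ∀ y ∈ Icc (-1 : ℝ) 1, t * |S.vt t y| ≤ C := by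
  obtain ⟨C, hC0, hC⟩ := S.exists_scaling_bound hT
  obtain ⟨M, G, -, hM, -, -, -, hv, -, -⟩ := S.exists_bounds T hT
  obtain ⟨L, hL0, hL⟩ := S.exists_lipschitz hT
  refine ⟨C + M + L, by positivity, fun t ht y hy => ?_⟩
  have hlin : HasDerivAt (fun l : ℝ => l ^ 2 * t) (2 * t) 1 := by
    simpa using (hasDerivAt_pow 2 (1 : ℝ)).mul_const t
  have hD : HasDerivAt (fun l : ℝ => S.v (l ^ 2 * t) y) (S.vt t y * (2 * t)) 1 := by
    have h1 : HasDerivAt (fun s => S.v s y) (S.vt t y) ((1 : ℝ) ^ 2 * t) := by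
      simpa using S.hasDeriv_t t ht.1 y hy
    exact h1.comp 1 hlin
  have hlim := ((hasDerivAt_iff_tendsto_slope_left_right.1 hD).1).abs
  have hle : |S.vt t y * (2 * t)| ≤ C + M + L := by
    refine le_of_tendsto hlim ?_
    filter_upwards [nhdsWithin_le_nhds (Ioi_mem_nhds (by norm_num : (1 / 2 : ℝ) < 1)),
      self_mem_nhdsWithin] with l hl hl'
    simp only [mem_Ioi] at hl
    simp only [mem_Iio] at hl'
    have hl1 : 0 < 1 - l := by linarith
    have hl2 : l ^ 2 ≤ 1 := by nlinarith
    have htl : l ^ 2 * t ∈ Icc 0 T :=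
      ⟨mul_nonneg (by positivity) ht.1, by nlinarith [ht.1, ht.2]⟩
    have hly : l * y ∈ Icc (-1 : ℝ) 1 := by constructor <;> nlinarith [hy.1, hy.2]
    rw [slope_def_field, abs_div, abs_of_neg (by linarith : l - 1 < 0),
      div_le_iff₀ (by linarith)]
    have b1 := hC l ⟨hl.le, hl'⟩ t ht y hy
    have b2 := hv _ htl _ hly
    have b3 := hL _ htl y hy _ hly
    have b4 : |y - l * y| ≤ 1 - l := by
      rw [show y - l * y = (1 - l) * y by ring, abs_mul, abs_of_pos hl1]
      have : |y| ≤ 1 := abs_le.2 hy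
      nlinarith
    have b5 := abs_le.1 (b3.trans (mul_le_mul_of_nonneg_left b4 hL0))
    have b6 : |(1 - l) * S.v (l ^ 2 * t) (l * y)| ≤ M * (1 - l) := by
      rw [abs_mul, abs_of_pos hl1]; nlinarith
    have b7 := abs_le.1 b6
    have b8 := abs_le.1 b1
    rw [one_pow, one_mul, abs_le]
    constructor <;> linarith
  rw [abs_mul, abs_of_nonneg (by linarith [ht.1] : 0 ≤ 2 * t)] at hle
  nlinarith [mul_nonneg ht.1 (abs_nonneg (S.vt t y))]

end FluidParticleSol

lemma integral_mul_eq_boundary_sub_dissipation {a b C : ℝ} {u w q : ℝ → ℝ} (hab : a < b)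
    (hu : ContinuousOn u (Icc a b)) (hw : ContinuousOn w (Icc a b))
    (hu' : ∀ y ∈ Ioo a b, HasDerivAt u (w y) y)
    (hw' : ∀ y ∈ Ioo a b, HasDerivAt w (q y + u y * w y) y) (hq : ∀ y ∈ Ioo a b, |q y| ≤ C) :
    IntervalIntegrable (fun y => u y * q y) volume a b ∧
      ∫ y in a..b, u y * q y =
        u b * w b - u a * w a - (u b ^ 3 - u a ^ 3) / 3 - ∫ y in a..b, w y ^ 2 := by
  have hu2 : ContinuousOn u (uIcc a b) := by rwa [uIcc_of_le hab.le]
  have hw2 : ContinuousOn w (uIcc a b) := by rwa [uIcc_of_le hab.le]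
  have hqi : IntervalIntegrable q volume a b := by
    rw [intervalIntegrable_iff_integrableOn_Ioo_of_le hab.le]
    refine Integrable.mono' (g := fun _ => C) (integrable_const C) ?_
      (ae_restrict_of_forall_mem measurableSet_Ioo hq)
    refine ((measurable_deriv w).aestronglyMeasurable.sub
      (((hu.mul hw).mono Ioo_subset_Icc_self).aestronglyMeasurable measurableSet_Ioo)).congr
      (ae_restrict_of_forall_mem measurableSet_Ioo fun y hy => ?_)
    simp [(hw' y hy).deriv]
  have hi : IntervalIntegrable (fun y => u y * q y) volume a b := hqi.continuousOn_mul hu2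
  have hwi : IntervalIntegrable (fun y => w y ^ 2) volume a b :=
    (hw2.pow 2).intervalIntegrable
  refine ⟨hi, ?_⟩
  have h := intervalIntegral.integral_eq_sub_of_hasDerivAt_of_le
    (f := fun y => u y * w y - u y ^ 3 / 3) (f' := fun y => w y ^ 2 + u y * q y) hab.le
    ((hu.mul hw).sub ((hu.pow 3).div_const 3)) (fun y hy => by
      refine (((hu' y hy).mul (hw' y hy)).sub (((hu' y hy).pow 3).div_const 3)).congr_deriv ?_
      simp only [Nat.add_one_sub_one, Nat.cast_ofNat]
      ring) (hwi.add hi)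
  rw [intervalIntegral.integral_add hwi hi] at h
  linarith

lemma sq_le_two_mul_integral_sq {a b : ℝ} {u w : ℝ → ℝ} (hab : a ≤ b) (hab2 : b - a ≤ 2)
    (hu : ContinuousOn u (Icc a b)) (hw : ContinuousOn w (Icc a b))
    (hu' : ∀ y ∈ Ioo a b, HasDerivAt u (w y) y) :
    (u b - u a) ^ 2 ≤ 2 * ∫ y in a..b, w y ^ 2 := by
  have hw2 : ContinuousOn w (uIcc a b) := by rwa [uIcc_of_le hab]
  have hwi : IntervalIntegrable w volume a b := hw2.intervalIntegrable
  have hwi2 : IntervalIntegrable (fun y => w y ^ 2) volume a b := (hw2.pow 2).intervalIntegrable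
  have h1 := intervalIntegral.integral_eq_sub_of_hasDerivAt_of_le hab hu hu' hwi
  set c := (u b - u a) / 2 with hc
  have h2 : 0 ≤ ∫ y in a..b, (w y - c) ^ 2 :=
    intervalIntegral.integral_nonneg hab fun y _ => sq_nonneg _
  have h3 : ∫ y in a..b, (w y - c) ^ 2 =
      (∫ y in a..b, w y ^ 2) - 2 * c * (u b - u a) + c ^ 2 * (b - a) := by
    rw [← h1, ← intervalIntegral.integral_const_mul]
    rw [show c ^ 2 * (b - a) = ∫ _ in a..b, c ^ 2 by simp [mul_comm],
      ← intervalIntegral.integral_sub hwi2 (hwi.const_mul _),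
      ← intervalIntegral.integral_add (hwi2.sub (hwi.const_mul _)) (by simp)]
    congr 1
    ext y
    ring
  have h4 : c ^ 2 * (b - a) ≤ c ^ 2 * 2 := mul_le_mul_of_nonneg_left hab2 (sq_nonneg c)
  rw [hc] at h2 h3 h4
  nlinarith

lemma sq_le_of_subinterval {a b x y : ℝ} {u w : ℝ → ℝ} (hab2 : b - a ≤ 2)
    (hu : ContinuousOn u (Icc a b)) (hw : ContinuousOn w (Icc a b))
    (hu' : ∀ y ∈ Ioo a b, HasDerivAt u (w y) y) (hax : a ≤ x) (hxy : x ≤ y) (hyb : y ≤ b) :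
    (u y - u x) ^ 2 ≤ 2 * ∫ y in a..b, w y ^ 2 := by
  refine (sq_le_two_mul_integral_sq hxy (by linarith) (hu.mono (Icc_subset_Icc hax hyb))
    (hw.mono (Icc_subset_Icc hax hyb)) fun z hz => hu' z (Ioo_subset_Ioo hax hyb hz)).trans ?_
  refine mul_le_mul_of_nonneg_left ?_ (by norm_num)
  refine intervalIntegral.integral_mono_interval hax hxy hyb
    (Eventually.of_forall fun y => sq_nonneg _) ?_
  refine (ContinuousOn.pow ?_ 2).intervalIntegrable
  rwa [uIcc_of_le (by linarith)]

namespace FluidParticleSol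

variable {K h₁ : ℝ} (S : FluidParticleSol K h₁)

lemma integral_v_mul_vt {t C : ℝ} (ht : 0 ≤ t) (hC : ∀ y ∈ Icc (-1 : ℝ) 1, |S.vt t y| ≤ C) :
    ∃ D : ℝ, (∀ y ∈ Icc (-1 : ℝ) 1, S.v t y ^ 2 ≤ 2 * D) ∧
      IntervalIntegrable (fun y => S.v t y * S.vt t y) volume (-1) 1 ∧
      ∫ y in (-1 : ℝ)..1, S.v t y * S.vt t y =
        -(deriv S.h t * (S.vyR t - S.vyL t)) - D := by
  obtain ⟨h1, h2⟩ := S.h_in t ht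
  set wL := Function.update (S.vy t) (S.h t) (S.vyL t) with hwL
  set wR := Function.update (S.vy t) (S.h t) (S.vyR t) with hwR
  have hvL : ContinuousOn (S.v t) (Icc (-1) (S.h t)) :=
    (S.continuousOn_v_slice ht).mono (Icc_subset_Icc le_rfl h2.le)
  have hvR : ContinuousOn (S.v t) (Icc (S.h t) 1) :=
    (S.continuousOn_v_slice ht).mono (Icc_subset_Icc h1.le le_rfl)
  have hcL : ContinuousOn wL (Icc (-1) (S.h t)) := S.continuousOn_update_vyL ht
  have hcR : ContinuousOn wR (Icc (S.h t) 1) := S.continuousOn_update_vyR ht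
  have hd : ∀ c : ℝ, ∀ y ∈ Ioo (-1 : ℝ) 1, y ≠ S.h t →
      HasDerivAt (S.v t) (Function.update (S.vy t) (S.h t) c y) y ∧
      HasDerivAt (Function.update (S.vy t) (S.h t) c)
        (S.vt t y + S.v t y * Function.update (S.vy t) (S.h t) c y) y := fun c y hy hne => by
    rw [Function.update_of_ne hne, S.pde t ht y hy hne]
    refine ⟨S.hasDeriv_y t ht y hy hne, (S.hasDeriv_yy t ht y hy hne).congr_of_eventuallyEq ?_⟩
    filter_upwards [isOpen_ne.mem_nhds hne] with x hx
    exact Function.update_of_ne hx _ _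
  have hdL : ∀ y ∈ Ioo (-1) (S.h t), y ∈ Ioo (-1 : ℝ) 1 ∧ y ≠ S.h t :=
    fun y hy => ⟨⟨hy.1, hy.2.trans h2⟩, hy.2.ne⟩
  have hdR : ∀ y ∈ Ioo (S.h t) 1, y ∈ Ioo (-1 : ℝ) 1 ∧ y ≠ S.h t :=
    fun y hy => ⟨⟨h1.trans hy.1, hy.2⟩, hy.1.ne'⟩
  have hvL' : ∀ y ∈ Ioo (-1) (S.h t), HasDerivAt (S.v t) (wL y) y :=
    fun y hy => (hd _ y (hdL y hy).1 (hdL y hy).2).1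
  have hvR' : ∀ y ∈ Ioo (S.h t) 1, HasDerivAt (S.v t) (wR y) y :=
    fun y hy => (hd _ y (hdR y hy).1 (hdR y hy).2).1
  obtain ⟨iL, eL⟩ := integral_mul_eq_boundary_sub_dissipation h1 hvL hcL hvL'
    (fun y hy => (hd _ y (hdL y hy).1 (hdL y hy).2).2)
    (fun y hy => hC y (Ioo_subset_Icc_self (hdL y hy).1))
  obtain ⟨iR, eR⟩ := integral_mul_eq_boundary_sub_dissipation h2 hvR hcR hvR'
    (fun y hy => (hd _ y (hdR y hy).1 (hdR y hy).2).2)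
    (fun y hy => hC y (Ioo_subset_Icc_self (hdR y hy).1))
  have nL : 0 ≤ ∫ y in (-1)..S.h t, wL y ^ 2 :=
    intervalIntegral.integral_nonneg h1.le fun y _ => sq_nonneg _
  have nR : 0 ≤ ∫ y in S.h t..1, wR y ^ 2 :=
    intervalIntegral.integral_nonneg h2.le fun y _ => sq_nonneg _
  refine ⟨(∫ y in (-1)..S.h t, wL y ^ 2) + ∫ y in S.h t..1, wR y ^ 2, fun y hy => ?_,
    iL.trans iR, ?_⟩
  · rcases le_total y (S.h t) with h | h
    · have := sq_le_of_subinterval (by linarith) hvL hcL hvL' le_rfl hy.1 h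
      rw [S.bc_left t ht, sub_zero] at this
      linarith
    · have := sq_le_of_subinterval (by linarith) hvR hcR hvR' h hy.2 le_rfl
      rw [S.bc_right t ht, zero_sub, neg_sq] at this
      linarith
  · rw [← intervalIntegral.integral_add_adjacent_intervals iL iR, eL, eR, S.bc_left t ht,
      S.bc_right t ht, hwL, hwR, Function.update_self, Function.update_self, S.ode1 t ht]
    ring

lemma intervalIntegrable_v_sq {t : ℝ} (ht : 0 ≤ t) :
    IntervalIntegrable (fun y => S.v t y ^ 2) volume (-1) 1 := by
  refine (ContinuousOn.pow ?_ 2).intervalIntegrable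
  rw [uIcc_of_le (by norm_num)]
  exact S.continuousOn_v_slice ht

lemma hasDerivAt_integral_v_sq {t : ℝ} (ht : 0 < t) :
    HasDerivAt (fun s => ∫ y in (-1 : ℝ)..1, S.v s y ^ 2)
      (2 * ∫ y in (-1 : ℝ)..1, S.v t y * S.vt t y) t ∧
    ∃ C : ℝ, ∀ y ∈ Icc (-1 : ℝ) 1, |S.vt t y| ≤ C := by
  have hT : (0 : ℝ) ≤ 2 * t := by linarith
  obtain ⟨C, hC0, hC⟩ := S.exists_vt_bound hT
  obtain ⟨M, -, -, hM, -, -, -, hv, -, -⟩ := S.exists_bounds (2 * t) hT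
  have hs : Ioo (t / 2) (2 * t) ∈ nhds t := Ioo_mem_nhds (by linarith) (by linarith)
  have hvt : ∀ s ∈ Ioo (t / 2) (2 * t), ∀ y ∈ Icc (-1 : ℝ) 1, |S.vt s y| ≤ C / (t / 2) :=
    fun s hs y hy => by
      rw [le_div_iff₀ (by linarith), mul_comm]
      exact (mul_le_mul_of_nonneg_right hs.1.le (abs_nonneg _)).trans
        (hC s ⟨by linarith [hs.1], hs.2.le⟩ y hy)
  have hvt0 := hvt t ⟨by linarith, by linarith⟩
  refine ⟨?_, _, hvt0⟩
  obtain ⟨-, -, hi, -⟩ := S.integral_v_mul_vt ht.le hvt0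
  have hI : ∀ {y : ℝ}, y ∈ uIoc (-1 : ℝ) 1 → y ∈ Icc (-1 : ℝ) 1 := fun {y} hy => by
    rw [uIoc_of_le (by norm_num)] at hy; exact Ioc_subset_Icc_self hy
  have key := intervalIntegral.hasDerivAt_integral_of_dominated_loc_of_deriv_le
    (μ := volume) (a := -1) (b := 1) (x₀ := t) (F := fun s y => S.v s y ^ 2)
    (F' := fun s y => 2 * (S.v s y * S.vt s y)) (bound := fun _ => 2 * (M * (C / (t / 2)))) hs
    (by
      filter_upwards [Ioi_mem_nhds ht] with s hs
      exact (intervalIntegrable_iff.1 (S.intervalIntegrable_v_sq (le_of_lt hs))).1)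
    (S.intervalIntegrable_v_sq ht.le) (intervalIntegrable_iff.1 (hi.const_mul 2)).1
    (Eventually.of_forall fun y hy s hs => by
      rw [Real.norm_eq_abs, abs_mul, abs_mul, abs_two]
      refine mul_le_mul_of_nonneg_left (mul_le_mul
        (hv s ⟨by linarith [hs.1], hs.2.le⟩ y (hI hy)) (hvt s hs y (hI hy)) (abs_nonneg _) hM)
        (by norm_num))
    (by simp)
    (Eventually.of_forall fun y hy s hs => by
      refine ((S.hasDeriv_t s (by linarith [hs.1]) y (hI hy)).pow 2).congr_deriv ?_
      simp only [Nat.add_one_sub_one, Nat.cast_ofNat]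
      ring)
  rw [← intervalIntegral.integral_const_mul]
  exact key.2

/-- The kinetic energy of the fluid and the particle. -/
noncomputable def kineticEnergy (t : ℝ) : ℝ :=
  (∫ y in (-1 : ℝ)..1, S.v t y ^ 2) + deriv S.h t ^ 2

lemma kineticEnergy_nonneg (t : ℝ) : 0 ≤ S.kineticEnergy t :=
  add_nonneg (intervalIntegral.integral_nonneg (by norm_num) fun y _ => sq_nonneg _) (sq_nonneg _)

/-- The total energy decays at a rate controlling the kinetic energy. -/
lemma exists_energy_deriv {t : ℝ} (ht : 0 < t) : ∃ E : ℝ, S.kineticEnergy t ≤ -(3 * E) ∧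
    HasDerivAt (fun s => S.kineticEnergy s + K * (S.h s - h₁) ^ 2) E t := by
  obtain ⟨hder, C, hC⟩ := S.hasDerivAt_integral_v_sq ht
  obtain ⟨D, hD, -, he⟩ := S.integral_v_mul_vt ht.le hC
  refine ⟨-(2 * D), ?_, ?_⟩
  · have h1 : ∫ y in (-1 : ℝ)..1, S.v t y ^ 2 ≤ ∫ _ in (-1 : ℝ)..1, 2 * D :=
      intervalIntegral.integral_mono_on (by norm_num) (S.intervalIntegrable_v_sq ht.le)
        (by simp) hD
    have h2 := hD _ (S.h_mem ht.le)
    rw [← S.ode1 t ht.le] at h2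
    rw [intervalIntegral.integral_const, smul_eq_mul] at h1
    rw [kineticEnergy]
    linarith
  · refine ((hder.add ((S.hasDerivAt_deriv_h t).pow 2)).add
      ((((S.hasDerivAt_h t).sub_const h₁).pow 2).const_mul K)).congr_deriv ?_
    rw [he, S.ode2 t ht.le]
    simp only [Nat.add_one_sub_one, Nat.cast_ofNat, pow_one]
    ring

lemma continuousOn_kineticEnergy : ContinuousOn S.kineticEnergy (Ici 0) := by
  refine ContinuousOn.add ?_ (S.continuous_deriv_h.pow 2).continuousOn
  intro t ht
  obtain ⟨M, -, -, hM, -, -, -, hv, -, -⟩ := S.exists_bounds (t + 1) (by linarith [mem_Ici.1 ht])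
  refine intervalIntegral.continuousWithinAt_of_dominated_interval (bound := fun _ => M ^ 2)
    ?_ ?_ (by simp) ?_
  · filter_upwards [self_mem_nhdsWithin] with s hs
    exact (intervalIntegrable_iff.1 (S.intervalIntegrable_v_sq hs)).1
  · filter_upwards [self_mem_nhdsWithin,
      nhdsWithin_le_nhds (Iio_mem_nhds (lt_add_one t))] with s hs hs'
    refine Eventually.of_forall fun y hy => ?_
    rw [uIoc_of_le (by norm_num)] at hy
    rw [Real.norm_eq_abs, abs_pow]
    exact pow_le_pow_left₀ (abs_nonneg _)
      (hv s ⟨hs, le_of_lt hs'⟩ y (Ioc_subset_Icc_self hy)) 2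
  · refine Eventually.of_forall fun y hy => ?_
    rw [uIoc_of_le (by norm_num)] at hy
    exact ((S.hasDeriv_t t ht y (Ioc_subset_Icc_self hy)).continuousAt.pow 2).continuousWithinAt

lemma integral_kineticEnergy_le {T : ℝ} (hT : 0 ≤ T) :
    ∫ t in (0 : ℝ)..T, S.kineticEnergy t ≤
      3 * (S.kineticEnergy 0 + K * (S.h 0 - h₁) ^ 2) := by
  have hN : ContinuousOn S.kineticEnergy (Icc 0 T) :=
    S.continuousOn_kineticEnergy.mono Icc_subset_Ici_self
  have hF : ContinuousOn (fun s => S.kineticEnergy s + K * (S.h s - h₁) ^ 2) (Icc 0 T) :=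
    hN.add (by have := S.continuous_h; fun_prop)
  have hd : ∀ t ∈ Ioo 0 T, HasDerivAt (fun t => ∫ s in (0 : ℝ)..t, S.kineticEnergy s)
      (S.kineticEnergy t) t := fun t ht =>
    intervalIntegral.integral_hasDerivAt_right
      ((hN.mono (by rw [uIcc_of_le ht.1.le]; exact Icc_subset_Icc le_rfl ht.2.le)
        ).intervalIntegrable)
      (ContinuousOn.stronglyMeasurableAtFilter isOpen_Ioo
        (hN.mono Ioo_subset_Icc_self) t ht)
      (hN.continuousAt (Icc_mem_nhds ht.1 ht.2))
  have hc : ContinuousOn (fun t => ∫ s in (0 : ℝ)..t, S.kineticEnergy s) (Icc 0 T) := by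
    have := intervalIntegral.continuousOn_primitive_interval (μ := volume) (a := 0) (b := T)
      (f := S.kineticEnergy) (by rw [uIcc_of_le hT]; exact hN.integrableOn_Icc)
    rwa [uIcc_of_le hT] at this
  have hanti : AntitoneOn (fun t => 3 * (S.kineticEnergy t + K * (S.h t - h₁) ^ 2) +
      ∫ s in (0 : ℝ)..t, S.kineticEnergy s) (Icc 0 T) := by
    have hex : ∀ t ∈ Ioo 0 T, ∃ E ≤ 0, HasDerivAt
        (fun t => 3 * (S.kineticEnergy t + K * (S.h t - h₁) ^ 2) +
          ∫ s in (0 : ℝ)..t, S.kineticEnergy s) E t := fun t ht => by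
      obtain ⟨E, hE, hE'⟩ := S.exists_energy_deriv ht.1
      exact ⟨_, by linarith, (hE'.const_mul 3).add (hd t ht)⟩
    refine antitoneOn_of_deriv_nonpos (convex_Icc 0 T) ((hF.const_mul 3).add hc) ?_ ?_ <;>
      rw [interior_Icc]
    · intro t ht
      obtain ⟨E, -, hE⟩ := hex t ht
      exact hE.differentiableAt.differentiableWithinAt
    · intro t ht
      obtain ⟨E, hE0, hE⟩ := hex t ht
      rw [hE.deriv]; exact hE0
  have h := hanti (left_mem_Icc.2 hT) (right_mem_Icc.2 hT) hT
  simp only [intervalIntegral.integral_same, add_zero] at h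
  have h0 := S.kineticEnergy_nonneg T
  have h1 := mul_nonneg S.hK (sq_nonneg (S.h T - h₁))
  linarith

end FluidParticleSol

/-- The kinetic energy is integrable on `(0,∞)`, with explicit bound `3·E₀`. -/
theorem kinetic_energy_integrable {K h₁ : ℝ} (S : FluidParticleSol K h₁) :
    MeasureTheory.IntegrableOn
        (fun t => (∫ y in (-1 : ℝ)..1, (S.v t y) ^ 2) + (deriv S.h t) ^ 2) (Set.Ioi 0) ∧
    (∫ t in Set.Ioi (0 : ℝ), ((∫ y in (-1 : ℝ)..1, (S.v t y) ^ 2) + (deriv S.h t) ^ 2))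
      ≤ 3 * ((∫ y in (-1 : ℝ)..1, (S.v 0 y) ^ 2) + (deriv S.h 0) ^ 2
          + K * (S.h 0 - h₁) ^ 2) := by
  have hle := fun T (hT : 0 ≤ T) => S.integral_kineticEnergy_le hT
  have hint : IntegrableOn S.kineticEnergy (Ioi 0) := by
    refine integrableOn_Ioi_of_intervalIntegral_norm_bounded
      (3 * (S.kineticEnergy 0 + K * (S.h 0 - h₁) ^ 2)) 0 (b := id) (l := atTop) (fun T => ?_)
      tendsto_id ?_
    · exact ((S.continuousOn_kineticEnergy.mono Icc_subset_Ici_self).integrableOn_Icc).mono_set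
        Ioc_subset_Icc_self
    · filter_upwards [eventually_ge_atTop 0] with T hT
      simpa only [id, Real.norm_of_nonneg (S.kineticEnergy_nonneg _)] using hle T hT
  refine ⟨hint, ?_⟩
  refine le_of_tendsto (intervalIntegral_tendsto_integral_Ioi 0 hint tendsto_id) ?_
  filter_upwards [eventually_ge_atTop 0] with T hT
  exact hle T hT
end

section
/- Let h ∈ (−1,1] and let w : [−1,h] → ℝ be continuously differentiable with w(−1) = 0. Then | (w(h)/(1+h)²) · ∫_{−1}^{h} w(y)(1+y) dy | ≤ 6 ∫_{−1}^{h} w'(y)² dy. -/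
open Real Set MeasureTheory

/-- Cauchy–Schwarz bound for the increment of a `C¹` function on a compact interval. -/
theorem sq_sub_le_mul_integral_deriv_sq {a b : ℝ} (hab : a < b) {w w' : ℝ → ℝ}
    (hw : ∀ y ∈ Set.Icc a b, HasDerivWithinAt w (w' y) (Set.Icc a b) y)
    (hw' : ContinuousOn w' (Set.Icc a b)) :
    (w b - w a) ^ 2 ≤ (b - a) * ∫ y in a..b, (w' y) ^ 2 := by
  have hi : IntervalIntegrable w' volume a b :=
    hw'.intervalIntegrable_of_Icc hab.le
  have hi2 : IntervalIntegrable (fun y => (w' y) ^ 2) volume a b :=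
    (hw'.pow 2).intervalIntegrable_of_Icc hab.le
  have hftc : ∫ y in a..b, w' y = w b - w a := by
    refine intervalIntegral.integral_eq_sub_of_hasDerivAt_of_le hab.le
      (fun y hy => (hw y hy).continuousWithinAt) (fun y hy => ?_) hi
    exact (hw y (Ioo_subset_Icc_self hy)).hasDerivAt (Icc_mem_nhds hy.1 hy.2)
  set c := (w b - w a) / (b - a) with hc
  have hpos : 0 < b - a := sub_pos.2 hab
  have hcb : c * (b - a) = w b - w a := div_mul_cancel₀ _ hpos.ne'
  have h0 : 0 ≤ ∫ y in a..b, (w' y - c) ^ 2 :=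
    intervalIntegral.integral_nonneg hab.le fun y _ => sq_nonneg _
  have h1 : ∫ y in a..b, (w' y - c) ^ 2
      = (∫ y in a..b, (w' y) ^ 2) - 2 * c * (w b - w a) + (b - a) * c ^ 2 := by
    have he : (fun y => (w' y - c) ^ 2) = fun y => (w' y) ^ 2 - 2 * c * w' y + c ^ 2 := by
      funext y; ring
    rw [he, intervalIntegral.integral_add (hi2.sub (hi.const_mul _)) intervalIntegrable_const,
      intervalIntegral.integral_sub hi2 (hi.const_mul _),
      intervalIntegral.integral_const_mul, hftc, intervalIntegral.integral_const, smul_eq_mul]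
  rw [h1, ← hcb] at h0
  rw [← hcb]
  nlinarith [mul_nonneg hpos.le h0]

/-- Key estimate for the term `A₁` on the left piece `[-1,h]`. -/
theorem A1_estimate_left (h : ℝ) (hh : h ∈ Set.Ioc (-1 : ℝ) 1) (w w' : ℝ → ℝ)
    (hw : ∀ y ∈ Set.Icc (-1 : ℝ) h, HasDerivWithinAt w (w' y) (Set.Icc (-1 : ℝ) h) y)
    (hw' : ContinuousOn w' (Set.Icc (-1 : ℝ) h))
    (hw0 : w (-1) = 0) :
    |(w h / (1 + h) ^ 2) * ∫ y in (-1 : ℝ)..h, w y * (1 + y)|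
      ≤ 6 * ∫ y in (-1 : ℝ)..h, (w' y) ^ 2 := by
  obtain ⟨h1, h2⟩ := hh
  have hL : 0 < 1 + h := by linarith
  set E := ∫ y in (-1 : ℝ)..h, (w' y) ^ 2 with hE
  have hE0 : 0 ≤ E := intervalIntegral.integral_nonneg h1.le fun y _ => sq_nonneg _
  have hLE : 0 ≤ (1 + h) * E := mul_nonneg hL.le hE0
  have hbound : ∀ y ∈ Set.Ioc (-1 : ℝ) h, |w y| ≤ √((1 + h) * E) := by
    intro y hy
    have hsub : Set.Icc (-1 : ℝ) y ⊆ Set.Icc (-1 : ℝ) h := Icc_subset_Icc_right hy.2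
    have hcs := sq_sub_le_mul_integral_deriv_sq hy.1
      (fun z hz => (hw z (hsub hz)).mono hsub) (hw'.mono hsub)
    have hmono : ∫ z in (-1 : ℝ)..y, (w' z) ^ 2 ≤ E :=
      intervalIntegral.integral_mono_interval le_rfl hy.1.le hy.2
        (Filter.Eventually.of_forall fun z => sq_nonneg _)
        ((hw'.pow 2).intervalIntegrable_of_Icc h1.le)
    rw [hw0, sub_zero] at hcs
    refine Real.abs_le_sqrt (hcs.trans ?_)
    have hy1 : 0 ≤ y - -1 := by linarith [hy.1]
    exact (mul_le_mul_of_nonneg_left hmono hy1).trans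
      (mul_le_mul_of_nonneg_right (by linarith [hy.2]) hE0)
  set M := √((1 + h) * E) with hM
  have hM0 : 0 ≤ M := Real.sqrt_nonneg _
  have hint : |∫ y in (-1 : ℝ)..h, w y * (1 + y)| ≤ M * (1 + h) * (1 + h) := by
    have := intervalIntegral.norm_integral_le_of_norm_le_const (a := -1) (b := h)
      (f := fun y => w y * (1 + y)) (C := M * (1 + h)) (fun y hy => by
        rw [uIoc_of_le h1.le] at hy
        rw [Real.norm_eq_abs, abs_mul, abs_of_nonneg (by linarith [hy.1] : 0 ≤ 1 + y)]
        exact mul_le_mul (hbound y hy) (by linarith [hy.2]) (by linarith [hy.1]) hM0)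
    rwa [Real.norm_eq_abs, sub_neg_eq_add, add_comm h 1, abs_of_pos hL] at this
  calc |(w h / (1 + h) ^ 2) * ∫ y in (-1 : ℝ)..h, w y * (1 + y)|
      = |w h| / (1 + h) ^ 2 * |∫ y in (-1 : ℝ)..h, w y * (1 + y)| := by
        rw [abs_mul, abs_div, abs_of_pos (pow_pos hL 2)]
    _ ≤ M / (1 + h) ^ 2 * (M * (1 + h) * (1 + h)) := by
        gcongr
        exact hbound h ⟨h1, le_rfl⟩
    _ = M ^ 2 := by field_simp
    _ = (1 + h) * E := Real.sq_sqrt hLE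
    _ ≤ 6 * E := mul_le_mul_of_nonneg_right (by linarith) hE0
end

section
/- Let h ∈ [−1,1) and let w : [h,1] → ℝ be continuously differentiable with w(1) = 0. Then | (w(h)/(1−h)²) · ∫_{h}^{1} w(y)(1−y) dy | ≤ 6 ∫_{h}^{1} w'(y)² dy. -/
open Real Set MeasureTheory

/-- Key estimate for the term `A₁` on the right piece `[h,1]`. -/
theorem A1_estimate_right (h : ℝ) (hh : h ∈ Set.Ico (-1 : ℝ) 1) (w w' : ℝ → ℝ)
    (hw : ∀ y ∈ Set.Icc h (1 : ℝ), HasDerivWithinAt w (w' y) (Set.Icc h (1 : ℝ)) y)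
    (hw' : ContinuousOn w' (Set.Icc h (1 : ℝ)))
    (hw1 : w 1 = 0) :
    |(w h / (1 - h) ^ 2) * ∫ y in h..(1 : ℝ), w y * (1 - y)|
      ≤ 6 * ∫ y in h..(1 : ℝ), (w' y) ^ 2 := by
  obtain ⟨hh1, hh2⟩ := hh
  have hL : 0 < 1 - h := sub_pos.2 hh2
  set E := ∫ y in h..(1 : ℝ), (w' y) ^ 2 with hE
  have hE0 : 0 ≤ E := intervalIntegral.integral_nonneg hh2.le fun y _ => sq_nonneg _
  have hbound : ∀ y ∈ Set.Icc h (1 : ℝ), (w y) ^ 2 ≤ 2 * E := by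
    intro y hy
    rcases hy.2.eq_or_lt with rfl | hy1
    · rw [hw1]; nlinarith
    have hsub : Set.Icc y 1 ⊆ Set.Icc h (1 : ℝ) := Icc_subset_Icc_left hy.1
    have hcs := sq_sub_le_mul_integral_deriv_sq hy1
      (fun z hz => (hw z (hsub hz)).mono hsub) (hw'.mono hsub)
    have hmono : ∫ z in y..(1 : ℝ), (w' z) ^ 2 ≤ E :=
      intervalIntegral.integral_mono_interval hy.1 hy.2 le_rfl
        (Filter.Eventually.of_forall fun z => sq_nonneg _)
        ((hw'.pow 2).intervalIntegrable_of_Icc hh2.le)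
    rw [hw1, zero_sub, neg_sq] at hcs
    calc (w y) ^ 2 ≤ (1 - y) * ∫ z in y..(1 : ℝ), (w' z) ^ 2 := hcs
      _ ≤ (1 - y) * E := mul_le_mul_of_nonneg_left hmono (by linarith)
      _ ≤ 2 * E := mul_le_mul_of_nonneg_right (by linarith [hy.1]) hE0
  have hint : |∫ y in h..(1 : ℝ), w h * (w y * (1 - y))| ≤ 2 * E * (1 - h) * |1 - h| := by
    rw [← Real.norm_eq_abs]
    refine intervalIntegral.norm_integral_le_of_norm_le_const fun y hy => ?_
    rw [uIoc_of_le hh2.le] at hy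
    have hprod : |w h * w y| ≤ 2 * E := by
      have h1 := hbound h ⟨le_rfl, hh2.le⟩
      have h2 := hbound y ⟨hy.1.le, hy.2⟩
      rw [abs_le]
      constructor <;> nlinarith [sq_nonneg (w h + w y), sq_nonneg (w h - w y)]
    rw [← mul_assoc, Real.norm_eq_abs, abs_mul, abs_of_nonneg (sub_nonneg.2 hy.2)]
    exact mul_le_mul hprod (by linarith [hy.1]) (sub_nonneg.2 hy.2) (by linarith)
  rw [intervalIntegral.integral_const_mul, abs_of_pos hL] at hint
  rw [div_mul_eq_mul_div, abs_div, abs_of_pos (pow_pos hL 2), div_le_iff₀ (pow_pos hL 2)]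
  nlinarith [mul_nonneg hE0 (sq_nonneg (1 - h))]
end

section
/- Let h ∈ (−1,1) and let w : [−1,1] → ℝ be continuously differentiable with w(−1) = w(1) = 0. Then | −(w(h)/(1+h)²) ∫_{−1}^{h} w(y)(1+y) dy + (w(h)/(1−h)²) ∫_{h}^{1} w(y)(1−y) dy | ≤ 6 ∫_{−1}^{1} w'(y)² dy. -/
open Real Set MeasureTheory

/-- Cauchy–Schwarz bound for increments of a `C¹` function on `[p, q]`. -/
theorem sq_sub_le_mul_integral_sq_deriv {p q z x : ℝ} {w w' : ℝ → ℝ}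
    (hw : ∀ y ∈ Icc p q, HasDerivWithinAt w (w' y) (Icc p q) y)
    (hw' : ContinuousOn w' (Icc p q)) (hpz : p ≤ z) (hzx : z ≤ x) (hxq : x ≤ q) (hpq : p < q) :
    (w x - w z) ^ 2 ≤ (q - p) * ∫ y in p..q, (w' y) ^ 2 := by
  have hsub : Icc z x ⊆ Icc p q := Icc_subset_Icc hpz hxq
  have hint : IntervalIntegrable w' volume z x :=
    (hw'.mono hsub).intervalIntegrable_of_Icc hzx
  have hint2 : IntervalIntegrable (fun y => (w' y) ^ 2) volume z x :=
    ((hw'.mono hsub).pow 2).intervalIntegrable_of_Icc hzx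
  have hint2' : IntervalIntegrable (fun y => (w' y) ^ 2) volume p q :=
    (hw'.pow 2).intervalIntegrable_of_Icc hpq.le
  have hftc : ∫ y in z..x, w' y = w x - w z := by
    refine intervalIntegral.integral_eq_sub_of_hasDerivAt_of_le hzx
      (fun y hy => ((hw y (hsub hy)).continuousWithinAt).mono hsub) (fun y hy => ?_) hint
    exact (hw y (hsub (Ioo_subset_Icc_self hy))).hasDerivAt
      (Icc_mem_nhds (hpz.trans_lt hy.1) (hy.2.trans_le hxq))
  have hmono : ∫ y in z..x, (w' y) ^ 2 ≤ ∫ y in p..q, (w' y) ^ 2 :=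
    intervalIntegral.integral_mono_interval hpz hzx hxq
      (Filter.Eventually.of_forall fun y => sq_nonneg (w' y)) hint2'
  obtain ⟨c, hc⟩ : ∃ c, w x - w z = c * (q - p) :=
    ⟨(w x - w z) / (q - p), by field_simp [(sub_pos.2 hpq).ne']⟩
  have hnonneg : 0 ≤ ∫ y in z..x, ((w' y) ^ 2 - 2 * c * w' y + c ^ 2) := by
    refine intervalIntegral.integral_nonneg hzx fun y _ => ?_
    nlinarith [sq_nonneg (w' y - c)]
  rw [intervalIntegral.integral_add (hint2.sub (hint.const_mul _)) (by simp),
    intervalIntegral.integral_sub hint2 (hint.const_mul _),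
    intervalIntegral.integral_const_mul, hftc, intervalIntegral.integral_const, smul_eq_mul,
    hc] at hnonneg
  rw [hc]
  have hlen : (x - z) * c ^ 2 ≤ (q - p) * c ^ 2 :=
    mul_le_mul_of_nonneg_right (by linarith) (sq_nonneg c)
  have hle : c ^ 2 * (q - p) ≤ ∫ y in p..q, (w' y) ^ 2 := by nlinarith
  nlinarith [mul_le_mul_of_nonneg_left hle (sub_pos.2 hpq).le]

/-- A nonnegative weight `g` of mass `(q - p) ^ 2 / 2` tested against a function bounded in the
square by `(q - p) * D`. -/
theorem abs_div_sq_mul_integral_le {p q m D : ℝ} {w g : ℝ → ℝ} (hpq : p < q)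
    (hg : Continuous g) (hg0 : ∀ y ∈ Icc p q, 0 ≤ g y)
    (hgi : ∫ y in p..q, g y = (q - p) ^ 2 / 2)
    (hm : m ^ 2 ≤ (q - p) * D) (hw : ∀ y ∈ Icc p q, w y ^ 2 ≤ (q - p) * D) :
    |m / (q - p) ^ 2 * ∫ y in p..q, w y * g y| ≤ (q - p) * D / 2 := by
  have hpos : 0 < q - p := sub_pos.2 hpq
  have hint : IntervalIntegrable (fun y => (q - p) * D * g y) volume p q :=
    (continuous_const.mul hg).intervalIntegrable _ _
  have key : |∫ y in p..q, m * (w y * g y)| ≤ ∫ y in p..q, (q - p) * D * g y := by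
    rw [← Real.norm_eq_abs]
    refine intervalIntegral.norm_integral_le_of_norm_le hpq.le
      (Filter.Eventually.of_forall fun y hy => ?_) hint
    have hy' := Ioc_subset_Icc_self hy
    rw [Real.norm_eq_abs, ← mul_assoc, abs_mul, abs_of_nonneg (hg0 y hy')]
    refine mul_le_mul_of_nonneg_right (abs_le.2 ⟨?_, ?_⟩) (hg0 y hy')
    · nlinarith [hw y hy', sq_nonneg (m + w y)]
    · nlinarith [hw y hy', sq_nonneg (m - w y)]
  rw [intervalIntegral.integral_const_mul, intervalIntegral.integral_const_mul, hgi] at key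
  rw [div_mul_eq_mul_div, abs_div, abs_of_pos (pow_pos hpos 2), div_le_iff₀ (pow_pos hpos 2)]
  linarith

/-- Estimate for the full term `A₁` obtained by testing with the hat function peaked at `h`. -/
theorem A1_estimate (h : ℝ) (hh : h ∈ Set.Ioo (-1 : ℝ) 1) (w w' : ℝ → ℝ)
    (hw : ∀ y ∈ Set.Icc (-1 : ℝ) 1, HasDerivWithinAt w (w' y) (Set.Icc (-1 : ℝ) 1) y)
    (hw' : ContinuousOn w' (Set.Icc (-1 : ℝ) 1))
    (hwl : w (-1) = 0) (hwr : w 1 = 0) :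
    |-(w h / (1 + h) ^ 2) * (∫ y in (-1 : ℝ)..h, w y * (1 + y))
        + (w h / (1 - h) ^ 2) * (∫ y in h..(1 : ℝ), w y * (1 - y))|
      ≤ 6 * ∫ y in (-1 : ℝ)..1, (w' y) ^ 2 := by
  obtain ⟨h1, h2⟩ := hh
  have hsl : Icc (-1) h ⊆ Icc (-1 : ℝ) 1 := Icc_subset_Icc_right h2.le
  have hsr : Icc h 1 ⊆ Icc (-1 : ℝ) 1 := Icc_subset_Icc_left h1.le
  have hl : ∀ y ∈ Icc (-1) h, w y ^ 2 ≤ (h - -1) * ∫ y in (-1 : ℝ)..h, (w' y) ^ 2 := by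
    intro y hy
    simpa [hwl] using sq_sub_le_mul_integral_sq_deriv
      (fun y hy => (hw y (hsl hy)).mono hsl) (hw'.mono hsl) le_rfl hy.1 hy.2 h1
  have hr : ∀ y ∈ Icc h 1, w y ^ 2 ≤ (1 - h) * ∫ y in h..(1 : ℝ), (w' y) ^ 2 := by
    intro y hy
    simpa [hwr] using sq_sub_le_mul_integral_sq_deriv
      (fun y hy => (hw y (hsr hy)).mono hsr) (hw'.mono hsr) hy.1 hy.2 le_rfl h2
  have hgl : ∫ y in (-1 : ℝ)..h, (1 + y) = (h - -1) ^ 2 / 2 := by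
    rw [intervalIntegral.integral_add (by simp) (by simp), intervalIntegral.integral_const,
      integral_id, smul_eq_mul]
    ring
  have hgr : ∫ y in h..(1 : ℝ), (1 - y) = (1 - h) ^ 2 / 2 := by
    rw [intervalIntegral.integral_sub (by simp) (by simp), intervalIntegral.integral_const,
      integral_id, smul_eq_mul]
    ring
  have hL := abs_div_sq_mul_integral_le (g := fun y => 1 + y) h1 (by fun_prop)
    (fun y hy => by linarith [hy.1]) hgl (hl h (right_mem_Icc.2 h1.le)) hl
  have hR := abs_div_sq_mul_integral_le (g := fun y => 1 - y) h2 (by fun_prop)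
    (fun y hy => by linarith [hy.2]) hgr (hr h (left_mem_Icc.2 h2.le)) hr
  have hsplit := intervalIntegral.integral_add_adjacent_intervals
    (((hw'.mono hsl).pow 2).intervalIntegrable_of_Icc (μ := volume) h1.le)
    (((hw'.mono hsr).pow 2).intervalIntegrable_of_Icc (μ := volume) h2.le)
  have hD1 : 0 ≤ ∫ y in (-1 : ℝ)..h, (w' y) ^ 2 :=
    intervalIntegral.integral_nonneg h1.le fun y _ => sq_nonneg _
  have hD2 : 0 ≤ ∫ y in h..(1 : ℝ), (w' y) ^ 2 :=
    intervalIntegral.integral_nonneg h2.le fun y _ => sq_nonneg _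
  simp only [Pi.pow_apply] at hsplit
  rw [← hsplit]
  rw [show h - -1 = 1 + h by ring] at hL
  rw [neg_mul]
  refine (abs_add_le _ _).trans ?_
  rw [abs_neg]
  nlinarith
end

section
/- Let a ≥ 0, let g, d, P ∈ ℝ, let K > 0, and let ε satisfy 0 ≤ ε ≤ min{1/8, K/8}. Assume |P| ≤ √(2a) + |g|. Define E = a + g² + K d² and V = E − ε d P. Then (1/4)E ≤ V ≤ 2E and (1/4)V ≤ E ≤ 2V. -/
open Real

/-- Square form of the bound on a quantity controlled by a square root and an absolute value. -/
lemma sq_le_of_abs_le_sqrt_add_abs {b g P : ℝ} (hb : 0 ≤ b) (hP : |P| ≤ Real.sqrt b + |g|) :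
    P ^ 2 ≤ 2 * b + 2 * g ^ 2 := by
  calc P ^ 2 = |P| ^ 2 := (sq_abs P).symm
    _ ≤ (Real.sqrt b + |g|) ^ 2 := by gcongr
    _ ≤ 2 * (Real.sqrt b ^ 2 + |g| ^ 2) := add_sq_le
    _ = 2 * b + 2 * g ^ 2 := by rw [Real.sq_sqrt hb, sq_abs]; ring

/-- Norm-equivalence between the energy `E` and the perturbed Lyapunov function `V`. -/
theorem lyapunov_equivalence (a g d P K ε E V : ℝ) (ha : 0 ≤ a) (hK : 0 < K)
    (hε0 : 0 ≤ ε) (hε : ε ≤ min (1 / 8) (K / 8))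
    (hP : |P| ≤ Real.sqrt (2 * a) + |g|)
    (hE : E = a + g ^ 2 + K * d ^ 2) (hV : V = E - ε * d * P) :
    (1 / 4) * E ≤ V ∧ V ≤ 2 * E ∧ (1 / 4) * V ≤ E ∧ E ≤ 2 * V := by
  obtain ⟨hε1, hεK⟩ := le_min_iff.mp hε
  have hP2 : P ^ 2 ≤ 2 * (2 * a) + 2 * g ^ 2 := sq_le_of_abs_le_sqrt_add_abs (by positivity) hP
  have hεP : ε * P ^ 2 ≤ 1 / 8 * P ^ 2 := by gcongr
  have hεd : ε * d ^ 2 ≤ K / 8 * d ^ 2 := by gcongr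
  have hg : 0 ≤ g ^ 2 := sq_nonneg g
  have hKd : 0 ≤ K * d ^ 2 := by positivity
  have hadd : 0 ≤ ε * (d + P) ^ 2 := by positivity
  have hsub : 0 ≤ ε * (d - P) ^ 2 := by positivity
  refine ⟨?_, ?_, ?_, ?_⟩ <;> linarith
end

section
/- Let f : [0,∞) → ℝ be continuous, nonnegative and integrable on (0,∞); let u : [0,∞) → ℝ be differentiable with |u'(t)| ≤ B for all t ≥ 0 and some constant B ≥ 0; let c ≥ 0; and assume that the function t ↦ f(t) + c·u(t)² is nonincreasing on [0,∞). Then f(t) → 0 as t → ∞. -/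
open Real Set MeasureTheory Filter

/-- A nonnegative integrable function on `(0,∞)` whose increments are bounded above by those of a
linear function tends to zero at infinity. -/
theorem tendsto_zero_of_integrableOn_of_le_add_mul {f : ℝ → ℝ} {L : ℝ} (hL : 0 ≤ L)
    (hf_nonneg : ∀ t, 0 ≤ t → 0 ≤ f t) (hf_int : IntegrableOn f (Ioi 0))
    (hf_le : ∀ s t, 0 ≤ s → s ≤ t → f t ≤ f s + L * (t - s)) :
    Tendsto f atTop (nhds 0) := by
  have hint : ∀ a b, 0 ≤ a → a ≤ b → IntervalIntegrable f volume a b := fun a b ha hab =>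
    (intervalIntegrable_iff_integrableOn_Ioc_of_le hab).2
      (hf_int.mono_set fun x hx => ha.trans_lt hx.1)
  have htail : ∀ δ > 0, Tendsto (fun t => ∫ s in (t - δ)..t, f s) atTop (nhds 0) := by
    intro δ hδ
    have h₁ := intervalIntegral_tendsto_integral_Ioi 0 hf_int tendsto_id
    have h₂ := intervalIntegral_tendsto_integral_Ioi 0 hf_int
      (tendsto_atTop_add_const_right atTop (-δ) tendsto_id)
    have h := h₁.sub h₂
    rw [sub_self] at h
    refine h.congr' ?_
    filter_upwards [eventually_ge_atTop δ] with t ht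
    exact intervalIntegral.integral_interval_sub_left (hint _ _ le_rfl (hδ.le.trans ht))
      (hint _ _ le_rfl (by simpa using ht))
  have hbound : ∀ δ > 0, ∀ t, δ ≤ t → δ * (f t - L * δ) ≤ ∫ s in (t - δ)..t, f s := by
    intro δ hδ t ht
    have h := intervalIntegral.integral_mono_on (a := t - δ) (b := t) (μ := volume)
      (f := fun _ => f t - L * δ) (g := f) (by linarith) intervalIntegrable_const
      (hint _ _ (by linarith) (by linarith)) fun s hs => by
        have h₁ := hf_le s t (by linarith [hs.1]) hs.2
        have h₂ : L * (t - s) ≤ L * δ := mul_le_mul_of_nonneg_left (by linarith [hs.1]) hL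
        linarith
    simpa only [intervalIntegral.integral_const, smul_eq_mul, sub_sub_cancel] using h
  rw [Metric.tendsto_atTop']
  intro ε hε
  set δ := ε / (2 * (L + 1)) with hδ_def
  have hδ : 0 < δ := by positivity
  have hLδ : L * δ ≤ ε / 2 := by
    have : (L + 1) * δ = ε / 2 := by rw [hδ_def]; field_simp
    linarith
  obtain ⟨T, hT⟩ := eventually_atTop.1
    ((htail δ hδ).eventually_lt_const (show 0 < δ * (ε / 2) by positivity))
  refine ⟨max T δ, fun t ht => ?_⟩
  have hδt : δ ≤ t := (le_max_right T δ).trans ht.le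
  have h := (hbound δ hδ t hδt).trans_lt (hT t ((le_max_left T δ).trans ht.le))
  have h' := lt_of_mul_lt_mul_left h hδ.le
  rw [Real.dist_eq, sub_zero, abs_of_nonneg (hf_nonneg t (hδ.le.trans hδt))]
  linarith

/-- If `f` is continuous, nonnegative and integrable on `(0,∞)`, `u` has a bounded derivative
and `f + c·u²` is nonincreasing on `[0,∞)`, then `f(t) → 0` as `t → ∞`. -/
theorem energy_tendsto_zero (f u u' : ℝ → ℝ) (B c : ℝ)
    (hf_cont : ContinuousOn f (Set.Ici 0))
    (hf_nonneg : ∀ t, 0 ≤ t → 0 ≤ f t)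
    (hf_int : MeasureTheory.IntegrableOn f (Set.Ioi 0))
    (hB : 0 ≤ B)
    (hu : ∀ t, 0 ≤ t → HasDerivWithinAt u (u' t) (Set.Ici 0) t)
    (hu' : ∀ t, 0 ≤ t → |u' t| ≤ B)
    (hc : 0 ≤ c)
    (hmono : AntitoneOn (fun t => f t + c * (u t) ^ 2) (Set.Ici 0)) :
    Filter.Tendsto f Filter.atTop (nhds 0) := by
  set F₀ := f 0 + c * u 0 ^ 2
  have hcu : ∀ t, 0 ≤ t → |c * u t| ≤ √(c * F₀) := fun t ht => by
    apply Real.abs_le_sqrt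
    have h : f t + c * u t ^ 2 ≤ F₀ := hmono self_mem_Ici ht ht
    have h' : c * u t ^ 2 ≤ F₀ := by linarith [hf_nonneg t ht]
    calc (c * u t) ^ 2 = c * (c * u t ^ 2) := by ring
      _ ≤ c * F₀ := mul_le_mul_of_nonneg_left h' hc
  refine tendsto_zero_of_integrableOn_of_le_add_mul (L := 2 * √(c * F₀) * B) (by positivity)
    hf_nonneg hf_int fun s t hs hst => ?_
  have hLip : ‖c * u s ^ 2 - c * u t ^ 2‖ ≤ 2 * √(c * F₀) * B * ‖s - t‖ := by
    refine (convex_Ici (0 : ℝ)).norm_image_sub_le_of_norm_hasDerivWithin_le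
      (f := fun x => c * u x ^ 2) (f' := fun x => 2 * (c * u x) * u' x)
      (fun x hx => ?_) (fun x hx => ?_) (hs.trans hst) hs
    · refine (((hu x hx).pow 2).const_mul c).congr_deriv ?_
      push_cast
      ring
    · rw [Real.norm_eq_abs, abs_mul, abs_mul, abs_two]
      have := hcu x hx
      have := hu' x hx
      gcongr
  rw [Real.norm_eq_abs, Real.norm_eq_abs, abs_sub_comm s t, abs_of_nonneg (sub_nonneg.2 hst)]
    at hLip
  have hF : f t + c * u t ^ 2 ≤ f s + c * u s ^ 2 := hmono hs (hs.trans hst) hst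
  linarith [neg_abs_le (c * u s ^ 2 - c * u t ^ 2), le_abs_self (c * u s ^ 2 - c * u t ^ 2)]
end
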